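/- Let ⟨S | R⟩ be a classical C'(1/6) presentation with group G, let g ∈ G be an infinite-order element, and let γ be a bi-infinite geodesic in Cay(G,S) at finite Hausdorff distance (with respect to d_S) from the subgroup ⟨g⟩. Then g is hyperbolic for the action on the coned-off space (i.e., n ↦ gⁿ is a quasi-isometric embedding of ℤ into (G, d_{S∪W})) if and only if there exists C > 0 such that diam_{d_S}(γ ∩ Γ0) < C for every embedded relator cycle Γ0. -/

import Mathlib

/- Common definitions: words, classical C'(1/6) presentations, word metrics,
   contraction, Morse property, etc. -/

namespace GSC

open Filter

/-- A word over the alphabet `S`: a list of letters with an exponent `±1`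
(`true` = the letter, `false` = its formal inverse). -/
abbrev Word (S : Type) := List (S × Bool)

/-- The formal inverse of a word. -/
def wordInv {S : Type} (w : Word S) : Word S := (w.map fun l => (l.1, !l.2)).reverse

/-- A word is (freely) reduced if no letter is followed by its formal inverse. -/
def Reduced {S : Type} (w : Word S) : Prop :=
  List.Chain' (fun a b => a.1 ≠ b.1 ∨ a.2 = b.2) w

/-- A word is cyclically reduced if its square is reduced. -/
def CyclicallyReduced {S : Type} (w : Word S) : Prop := Reduced (w ++ w)

/-- A piece with respect to a set of relators `R`: a word occurring as a prefix of
two distinct elements of `R`. -/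
def IsPiece {S : Type} (R : Set (Word S)) (p : Word S) : Prop :=
  ∃ r₁ ∈ R, ∃ r₂ ∈ R, r₁ ≠ r₂ ∧ p <+: r₁ ∧ p <+: r₂

/-- Closure of a set of words under inversion and cyclic permutation. -/
def symmClosure {S : Type} (R : Set (Word S)) : Set (Word S) :=
  {w | ∃ r ∈ R, ∃ n : ℕ, w = r.rotate n ∨ w = wordInv (r.rotate n)}

/-- A classical `C'(1/den)` collection of cyclically reduced words: after closing under
inversion and cyclic permutation, every piece `p` contained in a relator `r` satisfies
`den * |p| < |r|`. -/
def CprimeCollection {S : Type} (den : ℕ) (R : Set (Word S)) : Prop :=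
  (∀ r ∈ R, CyclicallyReduced r) ∧
  ∀ r ∈ symmClosure R, ∀ p : Word S, p <+: r → IsPiece (symmClosure R) p →
    den * p.length < r.length

/-- A classical `C'(1/6)` presentation: a set of cyclically reduced relators, closed under
inversion and cyclic permutation, in which every piece contained in a relator `r` has
length `< |r|/6`. -/
structure C6Presentation (S : Type) where
  rels : Set (Word S)
  cyclically_reduced : ∀ r ∈ rels, CyclicallyReduced r
  inv_mem : ∀ r ∈ rels, wordInv r ∈ rels
  rotate_mem : ∀ r ∈ rels, ∀ n : ℕ, r.rotate n ∈ rels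
  small_cancellation : ∀ r ∈ rels, ∀ p : Word S, p <+: r → IsPiece rels p →
    6 * p.length < r.length

/-- The element of the free group represented by a word. -/
def wordVal {S : Type} (w : Word S) : FreeGroup S :=
  (w.map fun l => (FreeGroup.of l.1) ^ (if l.2 then (1 : ℤ) else -1)).prod

/-- The group defined by a `C'(1/6)` presentation. -/
abbrev C6Presentation.Grp {S : Type} (P : C6Presentation S) : Type :=
  PresentedGroup (wordVal '' P.rels)

/-- The generating set of the presented group (the images of the letters of `S`). -/
def C6Presentation.gens {S : Type} (P : C6Presentation S) : Set P.Grp :=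
  Set.range fun a : S => (PresentedGroup.of a : P.Grp)

/-- The element of the presented group represented by a word. -/
def C6Presentation.elt {S : Type} (P : C6Presentation S) (w : Word S) : P.Grp :=
  (w.map fun l => (PresentedGroup.of l.1 : P.Grp) ^ (if l.2 then (1 : ℤ) else -1)).prod

/-- The word length of `g` with respect to a generating set `S ⊆ G`: the least `n`
such that `g` is a product of `n` elements of `S ∪ S⁻¹`. -/
noncomputable def wordLength {G : Type*} [Group G] (S : Set G) (g : G) : ℕ :=
  sInf {n : ℕ | ∃ l : List G, l.length = n ∧ (∀ x ∈ l, x ∈ S ∨ x⁻¹ ∈ S) ∧ l.prod = g}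

/-- The word metric on `G` with respect to `S`, as a real-valued function. -/
noncomputable def wdist {G : Type*} [Group G] (S : Set G) (g h : G) : ℝ :=
  (wordLength S (g⁻¹ * h) : ℝ)

/-- Distance from a point to a subset, in the word metric. -/
noncomputable def setDist {G : Type*} [Group G] (S : Set G) (x : G) (Y : Set G) : ℝ :=
  sInf (wdist S x '' Y)

/-- Closest point projection to a subset `Y`, in the word metric. -/
def proj {G : Type*} [Group G] (S : Set G) (Y : Set G) (x : G) : Set G :=
  {y ∈ Y | wdist S x y = setDist S x Y}

/-- Diameter of a subset, in the word metric. -/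
noncomputable def setDiam {G : Type*} [Group G] (S : Set G) (A : Set G) : ℝ :=
  sSup {d : ℝ | ∃ x ∈ A, ∃ y ∈ A, d = wdist S x y}

/-- Admissibility of a pair of contraction gauges `(ρ₁, ρ₂)`: both non-decreasing and
eventually non-negative, `ρ₁ r ≤ r`, `ρ₁` unbounded, and `ρ₂/ρ₁ → 0` at infinity. -/
def Admissible (ρ₁ ρ₂ : ℝ → ℝ) : Prop :=
  Monotone ρ₁ ∧ Monotone ρ₂ ∧
  (∀ᶠ r in atTop, 0 ≤ ρ₁ r) ∧ (∀ᶠ r in atTop, 0 ≤ ρ₂ r) ∧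
  (∀ r : ℝ, ρ₁ r ≤ r) ∧ (∀ M : ℝ, ∃ r : ℝ, M ≤ ρ₁ r) ∧
  Tendsto (fun r => ρ₂ r / ρ₁ r) atTop (nhds 0)

/-- `Y` is `(ρ₁,ρ₂)`-contracting inside the subspace `X` (with the metric induced by the
word metric of `S`): whenever `x, x' ∈ X` satisfy `d(x,x') ≤ ρ₁(d(x,Y))`, the projections
`π(x) ∪ π(x')` have diameter at most `ρ₂(d(x,Y))`. -/
def ContractingIn {G : Type*} [Group G] (S : Set G) (X Y : Set G) (ρ₁ ρ₂ : ℝ → ℝ) : Prop :=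
  Admissible ρ₁ ρ₂ ∧
  ∀ x ∈ X, ∀ x' ∈ X, wdist S x x' ≤ ρ₁ (setDist S x Y) →
    ∀ y ∈ proj S Y x ∪ proj S Y x', ∀ y' ∈ proj S Y x ∪ proj S Y x',
      wdist S y y' ≤ ρ₂ (setDist S x Y)

/-- `Y` is `(ρ₁,ρ₂)`-contracting in `Cay(G,S)`. -/
def ContractingWith {G : Type*} [Group G] (S : Set G) (ρ₁ ρ₂ : ℝ → ℝ) (Y : Set G) : Prop :=
  ContractingIn S Set.univ Y ρ₁ ρ₂

/-- `Y` is strongly contracting: `(r, C)`-contracting for some constant `C`. -/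
def StronglyContracting {G : Type*} [Group G] (S : Set G) (Y : Set G) : Prop :=
  ∃ C : ℝ, ContractingWith S (fun r => r) (fun _ => C) Y

/-- A sublinear function: non-decreasing, eventually non-negative, `f(r)/r → 0`. -/
def Sublinear (f : ℝ → ℝ) : Prop :=
  Monotone f ∧ (∀ᶠ r in atTop, 0 ≤ f r) ∧ Tendsto (fun r => f r / r) atTop (nhds 0)

/-- `f ⪯ g`: there are constants `C₁, C₂ > 0` and `C₃, C₄ ≥ 0` with
`f(x) ≤ C₁ g(C₂ x + C₃) + C₄` for all `x`. -/
def Preceq (f g : ℝ → ℝ) : Prop :=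
  ∃ C₁ C₂ C₃ C₄ : ℝ, 0 < C₁ ∧ 0 < C₂ ∧ 0 ≤ C₃ ∧ 0 ≤ C₄ ∧
    ∀ x : ℝ, f x ≤ C₁ * g (C₂ * x + C₃) + C₄

/-- `f ≍ g`: `f ⪯ g` and `g ⪯ f`. -/
def Asymp (f g : ℝ → ℝ) : Prop := Preceq f g ∧ Preceq g f

/-- `α ⊆ G` is a geodesic of `Cay(G,S)`: the image of an isometric embedding of a
subinterval of `ℤ` into `(G, d_S)`. -/
def IsGeodesic {G : Type*} [Group G] (S : Set G) (α : Set G) : Prop :=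
  ∃ (I : Set ℤ) (γ : ℤ → G), I.OrdConnected ∧
    (∀ m ∈ I, ∀ n ∈ I, wdist S (γ m) (γ n) = |(m : ℝ) - (n : ℝ)|) ∧ α = γ '' I

/-- `α ⊆ G` is a bi-infinite geodesic of `Cay(G,S)`. -/
def IsBiInfGeodesic {G : Type*} [Group G] (S : Set G) (α : Set G) : Prop :=
  ∃ γ : ℤ → G, (∀ m n : ℤ, wdist S (γ m) (γ n) = |(m : ℝ) - (n : ℝ)|) ∧ α = Set.range γ

/-- `Y` is Morse: there is `μ` such that every `(L,A)`-quasi-geodesic with endpoints on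
`Y` stays in the `μ(L,A)`-neighborhood of `Y`. -/
def IsMorse {G : Type*} [Group G] (S : Set G) (Y : Set G) : Prop :=
  ∃ μ : ℝ → ℝ → ℝ, ∀ L A : ℝ, 1 ≤ L → 0 ≤ A →
    ∀ (q : ℤ → G) (m n : ℤ), m ≤ n → q m ∈ Y → q n ∈ Y →
    (∀ i j : ℤ, m ≤ i → i ≤ n → m ≤ j → j ≤ n →
      L⁻¹ * |(i : ℝ) - (j : ℝ)| - A ≤ wdist S (q i) (q j) ∧
      wdist S (q i) (q j) ≤ L * |(i : ℝ) - (j : ℝ)| + A) →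
    ∀ i : ℤ, m ≤ i → i ≤ n → setDist S (q i) Y ≤ μ L A

/-- Two subsets are at finite Hausdorff distance in the word metric. -/
def FinHausdorffDist {G : Type*} [Group G] (S : Set G) (A B : Set G) : Prop :=
  ∃ ε : ℝ, (∀ a ∈ A, ∃ b ∈ B, wdist S a b ≤ ε) ∧ ∀ b ∈ B, ∃ a ∈ A, wdist S a b ≤ ε

/-- The embedded relator cycle determined by `g ∈ G(Γ)` and a relator `r`:
the set `{g ⋅ p̄ : p a prefix of r}`. -/
def relatorCycle {S : Type} (P : C6Presentation S) (g : P.Grp) (r : Word S) :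
    Set P.Grp :=
  {x | ∃ p : Word S, p <+: r ∧ x = g * P.elt p}

/-- A geodesic `α` is locally `(ρ₁,ρ₂)`-contracting: for every embedded relator cycle
`Γ₀` meeting `α`, the set `Γ₀ ∩ α` is `(ρ₁,ρ₂)`-contracting as a subspace of `Γ₀`. -/
def LocallyContracting {S : Type} (P : C6Presentation S) (α : Set P.Grp)
    (ρ₁ ρ₂ : ℝ → ℝ) : Prop :=
  ∀ (g : P.Grp) (r : Word S), r ∈ P.rels → (relatorCycle P g r ∩ α).Nonempty →
    ContractingIn P.gens (relatorCycle P g r) (relatorCycle P g r ∩ α) ρ₁ ρ₂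

/-- The generating set `S ∪ W` of the coned-off space: `W` is the set of elements
represented by subwords of cyclic permutations of relators (equivalently, by prefixes
of relators, since the relator set is closed under cyclic permutation). -/
def conedGens {S : Type} (P : C6Presentation S) : Set P.Grp :=
  P.gens ∪ {x | ∃ r ∈ P.rels, ∃ p : Word S, p <+: r ∧ x = P.elt p}

/-- The exponential growth rate of `(G,S)`. -/
noncomputable def growthRate {G : Type*} [Group G] (S : Set G) : ℝ :=
  limsup (fun n : ℕ => Real.log (Nat.card {g : G // wordLength S g ≤ n}) / (n : ℝ)) atTop

/-- Quasi-isometry of marked groups `(G,S)` and `(H,T)` via word metrics. -/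
def QIsom {G H : Type*} [Group G] [Group H] (S : Set G) (T : Set H) : Prop :=
  ∃ (f : G → H) (L A : ℝ), 1 ≤ L ∧ 0 ≤ A ∧
    (∀ x y : G, L⁻¹ * wdist S x y - A ≤ wdist T (f x) (f y) ∧
      wdist T (f x) (f y) ≤ L * wdist S x y + A) ∧
    ∀ h : H, ∃ x : G, wdist T (f x) h ≤ A

/-- A subgroup is virtually cyclic if it contains a cyclic subgroup of finite index. -/
def VirtuallyCyclic {G : Type*} [Group G] (E : Subgroup G) : Prop :=
  ∃ g : G, Subgroup.zpowers g ≤ E ∧ ((Subgroup.zpowers g).subgroupOf E).index ≠ 0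

end GSC
namespace GSC

/-! ### Word lengths -/

section WordLength

variable {G : Type*} [Group G] {T : Set G}

lemma wordLength_le_of_list (l : List G) (hl : ∀ x ∈ l, x ∈ T ∨ x⁻¹ ∈ T) :
    wordLength T l.prod ≤ l.length :=
  Nat.sInf_le ⟨l, rfl, hl, rfl⟩

lemma exists_list_of_closure_eq_top (hT : Subgroup.closure T = ⊤) (g : G) :
    ∃ l : List G, (∀ x ∈ l, x ∈ T ∨ x⁻¹ ∈ T) ∧ l.prod = g := by
  have hg : g ∈ Subgroup.closure T := hT ▸ Subgroup.mem_top g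
  induction hg using Subgroup.closure_induction_right with
  | one => exact ⟨[], by simp, by simp⟩
  | mul_right x _ y hy ih =>
    obtain ⟨l, hl, rfl⟩ := ih
    refine ⟨l ++ [y], ?_, by simp⟩
    intro z hz
    rcases List.mem_append.1 hz with hz | hz
    · exact hl z hz
    · rw [List.mem_singleton.1 hz]; exact Or.inl hy
  | mul_inv_cancel x _ y hy ih =>
    obtain ⟨l, hl, rfl⟩ := ih
    refine ⟨l ++ [y⁻¹], ?_, by simp⟩
    intro z hz
    rcases List.mem_append.1 hz with hz | hz
    · exact hl z hz
    · rw [List.mem_singleton.1 hz]; exact Or.inr (by simpa using hy)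

lemma exists_list_length_eq_wordLength (hT : Subgroup.closure T = ⊤) (g : G) :
    ∃ l : List G, l.length = wordLength T g ∧ (∀ x ∈ l, x ∈ T ∨ x⁻¹ ∈ T) ∧ l.prod = g := by
  obtain ⟨l, hl, hg⟩ := exists_list_of_closure_eq_top hT g
  exact Nat.sInf_mem (s := {n : ℕ | ∃ l : List G, l.length = n ∧
    (∀ x ∈ l, x ∈ T ∨ x⁻¹ ∈ T) ∧ l.prod = g}) ⟨_, l, rfl, hl, hg⟩

lemma wordLength_one : wordLength T (1 : G) = 0 :=
  Nat.le_zero.1 (wordLength_le_of_list [] (by simp))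

lemma wordLength_mul_le (hT : Subgroup.closure T = ⊤) (g h : G) :
    wordLength T (g * h) ≤ wordLength T g + wordLength T h := by
  obtain ⟨l, hl, hl', rfl⟩ := exists_list_length_eq_wordLength hT g
  obtain ⟨m, hm, hm', rfl⟩ := exists_list_length_eq_wordLength hT h
  rw [← hl, ← hm, ← List.prod_append, ← List.length_append]
  refine wordLength_le_of_list _ fun x hx => ?_
  rcases List.mem_append.1 hx with hx | hx
  exacts [hl' x hx, hm' x hx]

lemma wordLength_inv_le (hT : Subgroup.closure T = ⊤) (g : G) :
    wordLength T g⁻¹ ≤ wordLength T g := by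
  obtain ⟨l, hl, hl', rfl⟩ := exists_list_length_eq_wordLength hT g
  rw [List.prod_inv_reverse, ← hl]
  refine (wordLength_le_of_list _ fun x hx => ?_).trans (by simp)
  obtain ⟨y, hy, rfl⟩ := List.mem_map.1 (List.mem_reverse.1 hx)
  have := hl' y hy
  rw [inv_inv]
  exact this.symm

lemma wordLength_inv (hT : Subgroup.closure T = ⊤) (g : G) :
    wordLength T g⁻¹ = wordLength T g :=
  le_antisymm (wordLength_inv_le hT g) (by simpa using wordLength_inv_le hT g⁻¹)

lemma wordLength_pow_le (hT : Subgroup.closure T = ⊤) (g : G) (n : ℕ) :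
    wordLength T (g ^ n) ≤ n * wordLength T g := by
  induction n with
  | zero => simp [wordLength_one]
  | succ n ih =>
    rw [pow_succ, add_mul, one_mul]
    exact (wordLength_mul_le hT _ _).trans (Nat.add_le_add_right ih _)

lemma wordLength_zpow_le (hT : Subgroup.closure T = ⊤) (g : G) (n : ℤ) :
    wordLength T (g ^ n) ≤ n.natAbs * wordLength T g := by
  rcases Int.natAbs_eq n with h | h
  · rw [h, zpow_natCast, Int.natAbs_natCast]
    exact wordLength_pow_le hT g _
  · rw [h, zpow_neg, zpow_natCast, wordLength_inv hT, Int.natAbs_neg, Int.natAbs_natCast]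
    exact wordLength_pow_le hT g _

lemma wdist_triangle (hT : Subgroup.closure T = ⊤) (x y z : G) :
    wdist T x z ≤ wdist T x y + wdist T y z := by
  unfold wdist
  have := wordLength_mul_le hT (x⁻¹ * y) (y⁻¹ * z)
  rw [show x⁻¹ * y * (y⁻¹ * z) = x⁻¹ * z by group] at this
  exact_mod_cast this

lemma wdist_comm (hT : Subgroup.closure T = ⊤) (x y : G) : wdist T x y = wdist T y x := by
  unfold wdist
  rw [← wordLength_inv hT (x⁻¹ * y)]
  congr 2
  group

lemma wdist_nonneg (x y : G) : 0 ≤ wdist T x y := Nat.cast_nonneg _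

end WordLength

/-! ### Words and the elements they represent -/

section Words

variable {S : Type}

/-- The formal inverse of a letter. -/
abbrev invL (x : S × Bool) : S × Bool := (x.1, !x.2)

lemma invL_invL (x : S × Bool) : invL (invL x) = x := by simp [invL]

lemma invL_ne (x : S × Bool) : invL x ≠ x := by
  intro h
  have := congrArg Prod.snd h
  simp at this

lemma wordInv_eq (w : Word S) : wordInv w = (w.map invL).reverse := rfl

@[simp] lemma length_wordInv (w : Word S) : (wordInv w).length = w.length := by
  simp [wordInv]

@[simp] lemma wordInv_nil : wordInv ([] : Word S) = [] := rfl

lemma wordInv_append (u v : Word S) : wordInv (u ++ v) = wordInv v ++ wordInv u := by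
  simp [wordInv]

lemma wordInv_cons (x : S × Bool) (w : Word S) : wordInv (x :: w) = wordInv w ++ [invL x] := by
  simp [wordInv, invL]

lemma wordInv_wordInv (w : Word S) : wordInv (wordInv w) = w := by
  simp [wordInv, Function.comp_def]

lemma wordVal_eq_mk (w : Word S) : wordVal w = FreeGroup.mk w := by
  induction w with
  | nil => rfl
  | cons a w ih =>
    have h1 : FreeGroup.mk (a :: w) = FreeGroup.mk [a] * FreeGroup.mk w := by
      rw [FreeGroup.mul_mk]; rfl
    have h2 : wordVal (a :: w) = FreeGroup.of a.1 ^ (if a.2 then (1 : ℤ) else -1) * wordVal w := by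
      simp [wordVal]
    rw [h1, h2, ih]
    congr 1
    obtain ⟨x, b⟩ := a
    cases b
    · simp [FreeGroup.of, FreeGroup.inv_mk, FreeGroup.invRev]
    · simp [FreeGroup.of]

namespace C6Presentation

variable (P : C6Presentation S)

lemma elt_eq_mk (w : Word S) : P.elt w = PresentedGroup.mk _ (wordVal w) := by
  unfold elt wordVal
  rw [map_list_prod, List.map_map]
  congr 1

/-- The element represented by a letter. -/
def eltL (x : S × Bool) : P.Grp := (PresentedGroup.of x.1 : P.Grp) ^ (if x.2 then (1 : ℤ) else -1)

lemma elt_eq_prod (w : Word S) : P.elt w = (w.map P.eltL).prod := rfl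

@[simp] lemma elt_nil : P.elt [] = 1 := rfl

lemma elt_cons (x : S × Bool) (w : Word S) : P.elt (x :: w) = P.eltL x * P.elt w := by
  simp [elt_eq_prod]

lemma elt_append (u v : Word S) : P.elt (u ++ v) = P.elt u * P.elt v := by
  simp [elt_eq_prod]

lemma elt_singleton (x : S × Bool) : P.elt [x] = P.eltL x := by simp [elt_eq_prod]

lemma eltL_invL (x : S × Bool) : P.eltL (invL x) = (P.eltL x)⁻¹ := by
  obtain ⟨a, b⟩ := x
  cases b <;> simp [eltL]

lemma elt_wordInv (w : Word S) : P.elt (wordInv w) = (P.elt w)⁻¹ := by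
  induction w with
  | nil => simp
  | cons x w ih =>
    rw [wordInv_cons, elt_append, elt_singleton, eltL_invL, ih, elt_cons, mul_inv_rev]

lemma elt_eq_one_iff (w : Word S) :
    P.elt w = 1 ↔ wordVal w ∈ Subgroup.normalClosure (wordVal '' P.rels) := by
  rw [elt_eq_mk]
  exact QuotientGroup.eq_one_iff _

lemma elt_rel {r : Word S} (hr : r ∈ P.rels) : P.elt r = 1 :=
  (P.elt_eq_one_iff r).2 (Subgroup.subset_normalClosure ⟨r, hr, rfl⟩)

lemma closure_gens : Subgroup.closure P.gens = ⊤ := PresentedGroup.closure_range_of _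

lemma closure_conedGens : Subgroup.closure (conedGens P) = ⊤ :=
  top_le_iff.1 (P.closure_gens ▸ Subgroup.closure_mono Set.subset_union_left)

lemma eltL_mem (x : S × Bool) : P.eltL x ∈ P.gens ∨ (P.eltL x)⁻¹ ∈ P.gens := by
  obtain ⟨a, b⟩ := x
  cases b
  · right; exact ⟨a, by simp [eltL]⟩
  · left; exact ⟨a, by simp [eltL]⟩

lemma wordLength_elt_le (w : Word S) : wordLength P.gens (P.elt w) ≤ w.length := by
  rw [elt_eq_prod]
  refine (wordLength_le_of_list _ fun x hx => ?_).trans (by simp)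
  obtain ⟨y, -, rfl⟩ := List.mem_map.1 hx
  exact P.eltL_mem y

lemma exists_eltL {x : P.Grp} (hx : x ∈ P.gens ∨ x⁻¹ ∈ P.gens) : ∃ a, P.eltL a = x := by
  rcases hx with ⟨a, ha⟩ | ⟨a, ha⟩
  · exact ⟨(a, true), by simpa [eltL] using ha⟩
  · refine ⟨(a, false), ?_⟩
    simp only at ha
    simp [eltL, ha]

lemma exists_word (g : P.Grp) : ∃ w : Word S, w.length = wordLength P.gens g ∧ P.elt w = g := by
  obtain ⟨l, hl, hl', rfl⟩ := exists_list_length_eq_wordLength P.closure_gens g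
  rw [← hl]
  clear hl
  induction l with
  | nil => exact ⟨[], rfl, rfl⟩
  | cons x l ih =>
    obtain ⟨w, hw, hw'⟩ := ih fun y hy => hl' y (List.mem_cons_of_mem _ hy)
    obtain ⟨a, ha⟩ := P.exists_eltL (hl' x List.mem_cons_self)
    exact ⟨a :: w, by simp [hw], by rw [elt_cons, ha, hw', List.prod_cons]⟩

lemma exists_letter_of_wordLength_eq_one {g : P.Grp} (hg : wordLength P.gens g = 1) :
    ∃ a, P.eltL a = g := by
  obtain ⟨w, hw, hw'⟩ := P.exists_word g
  rw [hg] at hw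
  obtain ⟨a, rfl⟩ := List.length_eq_one_iff.1 hw
  exact ⟨a, by rw [← hw', elt_singleton]⟩

end C6Presentation

end Words

end GSC

namespace GSC

/-! ### Diagrams

A diagram on a sphere is recorded combinatorially: its darts are natural numbers, each face is
the cyclic list of darts on its boundary, and `α` exchanges the two darts of an edge. Simple
connectivity is expressed by the fact that every flat group-valued labelling of the darts is a
coboundary. -/

section Diagrams

variable {S : Type}

/-- `σ` develops the labelling `h` along the list of darts, starting from the value `b`. -/
def Develops {H : Type} [Group H] (σ h : ℕ → H) : List ℕ → H → Prop
  | [], _ => True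
  | d :: t, b => σ d = b ∧ Develops σ h t (b * h d)

section Develops

variable {H : Type} [Group H] {σ h σ' h' : ℕ → H}

@[simp] lemma develops_nil (b : H) : Develops σ h [] b := trivial

@[simp] lemma develops_cons (d : ℕ) (t : List ℕ) (b : H) :
    Develops σ h (d :: t) b ↔ σ d = b ∧ Develops σ h t (b * h d) := Iff.rfl

lemma develops_append (s t : List ℕ) (b : H) :
    Develops σ h (s ++ t) b ↔ Develops σ h s b ∧ Develops σ h t (b * (s.map h).prod) := by
  induction s generalizing b with
  | nil => simp
  | cons d s ih => simp [ih, and_assoc, mul_assoc]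

lemma Develops.congr {l : List ℕ} {b : H} (hl : Develops σ h l b)
    (hσ : ∀ d ∈ l, σ' d = σ d) (hh : ∀ d ∈ l, h' d = h d) : Develops σ' h' l b := by
  induction l generalizing b with
  | nil => trivial
  | cons d l ih =>
    rw [develops_cons] at hl ⊢
    rw [hσ d (by simp), hh d (by simp)]
    exact ⟨hl.1, ih hl.2 (fun e he => hσ e (by simp [he])) (fun e he => hh e (by simp [he]))⟩

lemma prod_map_congr {l : List ℕ} (hh : ∀ d ∈ l, h' d = h d) :
    (l.map h').prod = (l.map h).prod := by
  rw [List.map_congr_left hh]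

end Develops

/-- A diagram on the sphere with edge labels `lab`, edge involution `α` and faces `fs`. -/
structure IsDiag (lab : ℕ → S × Bool) (α : ℕ → ℕ) (fs : List (List ℕ)) : Prop where
  nodup : fs.flatten.Nodup
  mem : ∀ d ∈ fs.flatten, α d ∈ fs.flatten
  invol : ∀ d ∈ fs.flatten, α (α d) = d
  lab_inv : ∀ d ∈ fs.flatten, lab (α d) = invL (lab d)
  sc : ∀ (H : Type) [Group H] (h : ℕ → H), (∀ d ∈ fs.flatten, h (α d) = (h d)⁻¹) →
    (∀ f ∈ fs, (f.map h).prod = 1) →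
    ∃ σ : ℕ → H, (∀ d ∈ fs.flatten, σ (α d) = σ d * h d) ∧ ∀ f ∈ fs, ∃ b, Develops σ h f b

namespace IsDiag

variable {lab : ℕ → S × Bool} {α : ℕ → ℕ} {fs gs : List (List ℕ)}

lemma ne (hD : IsDiag lab α fs) {d : ℕ} (hd : d ∈ fs.flatten) : α d ≠ d := by
  intro h
  have := hD.lab_inv d hd
  rw [h] at this
  exact invL_ne _ this.symm

lemma inj (hD : IsDiag lab α fs) {d e : ℕ} (hd : d ∈ fs.flatten) (he : e ∈ fs.flatten)
    (h : α d = α e) : d = e := by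
  rw [← hD.invol d hd, h, hD.invol e he]

lemma nil : IsDiag lab α [[]] where
  nodup := by simp
  mem := by simp
  invol := by simp
  lab_inv := by simp
  sc := fun H _ h _ _ => ⟨fun _ => 1, by simp, by simp⟩

lemma perm (hD : IsDiag lab α fs) (h : fs.Perm gs) : IsDiag lab α gs := by
  have hp : fs.flatten.Perm gs.flatten := h.flatten
  have hm : ∀ {d}, d ∈ gs.flatten ↔ d ∈ fs.flatten := fun {d} => hp.mem_iff.symm
  refine ⟨hp.nodup_iff.1 hD.nodup, ?_, ?_, ?_, ?_⟩
  · intro d hd; exact hm.2 (hD.mem d (hm.1 hd))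
  · intro d hd; exact hD.invol d (hm.1 hd)
  · intro d hd; exact hD.lab_inv d (hm.1 hd)
  · intro H _ k h1 h2
    obtain ⟨σ, h3, h4⟩ := hD.sc H k (fun d hd => h1 d (hm.2 hd)) (fun f hf => h2 f (h.mem_iff.1 hf))
    exact ⟨σ, fun d hd => h3 d (hm.1 hd), fun f hf => h4 f (h.mem_iff.2 hf)⟩

lemma rotate (s t : List ℕ) (hD : IsDiag lab α ((s ++ t) :: fs)) :
    IsDiag lab α ((t ++ s) :: fs) := by
  have hp : ((s ++ t) :: fs).flatten.Perm ((t ++ s) :: fs).flatten := by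
    simp only [List.flatten_cons]
    exact List.Perm.append_right _ List.perm_append_comm
  have hm : ∀ {d}, d ∈ ((t ++ s) :: fs).flatten ↔ d ∈ ((s ++ t) :: fs).flatten :=
    fun {d} => hp.mem_iff.symm
  refine ⟨hp.nodup_iff.1 hD.nodup, ?_, ?_, ?_, ?_⟩
  · intro d hd; exact hm.2 (hD.mem d (hm.1 hd))
  · intro d hd; exact hD.invol d (hm.1 hd)
  · intro d hd; exact hD.lab_inv d (hm.1 hd)
  · intro H _ k h1 h2
    have h2' : ∀ f ∈ (s ++ t) :: fs, (f.map k).prod = 1 := by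
      intro f hf
      rcases List.mem_cons.1 hf with rfl | hf
      · have := h2 (t ++ s) (by simp)
        simp only [List.map_append, List.prod_append] at this ⊢
        exact mul_eq_one_comm.1 this
      · exact h2 f (by simp [hf])
    obtain ⟨σ, h3, h4⟩ := hD.sc H k (fun d hd => h1 d (hm.2 hd)) h2'
    refine ⟨σ, fun d hd => h3 d (hm.1 hd), fun f hf => ?_⟩
    rcases List.mem_cons.1 hf with rfl | hf
    · obtain ⟨b, hb⟩ := h4 (s ++ t) (by simp)
      rw [develops_append] at hb
      refine ⟨b * (s.map k).prod, ?_⟩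
      rw [develops_append]
      have h5 := h2' (s ++ t) (by simp)
      simp only [List.map_append, List.prod_append] at h5
      refine ⟨hb.2, ?_⟩
      rw [mul_assoc, h5, mul_one]
      exact hb.1
    · exact h4 f (by simp [hf])

lemma split (s t : List ℕ) (hD : IsDiag lab α ((s ++ t) :: fs)) :
    IsDiag lab α (s :: t :: fs) := by
  have hp : ((s ++ t) :: fs).flatten = (s :: t :: fs).flatten := by
    simp
  refine ⟨hp ▸ hD.nodup, hp ▸ hD.mem, hp ▸ hD.invol, hp ▸ hD.lab_inv, ?_⟩
  intro H _ k h1 h2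
  have hs : (s.map k).prod = 1 := h2 s (by simp)
  have ht : (t.map k).prod = 1 := h2 t (by simp)
  obtain ⟨σ, h3, h4⟩ := hD.sc H k (hp ▸ h1) (by
    intro f hf
    rcases List.mem_cons.1 hf with rfl | hf
    · simp [hs, ht]
    · exact h2 f (by simp [hf]))
  refine ⟨σ, hp ▸ h3, fun f hf => ?_⟩
  obtain ⟨b, hb⟩ := h4 (s ++ t) (by simp)
  rw [develops_append] at hb
  rcases List.mem_cons.1 hf with rfl | hf
  · exact ⟨b, hb.1⟩
  rcases List.mem_cons.1 hf with rfl | hf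
  · exact ⟨_, hb.2⟩
  · exact h4 f (by simp [hf])

lemma of_nil_cons (hD : IsDiag lab α ([] :: fs)) : IsDiag lab α fs := by
  have hp : ([] :: fs).flatten = fs.flatten := by simp
  refine ⟨hp ▸ hD.nodup, hp ▸ hD.mem, hp ▸ hD.invol, hp ▸ hD.lab_inv, ?_⟩
  intro H _ k h1 h2
  obtain ⟨σ, h3, h4⟩ := hD.sc H k (hp ▸ h1) (by
    intro f hf
    rcases List.mem_cons.1 hf with rfl | hf
    · simp
    · exact h2 f hf)
  exact ⟨σ, hp ▸ h3, fun f hf => h4 f (by simp [hf])⟩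

lemma merge {d : ℕ} {c c' : List ℕ} (hD : IsDiag lab α ((d :: c) :: (α d :: c') :: fs)) :
    IsDiag lab α ((c ++ c') :: fs) := by
  have hold : ∀ {e}, e ∈ ((d :: c) :: (α d :: c') :: fs).flatten ↔
      e = d ∨ e = α d ∨ e ∈ ((c ++ c') :: fs).flatten := by
    intro e; simp; tauto
  have hdm : d ∈ ((d :: c) :: (α d :: c') :: fs).flatten := by simp
  have hnd := hD.nodup
  have hperm : ((d :: c) :: (α d :: c') :: fs).flatten.Perm
      (d :: α d :: ((c ++ c') :: fs).flatten) := by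
    simp only [List.flatten_cons, List.cons_append, List.append_assoc]
    exact List.Perm.cons _ List.perm_middle
  rw [hperm.nodup_iff, List.nodup_cons, List.nodup_cons] at hnd
  obtain ⟨hd1, hd2, hnd⟩ := hnd
  have hd1' : d ∉ ((c ++ c') :: fs).flatten := fun h => hd1 (List.mem_cons_of_mem _ h)
  have hne : α d ≠ d := hD.ne hdm
  have hnm : ∀ e ∈ ((c ++ c') :: fs).flatten, e ≠ d ∧ e ≠ α d :=
    fun e he => ⟨fun h => hd1' (h ▸ he), fun h => hd2 (h ▸ he)⟩
  have hmem : ∀ e ∈ ((c ++ c') :: fs).flatten, α e ∈ ((c ++ c') :: fs).flatten := by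
    intro e he
    have heo := hold.2 (Or.inr (Or.inr he))
    rcases hold.1 (hD.mem e heo) with h | h | h
    · exact absurd (by rw [← h, hD.invol e heo]) (hnm e he).2
    · exact absurd (hD.inj heo hdm h) (hnm e he).1
    · exact h
  refine ⟨hnd, hmem, fun e he => hD.invol e (hold.2 (Or.inr (Or.inr he))),
    fun e he => hD.lab_inv e (hold.2 (Or.inr (Or.inr he))), ?_⟩
  intro H _ k h1 h2
  set p := (c.map k).prod with hp
  set p' := (c'.map k).prod with hp'
  have hpp : p * p' = 1 := by simpa using h2 (c ++ c') (by simp)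
  let k' : ℕ → H := fun e => if e = d then p⁻¹ else if e = α d then p else k e
  have hkd : k' d = p⁻¹ := by simp [k']
  have hkd' : k' (α d) = p := by simp [k', hne]
  have hke : ∀ e ∈ ((c ++ c') :: fs).flatten, k' e = k e := by
    intro e he; simp [k', (hnm e he).1, (hnm e he).2]
  have hkc : (c.map k').prod = p := prod_map_congr fun e he => hke e (by simp [he])
  have hkc' : (c'.map k').prod = p' := prod_map_congr fun e he => hke e (by simp [he])
  obtain ⟨σ, h3, h4⟩ := hD.sc H k' (by
    intro e he
    rcases hold.1 he with rfl | rfl | he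
    · rw [hkd, hkd', inv_inv]
    · rw [hD.invol d hdm, hkd, hkd']
    · rw [hke e he, hke _ (hmem e he), h1 e he]) (by
    intro f hf
    rcases List.mem_cons.1 hf with rfl | hf
    · rw [List.map_cons, List.prod_cons, hkd, hkc, inv_mul_cancel]
    rcases List.mem_cons.1 hf with rfl | hf
    · rw [List.map_cons, List.prod_cons, hkd', hkc', hpp]
    · rw [prod_map_congr (h := k) fun e he => hke e (by simp; exact Or.inr (Or.inr ⟨f, hf, he⟩))]
      exact h2 f (by simp [hf]))
  refine ⟨σ, fun e he => by rw [h3 e (hold.2 (Or.inr (Or.inr he))), hke e he], fun f hf => ?_⟩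
  rcases List.mem_cons.1 hf with rfl | hf
  · obtain ⟨b, hb⟩ := h4 (d :: c) (by simp)
    obtain ⟨b', hb'⟩ := h4 (α d :: c') (by simp)
    rw [develops_cons] at hb hb'
    have hbb : b' = b * p⁻¹ := by rw [← hb'.1, h3 d hdm, hb.1, hkd]
    refine ⟨b * p⁻¹, ?_⟩
    rw [develops_append]
    refine ⟨?_, ?_⟩
    · rw [← hkd]
      exact hb.2.congr (fun _ _ => rfl) fun e he => (hke e (by simp [he])).symm
    · have h5 := hb'.2
      rw [hbb, hkd'] at h5
      exact h5.congr (fun _ _ => rfl) fun e he => (hke e (by simp [he])).symm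
  · obtain ⟨b, hb⟩ := h4 f (by simp [hf])
    exact ⟨b, hb.congr (fun _ _ => rfl) fun e he =>
      (hke e (by simp; exact Or.inr (Or.inr ⟨f, hf, he⟩))).symm⟩

lemma spur {t : List ℕ} (hD : IsDiag lab α (t :: fs)) {x x' : ℕ}
    (hx : x ∉ (t :: fs).flatten) (hx' : x' ∉ (t :: fs).flatten) (hne : x ≠ x') (a : S × Bool) :
    IsDiag (Function.update (Function.update lab x a) x' (invL a))
      (Function.update (Function.update α x x') x' x) ((x :: x' :: t) :: fs) := by
  set lab' := Function.update (Function.update lab x a) x' (invL a)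
  set α' := Function.update (Function.update α x x') x' x
  have hnew : ∀ {e}, e ∈ ((x :: x' :: t) :: fs).flatten ↔
      e = x ∨ e = x' ∨ e ∈ (t :: fs).flatten := by
    intro e; simp
  have hnm : ∀ e ∈ (t :: fs).flatten, e ≠ x ∧ e ≠ x' :=
    fun e he => ⟨fun h => hx (h ▸ he), fun h => hx' (h ▸ he)⟩
  have hαx : α' x = x' := by simp [α', Function.update_of_ne hne]
  have hαx' : α' x' = x := by simp [α']
  have hαe : ∀ e ∈ (t :: fs).flatten, α' e = α e := fun e he => by
    simp [α', Function.update_of_ne (hnm e he).1, Function.update_of_ne (hnm e he).2]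
  have hlx : lab' x = a := by simp [lab', Function.update_of_ne hne]
  have hlx' : lab' x' = invL a := by simp [lab']
  have hle : ∀ e ∈ (t :: fs).flatten, lab' e = lab e := fun e he => by
    simp [lab', Function.update_of_ne (hnm e he).1, Function.update_of_ne (hnm e he).2]
  refine ⟨?_, ?_, ?_, ?_, ?_⟩
  · have : ((x :: x' :: t) :: fs).flatten = x :: x' :: (t :: fs).flatten := by simp
    rw [this, List.nodup_cons, List.nodup_cons]
    refine ⟨?_, hx', hD.nodup⟩
    rw [List.mem_cons]
    tauto
  · intro e he
    rcases hnew.1 he with rfl | rfl | he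
    · rw [hαx]; simp
    · rw [hαx']; simp
    · rw [hαe e he]; exact hnew.2 (Or.inr (Or.inr (hD.mem e he)))
  · intro e he
    rcases hnew.1 he with rfl | rfl | he
    · rw [hαx, hαx']
    · rw [hαx', hαx]
    · rw [hαe e he, hαe _ (hD.mem e he), hD.invol e he]
  · intro e he
    rcases hnew.1 he with rfl | rfl | he
    · rw [hαx, hlx, hlx']
    · rw [hαx', hlx, hlx', invL_invL]
    · rw [hαe e he, hle e he, hle _ (hD.mem e he), hD.lab_inv e he]
  · intro H _ k h1 h2
    have hk : k x' = (k x)⁻¹ := by rw [← h1 x (by simp), hαx]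
    obtain ⟨σ, h3, h4⟩ := hD.sc H k
      (fun e he => by rw [← hαe e he]; exact h1 e (hnew.2 (Or.inr (Or.inr he)))) (by
      intro f hf
      rcases List.mem_cons.1 hf with rfl | hf
      · have := h2 (x :: x' :: f) (by simp)
        simpa [hk] using this
      · exact h2 f (by simp [hf]))
    obtain ⟨b, hb⟩ := h4 t (by simp)
    let σ' : ℕ → H := Function.update (Function.update σ x b) x' (b * k x)
    have hσx : σ' x = b := by simp [σ', Function.update_of_ne hne]
    have hσx' : σ' x' = b * k x := by simp [σ']
    have hσe : ∀ e ∈ (t :: fs).flatten, σ' e = σ e := fun e he => by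
      simp [σ', Function.update_of_ne (hnm e he).1, Function.update_of_ne (hnm e he).2]
    refine ⟨σ', ?_, ?_⟩
    · intro e he
      rcases hnew.1 he with rfl | rfl | he
      · rw [hαx, hσx, hσx']
      · rw [hαx', hσx, hσx', hk]; group
      · rw [hαe e he, hσe e he, hσe _ (hD.mem e he), h3 e he]
    · intro f hf
      rcases List.mem_cons.1 hf with rfl | hf
      · refine ⟨b, ?_⟩
        rw [develops_cons, develops_cons, hk, mul_inv_cancel_right]
        exact ⟨hσx, hσx', hb.congr (fun e he => hσe e (by simp [he])) fun _ _ => rfl⟩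
      · obtain ⟨b', hb'⟩ := h4 f (by simp [hf])
        exact ⟨b', hb'.congr (fun e he => hσe e (by simp; exact Or.inr ⟨f, hf, he⟩))
          fun _ _ => rfl⟩

lemma fold {t : List ℕ} {x x' : ℕ} (hD : IsDiag lab α ((x :: x' :: t) :: fs))
    (hlab : lab x' = invL (lab x)) : ∃ α', IsDiag lab α' (t :: fs) := by
  have hold : ∀ {e}, e ∈ ((x :: x' :: t) :: fs).flatten ↔
      e = x ∨ e = x' ∨ e ∈ (t :: fs).flatten := by
    intro e; simp
  have hnd := hD.nodup
  have heq : ((x :: x' :: t) :: fs).flatten = x :: x' :: (t :: fs).flatten := by simp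
  rw [heq, List.nodup_cons, List.nodup_cons] at hnd
  obtain ⟨hx, hx', hnd⟩ := hnd
  rw [List.mem_cons, not_or] at hx
  obtain ⟨hne, hx⟩ := hx
  have hnm : ∀ e ∈ (t :: fs).flatten, e ≠ x ∧ e ≠ x' :=
    fun e he => ⟨fun h => hx (h ▸ he), fun h => hx' (h ▸ he)⟩
  have hxm : x ∈ ((x :: x' :: t) :: fs).flatten := by simp
  have hxm' : x' ∈ ((x :: x' :: t) :: fs).flatten := by simp
  have hin : ∀ e ∈ (t :: fs).flatten, e ∈ ((x :: x' :: t) :: fs).flatten :=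
    fun e he => hold.2 (Or.inr (Or.inr he))
  have hflat : ∀ f ∈ fs, ∀ e ∈ f, e ∈ (t :: fs).flatten := fun f hf e he => by
    simp; exact Or.inr ⟨f, hf, he⟩
  by_cases hα : α x = x'
  · have hα' : α x' = x := by rw [← hα, hD.invol x hxm]
    have hmem : ∀ e ∈ (t :: fs).flatten, α e ∈ (t :: fs).flatten := by
      intro e he
      rcases hold.1 (hD.mem e (hin e he)) with h | h | h
      · exact absurd (hD.inj (hin e he) hxm' (by rw [h, hα'])) (hnm e he).2
      · exact absurd (hD.inj (hin e he) hxm (by rw [h, hα])) (hnm e he).1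
      · exact h
    refine ⟨α, hnd, hmem, fun e he => hD.invol e (hin e he), fun e he => hD.lab_inv e (hin e he),
      ?_⟩
    intro H _ k h1 h2
    let k' : ℕ → H := fun e => if e = x then 1 else if e = x' then 1 else k e
    have hkx : k' x = 1 := by simp [k']
    have hkx' : k' x' = 1 := by simp [k']
    have hke : ∀ e ∈ (t :: fs).flatten, k' e = k e := by
      intro e he; simp [k', (hnm e he).1, (hnm e he).2]
    obtain ⟨σ, h3, h4⟩ := hD.sc H k' (by
      intro e he
      rcases hold.1 he with rfl | rfl | he
      · rw [hα, hkx, hkx', inv_one]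
      · rw [hα', hkx, hkx', inv_one]
      · rw [hke e he, hke _ (hmem e he), h1 e he]) (by
      intro f hf
      rcases List.mem_cons.1 hf with rfl | hf
      · simp only [List.map_cons, List.prod_cons, hkx, hkx', one_mul]
        rw [prod_map_congr (h := k) fun e he => hke e (by simp [he])]
        exact h2 t (by simp)
      · rw [prod_map_congr (h := k) fun e he => hke e (hflat f hf e he)]
        exact h2 f (by simp [hf]))
    refine ⟨σ, fun e he => by rw [h3 e (hin e he), hke e he], fun f hf => ?_⟩
    rcases List.mem_cons.1 hf with rfl | hf
    · obtain ⟨b, hb⟩ := h4 _ List.mem_cons_self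
      rw [develops_cons, develops_cons] at hb
      exact ⟨_, hb.2.2.congr (fun _ _ => rfl) fun e he => (hke e (by simp [he])).symm⟩
    · obtain ⟨b, hb⟩ := h4 f (by simp [hf])
      exact ⟨b, hb.congr (fun _ _ => rfl) fun e he => (hke e (hflat f hf e he)).symm⟩
  · set a := α x with ha
    set a' := α x' with ha'
    have hax : α a = x := hD.invol x hxm
    have hax' : α a' = x' := hD.invol x' hxm'
    have ham : a ∈ (t :: fs).flatten := by
      rcases hold.1 (hD.mem x hxm) with h | h | h
      · exact absurd h (hD.ne hxm)
      · exact absurd h hα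
      · exact h
    have ham' : a' ∈ (t :: fs).flatten := by
      rcases hold.1 (hD.mem x' hxm') with h | h | h
      · exact absurd (by rw [ha, ← h]; exact hax') hα
      · exact absurd h (hD.ne hxm')
      · exact h
    have haa : a ≠ a' := fun h => hne (hD.inj hxm hxm' h)
    let β : ℕ → ℕ := fun e => if e = a then a' else if e = a' then a else α e
    have hβa : β a = a' := by simp [β]
    have hβa' : β a' = a := by simp [β]
    have hβe : ∀ e, e ≠ a → e ≠ a' → β e = α e := fun e h h' => by simp [β, h, h']
    have hmem : ∀ e ∈ (t :: fs).flatten, e ≠ a → e ≠ a' →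
        α e ∈ (t :: fs).flatten ∧ α e ≠ a ∧ α e ≠ a' := by
      intro e he h h'
      refine ⟨?_, ?_, ?_⟩
      · rcases hold.1 (hD.mem e (hin e he)) with h6 | h6 | h6
        · exact absurd (hD.inj (hin e he) (hin a ham) (by rw [h6, hax])) h
        · exact absurd (hD.inj (hin e he) (hin a' ham') (by rw [h6, hax'])) h'
        · exact h6
      · exact fun h6 => (hnm e he).1 (hD.inj (hin e he) hxm h6)
      · exact fun h6 => (hnm e he).2 (hD.inj (hin e he) hxm' h6)
    have hlaba : lab a = invL (lab x) := hD.lab_inv x hxm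
    have hlaba' : lab a' = lab x := by rw [hD.lab_inv x' hxm', hlab, invL_invL]
    refine ⟨β, hnd, ?_, ?_, ?_, ?_⟩
    · intro e he
      by_cases h : e = a
      · rw [h, hβa]; exact ham'
      by_cases h' : e = a'
      · rw [h', hβa']; exact ham
      rw [hβe e h h']; exact (hmem e he h h').1
    · intro e he
      by_cases h : e = a
      · rw [h, hβa, hβa']
      by_cases h' : e = a'
      · rw [h', hβa', hβa]
      obtain ⟨h5, h6, h7⟩ := hmem e he h h'
      rw [hβe e h h', hβe _ h6 h7, hD.invol e (hin e he)]
    · intro e he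
      by_cases h : e = a
      · rw [h, hβa, hlaba, hlaba', invL_invL]
      by_cases h' : e = a'
      · rw [h', hβa', hlaba, hlaba']
      rw [hβe e h h', hD.lab_inv e (hin e he)]
    · intro H _ k h1 h2
      have hkaa : k a' = (k a)⁻¹ := by rw [← h1 a ham, hβa]
      let k' : ℕ → H := fun e => if e = x then (k a)⁻¹ else if e = x' then k a else k e
      have hkx : k' x = (k a)⁻¹ := by simp [k']
      have hkx' : k' x' = k a := by simp [k', Ne.symm hne]
      have hke : ∀ e ∈ (t :: fs).flatten, k' e = k e := by
        intro e he; simp [k', (hnm e he).1, (hnm e he).2]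
      obtain ⟨σ, h3, h4⟩ := hD.sc H k' (by
        intro e he
        rcases hold.1 he with rfl | rfl | he
        · rw [hkx, ← ha, hke a ham, inv_inv]
        · rw [hkx', ← ha', hke a' ham', hkaa]
        · by_cases h : e = a
          · rw [h, hax, hkx, hke a ham]
          by_cases h' : e = a'
          · rw [h', hax', hkx', hke a' ham', hkaa, inv_inv]
          obtain ⟨h5, h6, h7⟩ := hmem e he h h'
          rw [hke e he, hke _ h5, ← h1 e he, hβe e h h']) (by
        intro f hf
        rcases List.mem_cons.1 hf with rfl | hf
        · simp only [List.map_cons, List.prod_cons, hkx, hkx', inv_mul_cancel_left]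
          rw [prod_map_congr (h := k) fun e he => hke e (by simp [he])]
          exact h2 t (by simp)
        · rw [prod_map_congr (h := k) fun e he => hke e (hflat f hf e he)]
          exact h2 f (by simp [hf]))
      obtain ⟨b, hb⟩ := h4 _ List.mem_cons_self
      rw [develops_cons, develops_cons] at hb
      have hσ : σ a' = σ a * k a := by
        have h5 : σ x = σ a * k a := by rw [← hax, h3 a (hin a ham), hke a ham]
        have h6 : σ a' = σ x' * k a := by rw [ha', h3 x' hxm', hkx']
        rw [h6, hb.2.1, hkx, ← hb.1, h5]; group
      refine ⟨σ, fun e he => ?_, fun f hf => ?_⟩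
      · by_cases h : e = a
        · rw [h, hβa, hσ]
        by_cases h' : e = a'
        · rw [h', hβa', hσ, hkaa]; group
        rw [hβe e h h', h3 e (hin e he), hke e he]
      rcases List.mem_cons.1 hf with rfl | hf
      · exact ⟨_, hb.2.2.congr (fun _ _ => rfl) fun e he => (hke e (by simp [he])).symm⟩
      · obtain ⟨b, hb⟩ := h4 f (by simp [hf])
        exact ⟨b, hb.congr (fun _ _ => rfl) fun e he => (hke e (hflat f hf e he)).symm⟩

end IsDiag

end Diagrams

end GSC

namespace GSC

section Fills

lemma exists_perm_map_eq {A B : Type*} (F : A → B) {L L' : List B} (h : L.Perm L') :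
    ∀ {l : List A}, l.map F = L → ∃ l', l.Perm l' ∧ l'.map F = L' := by
  induction h with
  | nil => exact fun {l} hl => ⟨l, List.Perm.refl _, hl⟩
  | cons x _ ih =>
    intro l hl
    obtain ⟨a, l₁, rfl, rfl, h2⟩ := List.map_eq_cons_iff.1 hl
    obtain ⟨l', h3, h4⟩ := ih h2
    exact ⟨a :: l', h3.cons a, by simp [h4]⟩
  | swap x y l =>
    intro l hl
    obtain ⟨a, l₁, rfl, rfl, h2⟩ := List.map_eq_cons_iff.1 hl
    obtain ⟨b, l₂, rfl, rfl, h3⟩ := List.map_eq_cons_iff.1 h2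
    exact ⟨b :: a :: l₂, List.Perm.swap _ _ _, by simp [h3]⟩
  | trans _ _ ih₁ ih₂ =>
    intro l hl
    obtain ⟨l', h3, h4⟩ := ih₁ hl
    obtain ⟨l'', h5, h6⟩ := ih₂ h4
    exact ⟨l'', h3.trans h5, h6⟩

variable {S : Type}

/-- There is a diagram on the sphere whose faces are labelled by the given words. -/
def Fills (L : List (Word S)) : Prop :=
  ∃ lab α fs, IsDiag lab α fs ∧ fs.map (List.map lab) = L

namespace Fills

variable {L L' : List (Word S)}

lemma nil [Nonempty S] : Fills [([] : Word S)] := by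
  obtain ⟨a⟩ := ‹Nonempty S›
  exact ⟨fun _ => (a, true), id, [[]], IsDiag.nil, rfl⟩

lemma perm (h : Fills L) (hp : L.Perm L') : Fills L' := by
  obtain ⟨lab, α, fs, hD, h⟩ := h
  obtain ⟨gs, h1, h2⟩ := exists_perm_map_eq _ hp h
  exact ⟨lab, α, gs, hD.perm h1, h2⟩

lemma rotate {s t : Word S} (h : Fills ((s ++ t) :: L)) : Fills ((t ++ s) :: L) := by
  obtain ⟨lab, α, fs, hD, h⟩ := h
  obtain ⟨f, gs, rfl, h1, h2⟩ := List.map_eq_cons_iff.1 h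
  obtain ⟨l₁, l₂, rfl, rfl, rfl⟩ := List.map_eq_append_iff.1 h1
  exact ⟨lab, α, _, hD.rotate, by simp [h2]⟩

lemma split {s t : Word S} (h : Fills ((s ++ t) :: L)) : Fills (s :: t :: L) := by
  obtain ⟨lab, α, fs, hD, h⟩ := h
  obtain ⟨f, gs, rfl, h1, h2⟩ := List.map_eq_cons_iff.1 h
  obtain ⟨l₁, l₂, rfl, rfl, rfl⟩ := List.map_eq_append_iff.1 h1
  exact ⟨lab, α, _, hD.split, by simp [h2]⟩

lemma of_nil_cons (h : Fills ([] :: L)) : Fills L := by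
  obtain ⟨lab, α, fs, hD, h⟩ := h
  obtain ⟨f, gs, rfl, h1, h2⟩ := List.map_eq_cons_iff.1 h
  rw [List.map_eq_nil_iff.1 h1] at hD
  exact ⟨lab, α, _, hD.of_nil_cons, h2⟩

lemma fold {x : S × Bool} {t : Word S} (h : Fills ((x :: invL x :: t) :: L)) :
    Fills (t :: L) := by
  obtain ⟨lab, α, fs, hD, h⟩ := h
  obtain ⟨f, gs, rfl, h1, h2⟩ := List.map_eq_cons_iff.1 h
  obtain ⟨d, l, rfl, rfl, h3⟩ := List.map_eq_cons_iff.1 h1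
  obtain ⟨e, l, rfl, h4, h5⟩ := List.map_eq_cons_iff.1 h3
  obtain ⟨α', hD'⟩ := hD.fold h4
  exact ⟨lab, α', _, hD', by simp [h2, h5]⟩

lemma spur {t : Word S} (h : Fills (t :: L)) (x : S × Bool) :
    Fills ((x :: invL x :: t) :: L) := by
  obtain ⟨lab, α, fs, hD, h⟩ := h
  obtain ⟨f, gs, rfl, h1, h2⟩ := List.map_eq_cons_iff.1 h
  set m := (f :: gs).flatten.sum + 1 with hm
  have hlt : ∀ e ∈ (f :: gs).flatten, e < m := fun e he =>
    Nat.lt_succ_of_le (List.le_sum_of_mem he)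
  have h1m : m ∉ (f :: gs).flatten := fun h => (hlt _ h).false
  have h2m : m + 1 ∉ (f :: gs).flatten := fun h => by have := hlt _ h; omega
  have hne : m ≠ m + 1 := by omega
  refine ⟨_, _, _, hD.spur h1m h2m hne x, ?_⟩
  have hc : ∀ e ∈ (f :: gs).flatten,
      Function.update (Function.update lab m x) (m + 1) (invL x) e = lab e := by
    intro e he
    have := hlt e he
    rw [Function.update_of_ne (by omega), Function.update_of_ne (by omega)]
  simp only [List.map_cons, Function.update_self, Function.update_of_ne hne]
  rw [List.map_congr_left (g := lab) fun e he => hc e (by simp [he]), h1]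
  congr 1
  rw [← h2]
  refine List.map_congr_left fun l hl => List.map_congr_left fun e he => hc e ?_
  simp only [List.flatten_cons, List.mem_append, List.mem_flatten]
  exact Or.inr ⟨l, hl, he⟩

lemma fold_word (u : Word S) {t : Word S} (h : Fills ((u ++ wordInv u ++ t) :: L)) :
    Fills (t :: L) := by
  induction u generalizing t with
  | nil => simpa using h
  | cons x u ih =>
    rw [wordInv_cons] at h
    have h1 : Fills (([x] ++ (u ++ wordInv u ++ ([invL x] ++ t))) :: L) := by simpa using h
    have h2 := h1.rotate
    have h3 : Fills ((u ++ wordInv u ++ ([invL x] ++ t ++ [x])) :: L) := by simpa using h2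
    have h4 : Fills (([invL x] ++ t ++ [x]) :: L) := ih h3
    have h5 := h4.rotate
    exact fold (x := x) (by simpa using h5)

lemma spur_word (u : Word S) {t : Word S} (h : Fills (t :: L)) :
    Fills ((u ++ wordInv u ++ t) :: L) := by
  induction u generalizing t with
  | nil => simpa using h
  | cons x u ih =>
    rw [wordInv_cons]
    have h1 : Fills (([x] ++ ([invL x] ++ t)) :: L) := by simpa using h.spur x
    have h2 := ih h1.rotate
    have h3 : Fills (((u ++ wordInv u ++ ([invL x] ++ t)) ++ [x]) :: L) := by simpa using h2
    simpa using h3.rotate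

lemma cancel (s u t : Word S) (h : Fills ((s ++ (u ++ (wordInv u ++ t))) :: L)) :
    Fills ((s ++ t) :: L) := by
  have h1 : Fills ((u ++ wordInv u ++ (t ++ s)) :: L) := by simpa using h.rotate
  exact (fold_word u h1).rotate

lemma insert (s u t : Word S) (h : Fills ((s ++ t) :: L)) :
    Fills ((s ++ (u ++ (wordInv u ++ t))) :: L) := by
  have h1 : Fills (((u ++ wordInv u ++ t) ++ s) :: L) := by simpa using spur_word u h.rotate
  simpa using h1.rotate

lemma insert_face (s r t : Word S) (h : Fills ((s ++ t) :: L)) :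
    Fills ((s ++ (r ++ t)) :: wordInv r :: L) := by
  have h1 := (h.insert s r t).rotate
  have h2 : Fills ((r ++ (wordInv r ++ (t ++ s))) :: L) := by simpa using h1
  have h3 : Fills ((wordInv r ++ (t ++ s ++ r)) :: L) := by simpa using h2.rotate
  have h4 : Fills ((t ++ (s ++ r)) :: wordInv r :: L) := by
    simpa using h3.split.perm (List.Perm.swap _ _ _)
  simpa using h4.rotate

end Fills

/-- The word bounds a diagram whose other faces are labelled by relators. -/
def HasDiagram (P : C6Presentation S) (w : Word S) : Prop :=
  ∃ rs : List (Word S), (∀ r ∈ rs, r ∈ P.rels) ∧ Fills (w :: rs)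

variable {P : C6Presentation S}

lemma HasDiagram.step {w w' : Word S} (h : FreeGroup.Red.Step w w') :
    HasDiagram P w ↔ HasDiagram P w' := by
  obtain ⟨⟩ := h
  rename_i s t x b
  constructor
  · rintro ⟨rs, h1, h2⟩
    exact ⟨rs, h1, Fills.cancel s [(x, b)] t (by simpa [wordInv] using h2)⟩
  · rintro ⟨rs, h1, h2⟩
    exact ⟨rs, h1, by simpa [wordInv] using h2.insert s [(x, b)] t⟩

lemma HasDiagram.red {w w' : Word S} (h : FreeGroup.Red w w') :
    HasDiagram P w ↔ HasDiagram P w' := by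
  induction h with
  | refl => rfl
  | tail _ h ih => exact ih.trans (HasDiagram.step h)

lemma HasDiagram.congr {w w' : Word S} (h : FreeGroup.mk w = FreeGroup.mk w') :
    HasDiagram P w ↔ HasDiagram P w' := by
  obtain ⟨c, h1, h2⟩ := FreeGroup.Red.exact.1 h
  exact (HasDiagram.red h1).trans (HasDiagram.red h2).symm

lemma mk_wordInv (w : Word S) : FreeGroup.mk (wordInv w) = (FreeGroup.mk w)⁻¹ := by
  rw [FreeGroup.inv_mk]; rfl

lemma HasDiagram.mul_conj {w : Word S} (h : HasDiagram P w) (c : Word S) {r : Word S}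
    (hr : r ∈ P.rels) : HasDiagram P (w ++ (c ++ (r ++ wordInv c))) := by
  obtain ⟨rs, h1, h2⟩ := h
  have h3 : Fills ((w ++ []) :: rs) := by simpa using h2
  have h4 : Fills (((w ++ c) ++ wordInv c) :: rs) := by simpa using h3.insert w c []
  refine ⟨wordInv r :: rs, ?_, by simpa using h4.insert_face (w ++ c) r (wordInv c)⟩
  intro r' hr'
  rcases List.mem_cons.1 hr' with rfl | hr'
  · exact P.inv_mem r hr
  · exact h1 _ hr'

lemma hasDiagram_of_elt_eq_one [Nonempty S] {w : Word S} (hw : P.elt w = 1) : HasDiagram P w := by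
  rw [P.elt_eq_one_iff] at hw
  suffices h : ∃ w', FreeGroup.mk w' = wordVal w ∧ HasDiagram P w' by
    obtain ⟨w', h1, h2⟩ := h
    rw [wordVal_eq_mk] at h1
    exact (HasDiagram.congr h1).1 h2
  have key : ∀ y ∈ Group.conjugatesOfSet (wordVal '' P.rels), ∃ c r, r ∈ P.rels ∧
      y = FreeGroup.mk (c ++ (r ++ wordInv c)) := by
    intro y hy
    obtain ⟨_, ⟨r, hr, rfl⟩, hc⟩ := Group.mem_conjugatesOfSet_iff.1 hy
    obtain ⟨c, hc⟩ := isConj_iff.1 hc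
    obtain ⟨c, rfl⟩ : ∃ c', FreeGroup.mk c' = c := Quot.exists_rep c
    exact ⟨c, r, hr, by rw [← hc, wordVal_eq_mk, ← FreeGroup.mul_mk, ← FreeGroup.mul_mk,
      mk_wordInv, mul_assoc]⟩
  unfold Subgroup.normalClosure at hw
  generalize wordVal w = x at hw
  induction hw using Subgroup.closure_induction_right with
  | one => exact ⟨[], rfl, [], by simp, Fills.nil⟩
  | mul_right x _ y hy ih =>
    obtain ⟨w', rfl, h2⟩ := ih
    obtain ⟨c, r, hr, rfl⟩ := key y hy
    exact ⟨_, FreeGroup.mul_mk.symm, h2.mul_conj c hr⟩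
  | mul_inv_cancel x _ y hy ih =>
    obtain ⟨w', rfl, h2⟩ := ih
    obtain ⟨c, r, hr, rfl⟩ := key y hy
    refine ⟨_, ?_, h2.mul_conj c (P.inv_mem r hr)⟩
    simp only [← FreeGroup.mul_mk, mk_wordInv]
    group

end Fills

end GSC

namespace GSC

section Reduced

variable {S : Type}

/-- The words spelling the coned-off path: prefixes of relators, and letters that occur in no
relator. -/
def IsPart (P : C6Presentation S) (w : Word S) : Prop :=
  (∃ r ∈ P.rels, w <+: r) ∨ ∃ x, w = [x] ∧ ∀ r ∈ P.rels, x ∉ r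

/-- A diagram with boundary word `v * ws₁ * ⋯ * wsₖ` in which no two faces cancel, and in which
no face can be absorbed into one of the parts `wsᵢ`. -/
structure IsReducedDiag (P : C6Presentation S) (v : Word S) (ws : List (Word S))
    (lab : ℕ → S × Bool) (α : ℕ → ℕ) (out : List ℕ) (ins : List (List ℕ)) : Prop where
  isDiag : IsDiag lab α (out :: ins)
  isPart : ∀ w ∈ ws, IsPart P w
  out_lab : out.map lab = v ++ ws.flatten
  elt_eq : P.elt (v ++ ws.flatten) = 1
  rel : ∀ f ∈ ins, f.map lab ∈ P.rels
  ne_nil : ∀ f ∈ ins, f ≠ []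
  no_cancel : ∀ {d : ℕ} {s₁ s₂ t₁ t₂ : List ℕ} {rest : List (List ℕ)},
    ins.Perm ((s₁ ++ d :: s₂) :: (t₁ ++ α d :: t₂) :: rest) →
      (s₂ ++ s₁).map lab ≠ wordInv ((t₂ ++ t₁).map lab)
  no_absorb : ∀ {d : ℕ} {s₁ s₂ a b : List ℕ} {rest : List (List ℕ)} {ws₁ ws₂ : List (Word S)}
    {p₁ p₂ q : Word S}, ins.Perm ((s₁ ++ d :: s₂) :: rest) → out = a ++ α d :: b →
      ws = ws₁ ++ (p₁ ++ lab (α d) :: p₂) :: ws₂ → a.map lab = v ++ (ws₁.flatten ++ p₁) →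
      p₁ ++ lab (α d) :: (p₂ ++ q) ∈ P.rels →
      (s₂ ++ s₁).map lab ≠ wordInv p₁ ++ (wordInv q ++ wordInv p₂)

lemma exists_isReducedDiag [Nonempty S] (P : C6Presentation S) (v : Word S) (ws : List (Word S))
    (hws : ∀ w ∈ ws, IsPart P w) (hv : P.elt (v ++ ws.flatten) = 1) :
    ∃ ws' : List (Word S), ws'.length = ws.length ∧
      ∃ lab α out ins, IsReducedDiag P v ws' lab α out ins := by
  classical
  let Q : ℕ → Prop := fun n => ∃ ws' : List (Word S), ws'.length = ws.length ∧
    (∀ w ∈ ws', IsPart P w) ∧ P.elt (v ++ ws'.flatten) = 1 ∧ ∃ rs : List (Word S),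
      rs.length = n ∧ (∀ r ∈ rs, r ∈ P.rels) ∧
      Fills ((v ++ ws'.flatten) :: rs)
  have hQ : ∃ n, Q n := by
    obtain ⟨rs, h1, h2⟩ := hasDiagram_of_elt_eq_one hv
    exact ⟨_, ws, rfl, hws, hv, rs, rfl, h1, h2⟩
  obtain ⟨ws', hlen, hpart, helt, rs, hrs, hrel, lab, α, fs, hD, hfs⟩ := Nat.find_spec hQ
  obtain ⟨out, ins, rfl, hout, hins⟩ := List.map_eq_cons_iff.1 hfs
  have hmin : ∀ n, Q n → ins.length ≤ n := by
    intro n hn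
    have := Nat.find_min' hQ hn
    rwa [← hrs, ← hins, List.length_map] at this
  have hrel' : ∀ f ∈ ins, f.map lab ∈ P.rels := fun f hf =>
    hrel _ (hins ▸ List.mem_map_of_mem hf)
  refine ⟨ws', hlen, lab, α, out, ins, hD, hpart, hout, helt, hrel', ?_, ?_, ?_⟩
  · rintro f hf rfl
    have hp := List.perm_cons_erase hf
    have h1 := hD.perm ((hp.cons out).trans (List.Perm.swap _ _ _))
    have h2 := hmin (ins.erase []).length ⟨ws', hlen, hpart, helt,
      (ins.erase []).map (List.map lab),
      by simp, fun r hr => ?_, lab, α, _, h1.of_nil_cons, by simp [hout]⟩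
    · have := hp.length_eq
      simp only [List.length_cons] at this
      omega
    · obtain ⟨f, hf', rfl⟩ := List.mem_map.1 hr
      exact hrel' f (List.mem_of_mem_erase hf')
  · intro d s₁ s₂ t₁ t₂ rest hp heq
    have h1 := hD.perm ((hp.cons out).trans
      ((List.Perm.swap _ _ _).trans ((List.Perm.swap _ _ _).cons _)))
    have h2 := (h1.rotate.perm (List.Perm.swap _ _ _)).rotate.perm (List.Perm.swap _ _ _)
    have h3 := IsDiag.merge h2
    have h4 : Fills ((wordInv ((t₂ ++ t₁).map lab) ++ wordInv (wordInv ((t₂ ++ t₁).map lab)) ++ [])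
        :: (out :: rest).map (List.map lab)) :=
      ⟨lab, α, _, h3, by
        rw [wordInv_wordInv, ← heq]
        simp⟩
    have h5 := (h4.fold_word).of_nil_cons
    rw [List.map_cons, hout] at h5
    have h6 := hmin rest.length ⟨ws', hlen, hpart, helt, rest.map (List.map lab), by simp,
      fun r hr => ?_, h5⟩
    · have := hp.length_eq
      simp only [List.length_cons] at this
      omega
    · obtain ⟨f, hf', rfl⟩ := List.mem_map.1 hr
      exact hrel' f (hp.mem_iff.2 (by simp [hf']))
  · intro d s₁ s₂ a b rest ws₁ ws₂ p₁ p₂ q hp ho hws' ha hr heq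
    have hb : b.map lab = p₂ ++ ws₂.flatten := by
      rw [ho, hws'] at hout
      simp only [List.map_append, List.map_cons, ha, List.flatten_append, List.flatten_cons,
        List.append_assoc, List.cons_append, List.append_cancel_left_eq, List.cons.injEq,
        true_and] at hout
      exact hout
    rw [ho] at hD
    have h1 := hD.rotate.perm ((hp.cons _).trans (List.Perm.swap _ _ _))
    have h3 : IsDiag lab α ((s₂ ++ s₁ ++ (b ++ a)) :: rest) := IsDiag.merge h1.rotate
    have h4 : Fills ((wordInv p₁ ++ (wordInv q ++ (wordInv p₂ ++ (wordInv (wordInv p₂) ++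
        (ws₂.flatten ++ (v ++ (ws₁.flatten ++ p₁))))))) :: rest.map (List.map lab)) :=
      ⟨lab, α, _, h3, by
        rw [wordInv_wordInv, List.map_cons, List.map_append, heq]
        simp [ha, hb]⟩
    have h5 := Fills.cancel (wordInv p₁ ++ wordInv q) (wordInv p₂) _ (by simpa using h4)
    have h6 : Fills ((p₁ ++ wordInv p₁ ++ (wordInv q ++ (ws₂.flatten ++ (v ++ ws₁.flatten)))) ::
        rest.map (List.map lab)) := by
      have h7 : Fills (((wordInv p₁ ++ (wordInv q ++ (ws₂.flatten ++ (v ++ ws₁.flatten)))) ++ p₁) ::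
        rest.map (List.map lab)) := by simpa using h5
      simpa using h7.rotate
    have h7 := h6.fold_word
    have h8 : Fills (((v ++ ws₁.flatten) ++ (wordInv q ++ ws₂.flatten)) ::
        rest.map (List.map lab)) :=
      Fills.rotate (s := wordInv q ++ ws₂.flatten) (by simpa using h7)
    have h9 := hmin rest.length ⟨ws₁ ++ wordInv q :: ws₂, ?_, ?_, ?_,
      rest.map (List.map lab), by simp,
      fun r hr => ?_, by simpa using h8⟩
    · have := hp.length_eq
      simp only [List.length_cons] at this
      omega
    · rw [← hlen, hws']; simp
    · intro w hw
      simp only [List.mem_append, List.mem_cons] at hw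
      rcases hw with hw | rfl | hw
      · exact hpart w (by rw [hws']; simp [hw])
      · refine Or.inl ⟨_, P.inv_mem _ hr, ?_⟩
        have : p₁ ++ lab (α d) :: (p₂ ++ q) = (p₁ ++ lab (α d) :: p₂) ++ q := by simp
        rw [this, wordInv_append]
        exact List.prefix_append _ _
      · exact hpart w (by rw [hws']; simp [hw])
    · have h10 := P.elt_rel hr
      have h11 : p₁ ++ lab (α d) :: (p₂ ++ q) = (p₁ ++ lab (α d) :: p₂) ++ q := by simp
      rw [h11, P.elt_append] at h10
      rw [← helt, hws']
      have h10 := eq_inv_of_mul_eq_one_left h10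
      rw [P.elt_append] at h10
      simp only [List.flatten_append, List.flatten_cons, P.elt_append, P.elt_wordInv, ← h10]
    · obtain ⟨f, hf', rfl⟩ := List.mem_map.1 hr
      exact hrel' f (hp.mem_iff.2 (by simp [hf']))

end Reduced

end GSC

namespace GSC

section Darts

/-- The cyclic rotation `i ↦ i + 1` of `Fin n`. -/
noncomputable def cycSucc (n : ℕ) : Equiv.Perm (Fin n) :=
  Equiv.ofBijective (fun i => ⟨(i.1 + 1) % n, Nat.mod_lt _ (i.1.zero_le.trans_lt i.2)⟩)
    (Finite.injective_iff_bijective.1 (by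
      intro i j h
      have h1 : (i.1 + 1) ≡ (j.1 + 1) [MOD n] := congrArg Fin.val h
      have h2 : i.1 ≡ j.1 [MOD n] := Nat.ModEq.add_right_cancel' 1 h1
      exact Fin.ext (h2.eq_of_lt_of_lt i.2 j.2)))

lemma cycSucc_pow_val {n : ℕ} (i : Fin n) (j : ℕ) : ((cycSucc n ^ j) i).1 = (i.1 + j) % n := by
  induction j with
  | zero => simp [Nat.mod_eq_of_lt i.2]
  | succ j ih =>
    rw [pow_succ', Equiv.Perm.mul_apply]
    change (((cycSucc n ^ j) i).1 + 1) % n = _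
    rw [ih, Nat.mod_add_mod, add_assoc]

/-- The positions in a list of lists. -/
abbrev Dart (F : List (List ℕ)) : Type := Σ a : Fin F.length, Fin (F.get a).length

namespace Dart

variable {F : List (List ℕ)}

/-- The entry at a position. -/
def val (d : Dart F) : ℕ := (F.get d.1).get d.2

/-- The next position on the same face, in cyclic order. -/
noncomputable def next (F : List (List ℕ)) : Equiv.Perm (Dart F) :=
  Equiv.sigmaCongrRight fun a => cycSucc (F.get a).length

lemma next_pow (a : Fin F.length) (i : Fin (F.get a).length) (j : ℕ) :
    (next F ^ j) ⟨a, i⟩ = ⟨a, (cycSucc (F.get a).length ^ j) i⟩ := by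
  induction j with
  | zero => rfl
  | succ j ih => rw [pow_succ', Equiv.Perm.mul_apply, ih, pow_succ', Equiv.Perm.mul_apply]; rfl

lemma val_mem (d : Dart F) : val d ∈ F.get d.1 := List.get_mem _ _

lemma val_mem_flatten (d : Dart F) : val d ∈ F.flatten :=
  List.mem_flatten.2 ⟨_, List.get_mem _ _, val_mem d⟩

lemma exists_val_eq {x : ℕ} (hx : x ∈ F.flatten) : ∃ d : Dart F, val d = x := by
  obtain ⟨f, hf, hx⟩ := List.mem_flatten.1 hx
  obtain ⟨a, rfl⟩ := List.get_of_mem hf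
  obtain ⟨i, rfl⟩ := List.get_of_mem hx
  exact ⟨⟨a, i⟩, rfl⟩

lemma val_injective (h : F.flatten.Nodup) : Function.Injective (val (F := F)) := by
  rintro ⟨a, i⟩ ⟨b, j⟩ hij
  rw [List.nodup_flatten] at h
  obtain rfl : a = b := by
    by_contra hab
    have key : ∀ a b : Fin F.length, a < b → ∀ i j, (F.get a).get i ≠ (F.get b).get j := by
      intro a b hlt i j hij
      have := List.pairwise_iff_get.1 h.2 a b hlt
      exact this (List.get_mem _ i) (hij ▸ List.get_mem _ j)
    rcases lt_or_gt_of_ne hab with hlt | hlt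
    · exact key a b hlt i j hij
    · exact key b a hlt j i hij.symm
  have := (h.1 _ (List.get_mem F a)).injective_get hij
  exact congrArg (Sigma.mk a) this

lemma card_fiber (a : Fin F.length) :
    (Finset.univ.filter fun e : Dart F => (e.1 : ℕ) = a).card = (F.get a).length := by
  classical
  have : (Finset.univ.filter fun e : Dart F => (e.1 : ℕ) = a) =
      Finset.univ.map (Function.Embedding.sigmaMk (β := fun a => Fin (F.get a).length) a) := by
    ext ⟨b, j⟩
    simp only [Finset.mem_filter, Finset.mem_univ, true_and, Finset.mem_map,
      Function.Embedding.sigmaMk_apply]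
    constructor
    · intro h
      obtain rfl := Fin.ext h
      exact ⟨j, rfl⟩
    · rintro ⟨i, h⟩
      rw [(Sigma.mk.inj_iff.1 h).1]
  rw [this, Finset.card_map, Finset.card_univ, Fintype.card_fin]

lemma val_next_pow (a : Fin F.length) (i : Fin (F.get a).length) (j : ℕ) :
    val ((next F ^ j) ⟨a, i⟩) =
      (F.get a)[(i.1 + j) % (F.get a).length]'(Nat.mod_lt _ (i.1.zero_le.trans_lt i.2)) := by
  rw [next_pow]
  simp only [val, List.get_eq_getElem, cycSucc_pow_val]

lemma map_range_next {B : Type*} (g : ℕ → B) (d : Dart F) :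
    (List.range (F.get d.1).length).map (fun j => g (val ((next F ^ j) d))) =
      ((F.get d.1).rotate d.2).map g := by
  obtain ⟨a, i⟩ := d
  refine List.ext_getElem (by simp) fun j h1 h2 => ?_
  simp only [List.getElem_map, List.getElem_range, List.getElem_rotate, val_next_pow, add_comm j]

lemma develops_getElem {H : Type} [Group H] {σ h : ℕ → H} {l : List ℕ} {b : H}
    (hl : Develops σ h l b) (i : ℕ) (hi : i < l.length) :
    σ l[i] = b * ((l.take i).map h).prod := by
  induction l generalizing b i with
  | nil => simp at hi
  | cons d l ih =>
    cases i with
    | zero => simpa using hl.1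
    | succ i =>
      have := ih hl.2 i (by simpa using hi)
      simpa [mul_assoc] using this

lemma develops_next {H : Type} [Group H] {σ h : ℕ → H}
    (hσ : ∀ f ∈ F, ∃ b, Develops σ h f b) (h1 : ∀ f ∈ F, (f.map h).prod = 1) (d : Dart F) :
    σ (val (next F d)) = σ (val d) * h (val d) := by
  obtain ⟨a, i⟩ := d
  obtain ⟨b, hb⟩ := hσ _ (List.get_mem F a)
  have hp := h1 _ (List.get_mem F a)
  have h2 := val_next_pow a i 1
  rw [pow_one] at h2
  rw [h2]
  have h3 : ∀ (k : ℕ) (hk : k < (F.get a).length), k = (i.1 + 1) % (F.get a).length →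
      σ ((F.get a)[k]) = σ (val ⟨a, i⟩) * h (val ⟨a, i⟩) := by
    intro k hk hk'
    simp only [val, List.get_eq_getElem (l := F.get a)]
    rw [develops_getElem hb k hk, develops_getElem hb i.1 i.2, mul_assoc]
    have h4 : ((F.get a).take (i.1 + 1)).map h =
        ((F.get a).take i.1).map h ++ [h ((F.get a)[i.1])] := by
      rw [List.take_succ_eq_append_getElem i.2, List.map_append]; rfl
    have h5 := congrArg List.prod h4
    rw [List.prod_append, List.prod_singleton] at h5
    rw [← h5]
    congr 1
    rcases Nat.lt_or_ge (i.1 + 1) (F.get a).length with hlt | hge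
    · rw [hk', Nat.mod_eq_of_lt hlt]
    · have : i.1 + 1 = (F.get a).length := le_antisymm i.2 hge
      rw [hk', this, Nat.mod_self, List.take_length, hp]
      simp
  exact h3 _ _ rfl

end Dart

variable {S : Type} {lab : ℕ → S × Bool} {α : ℕ → ℕ} {F : List (List ℕ)}

/-- The edge involution on positions. -/
noncomputable def IsDiag.opp (hD : IsDiag lab α F) : Equiv.Perm (Dart F) :=
  Function.Involutive.toPerm
    (fun d => (Dart.exists_val_eq (hD.mem _ (Dart.val_mem_flatten d))).choose) (by
      intro d
      refine Dart.val_injective hD.nodup ?_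
      rw [(Dart.exists_val_eq (hD.mem _ (Dart.val_mem_flatten _))).choose_spec,
        (Dart.exists_val_eq (hD.mem _ (Dart.val_mem_flatten _))).choose_spec,
        hD.invol _ (Dart.val_mem_flatten d)])

lemma IsDiag.val_opp (hD : IsDiag lab α F) (d : Dart F) : Dart.val (hD.opp d) = α (Dart.val d) :=
  (Dart.exists_val_eq (hD.mem _ (Dart.val_mem_flatten d))).choose_spec

lemma IsDiag.opp_opp (hD : IsDiag lab α F) (d : Dart F) : hD.opp (hD.opp d) = d :=
  Dart.val_injective hD.nodup (by
    rw [hD.val_opp, hD.val_opp, hD.invol _ (Dart.val_mem_flatten d)])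

lemma IsDiag.exists_potential (hD : IsDiag lab α F) {H : Type} [Group H] (h : Dart F → H)
    (h1 : ∀ d, h (hD.opp d) = (h d)⁻¹)
    (h2 : ∀ a : Fin F.length, (List.ofFn fun i => h ⟨a, i⟩).prod = 1) :
    ∃ σ : Dart F → H, (∀ d, σ (hD.opp d) = σ d * h d) ∧ ∀ d, σ (Dart.next F d) = σ d * h d := by
  classical
  have hinj := Dart.val_injective hD.nodup
  let k : ℕ → H := Function.extend Dart.val h 1
  have hk : ∀ d, k (Dart.val d) = h d := fun d => hinj.extend_apply _ _ _
  have hprod : ∀ f ∈ F, (f.map k).prod = 1 := by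
    intro f hf
    obtain ⟨a, rfl⟩ := List.get_of_mem hf
    rw [← h2 a]
    congr 1
    refine List.ext_getElem (by simp) fun i hi hi' => ?_
    rw [List.getElem_map, List.getElem_ofFn, ← hk]
    rfl
  obtain ⟨σ, h3, h4⟩ := hD.sc H k (by
    intro x hx
    obtain ⟨d, rfl⟩ := Dart.exists_val_eq hx
    rw [← hD.val_opp, hk, hk, h1]) hprod
  refine ⟨fun d => σ (Dart.val d), fun d => ?_, fun d => ?_⟩
  · change σ (Dart.val (hD.opp d)) = _
    rw [hD.val_opp, h3 _ (Dart.val_mem_flatten d), hk]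
  · change σ (Dart.val (Dart.next F d)) = _
    rw [Dart.develops_next h4 hprod, hk]

end Darts

end GSC

namespace GSC

section RDiag

variable {S : Type}

/-- The word of length `N` read along the orbit of `d`. -/
def orbitWord {D : Type} (φ : Equiv.Perm D) (lab : D → S × Bool) (N : ℕ) (d : D) : Word S :=
  (List.range N).map fun j => lab ((φ ^ j) d)

/-- A reduced diagram presented by permutations of its set `D` of darts: `φ` rotates the faces and
`α` exchanges the darts of an edge. The face with index `0` is the outer one; its boundary consists
of the darts in `V`, running along the path `γ`, and of at most `k` parts. The first darts of these
pieces of the boundary belong to `Brk`. -/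
structure RDiag (P : C6Presentation S) (γ : ℤ → P.Grp) (s : ℤ) (m k : ℕ) (D : Type) [Fintype D]
    [DecidableEq D] where
  φ : Equiv.Perm D
  α : Equiv.Perm D
  lab : D → S × Bool
  pos : D → P.Grp
  n : ℕ
  fc : D → ℕ
  Brk : Finset D
  V : Finset D
  idx : D → ℕ
  α_α : ∀ d, α (α d) = d
  lab_α : ∀ d, lab (α d) = invL (lab d)
  pos_α : ∀ d, pos (α d) = pos d * P.eltL (lab d)
  pos_φ : ∀ d, pos (φ d) = pos d * P.eltL (lab d)
  fc_le : ∀ d, fc d ≤ n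
  fc_φ : ∀ d, fc (φ d) = fc d
  fc_surj : ∀ i, 1 ≤ i → i ≤ n → ∃ d, fc d = i
  pow_size : ∀ d, (φ ^ (Finset.univ.filter fun e => fc e = fc d).card) d = d
  exists_pow : ∀ d e, fc d = fc e →
    ∃ j < (Finset.univ.filter fun e => fc e = fc d).card, (φ ^ j) d = e
  rel : ∀ d, fc d ≠ 0 →
    orbitWord φ lab (Finset.univ.filter fun e => fc e = fc d).card d ∈ P.rels
  red : ∀ d, φ d ∉ Brk → lab (φ d) ≠ invL (lab d)
  V_fc : ∀ d ∈ V, fc d = 0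
  V_idx : ∀ d ∈ V, idx d < m
  V_inj : ∀ d ∈ V, ∀ e ∈ V, idx d = idx e → d = e
  V_pos : ∀ d ∈ V, pos d = γ (s + idx d)
  V_pos' : ∀ d ∈ V, pos (φ d) = γ (s + idx d + 1)
  V_card : V.card = m
  V_exit : ∀ d ∈ V, φ d ∉ V → idx d + 1 = m
  V_brk : ∀ d, φ d ∉ Brk → (φ d ∈ V ↔ d ∈ V)
  brk_fc : ∀ d ∈ Brk, fc d = 0
  brk_card : Brk.card ≤ k + 1
  no_cancel : ∀ d, fc d ≠ 0 → fc (α d) ≠ 0 → fc d ≠ fc (α d) →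
    orbitWord φ lab (Finset.univ.filter fun e => fc e = fc d).card d ≠
      wordInv (orbitWord φ lab (Finset.univ.filter fun e => fc e = fc (α d)).card (φ (α d)))
  part : ∀ e, fc e = 0 → e ∉ V → ∃ e₀ ∈ Brk, ∃ p₁ p₂ : Word S, (φ ^ p₁.length) e₀ = e ∧
    orbitWord φ lab (p₁.length + 1) e₀ = p₁ ++ [lab e] ∧ IsPart P (p₁ ++ lab e :: p₂) ∧
    ∀ q, p₁ ++ lab e :: (p₂ ++ q) ∈ P.rels → fc (α e) ≠ 0 →
      orbitWord φ lab (Finset.univ.filter fun d => fc d = fc (α e)).card (α e) ≠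
        invL (lab e) :: (wordInv p₁ ++ (wordInv q ++ wordInv p₂))
  sc : ∀ h : D → ℚ, (∀ d, h (α d) = - h d) →
    (∀ i, 1 ≤ i → i ≤ n → ∑ e with fc e = i, h e = 0) →
    ∃ σ : D → ℚ, ∀ d, σ (α d) = σ d + h d ∧ σ (φ d) = σ d + h d

lemma exists_flatten_getElem {A : Type*} (L : List (List A)) (t : ℕ) (ht : t < L.flatten.length) :
    ∃ L₁ p₁ p₂ L₂, L = L₁ ++ (p₁ ++ L.flatten[t] :: p₂) :: L₂ ∧
      t = L₁.flatten.length + p₁.length := by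
  induction L generalizing t with
  | nil => simp at ht
  | cons l L ih =>
    rcases Nat.lt_or_ge t l.length with h | h
    · refine ⟨[], l.take t, l.drop (t + 1), L, ?_, by simp [h.le]⟩
      have : (l :: L).flatten[t] = l[t] := by
        simp only [List.flatten_cons]
        exact List.getElem_append_left h
      rw [this]; simp
    · have h' : t - l.length < L.flatten.length := by
        simp only [List.flatten_cons, List.length_append] at ht; omega
      obtain ⟨L₁, p₁, p₂, L₂, h1, h2⟩ := ih _ h'
      refine ⟨l :: L₁, p₁, p₂, L₂, ?_, ?_⟩
      · have : (l :: L).flatten[t] = L.flatten[t - l.length] := by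
          simp only [List.flatten_cons]
          exact List.getElem_append_right h
        rw [this, List.cons_append, ← h1]
      · simp only [List.flatten_cons, List.length_append]; omega

lemma Reduced.of_isPrefix {u w : Word S} (hw : Reduced w) (h : u <+: w) : Reduced u :=
  List.IsChain.left_of_append (h.choose_spec.symm ▸ hw)

lemma Reduced.ne {u v : Word S} {x y : S × Bool} (h : Reduced (u ++ x :: y :: v)) :
    y ≠ invL x := by
  rintro rfl
  have h1 : List.IsChain (fun a b : S × Bool => a.1 ≠ b.1 ∨ a.2 = b.2) (u ++ x :: invL x :: v) := h
  rw [List.isChain_append_cons_cons] at h1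
  have := h1.2.1
  simp at this

end RDiag

end GSC

namespace GSC

section Conversion

variable {S : Type}

namespace Dart

variable {F : List (List ℕ)}

lemma fst_next (d : Dart F) : (next F d).1 = d.1 := rfl

lemma fst_next_pow (d : Dart F) (j : ℕ) : ((next F ^ j) d).1 = d.1 := by
  rw [next_pow]

lemma snd_next_pow (d : Dart F) (j : ℕ) :
    (((next F ^ j) d).2 : ℕ) = ((d.2 : ℕ) + j) % (F.get d.1).length := by
  obtain ⟨a, i⟩ := d
  rw [next_pow]
  exact cycSucc_pow_val i j

lemma snd_next (d : Dart F) :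
    ((next F d).2 : ℕ) = ((d.2 : ℕ) + 1) % (F.get d.1).length := by
  have := snd_next_pow d 1
  rwa [pow_one] at this

lemma ext_val {d e : Dart F} (h1 : (d.1 : ℕ) = e.1) (h2 : (d.2 : ℕ) = e.2) : d = e := by
  obtain ⟨a, i⟩ := d
  obtain ⟨b, j⟩ := e
  obtain rfl : a = b := Fin.ext h1
  obtain rfl : i = j := Fin.ext h2
  rfl

lemma orbitWord_card (lab : ℕ → S × Bool) (d : Dart F) :
    orbitWord (next F) (fun e => lab (val e))
      (Finset.univ.filter fun e : Dart F => (e.1 : ℕ) = (d.1 : ℕ)).card d =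
      ((F.get d.1).rotate d.2).map lab := by
  rw [card_fiber]
  exact map_range_next lab d

lemma orbitWord_eq_take (lab : ℕ → S × Bool) (d : Dart F) (l : ℕ)
    (hl : (d.2 : ℕ) + l ≤ (F.get d.1).length) :
    orbitWord (next F) (fun e => lab (val e)) l d =
      (((F.get d.1).map lab).drop d.2).take l := by
  obtain ⟨a, i⟩ := d
  refine List.ext_getElem ?_ fun j h1 h2 => ?_
  · simp only [orbitWord, List.length_map, List.length_range, List.length_take, List.length_drop]
    simp only [List.get_eq_getElem] at hl ⊢
    omega
  · simp only [orbitWord, List.length_map, List.length_range] at h1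
    simp only [orbitWord, List.getElem_map, List.getElem_range, val_next_pow, List.getElem_take,
      List.getElem_drop]
    congr 2
    exact Nat.mod_eq_of_lt (by change i.1 + l ≤ (F.get a).length at hl; omega)

lemma val_eq_getElem (d : Dart F) : val d = (F.get d.1)[(d.2 : ℕ)] := rfl

lemma get_eq_take_append (d : Dart F) :
    F.get d.1 = (F.get d.1).take d.2 ++ val d :: (F.get d.1).drop (d.2 + 1) := by
  have h : val d :: (F.get d.1).drop (d.2 + 1) = (F.get d.1).drop d.2 := by
    rw [val_eq_getElem, ← List.drop_eq_getElem_cons]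
  rw [h, List.take_append_drop]

lemma rotate_eq (d : Dart F) :
    (F.get d.1).rotate d.2 =
      val d :: ((F.get d.1).drop (d.2 + 1) ++ (F.get d.1).take d.2) := by
  have h : val d :: (F.get d.1).drop (d.2 + 1) = (F.get d.1).drop d.2 := by
    rw [val_eq_getElem, ← List.drop_eq_getElem_cons]
  rw [List.rotate_eq_drop_append_take d.2.2.le, ← h]
  rfl

lemma rotate_next_eq (d : Dart F) :
    (F.get (next F d).1).rotate (next F d).2 =
      ((F.get d.1).drop (d.2 + 1) ++ (F.get d.1).take d.2) ++ [val d] := by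
  rw [snd_next, fst_next]
  rw [List.rotate_mod, ← List.rotate_rotate, rotate_eq]
  simp

end Dart

lemma exists_perm_cons_cons {A : Type*} (l : List A) (i j : ℕ) (hi : i < l.length)
    (hj : j < l.length) (hij : i ≠ j) : ∃ rest, l.Perm (l[i] :: l[j] :: rest) := by
  classical
  have h1 := List.getElem_cons_eraseIdx_perm hi
  have h2 : l[j] ∈ l.eraseIdx i := by
    rw [List.mem_eraseIdx_iff_getElem]
    exact ⟨j, hj, hij.symm, rfl⟩
  exact ⟨_, h1.symm.trans ((List.perm_cons_erase h2).cons _)⟩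

variable {P : C6Presentation S} {v : Word S} {ws : List (Word S)} {lab : ℕ → S × Bool}
  {α : ℕ → ℕ} {out : List ℕ} {ins : List (List ℕ)}

namespace IsReducedDiag

lemma get_mem (d : Dart (out :: ins)) (hd : (d.1 : ℕ) ≠ 0) : (out :: ins).get d.1 ∈ ins := by
  obtain ⟨⟨a, ha⟩, i⟩ := d
  cases a with
  | zero => exact absurd rfl hd
  | succ a => exact List.getElem_mem _

lemma get_eq (d : Dart (out :: ins)) (hd : (d.1 : ℕ) = 0) : (out :: ins).get d.1 = out := by
  obtain ⟨⟨a, ha⟩, i⟩ := d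
  cases a with
  | zero => rfl
  | succ a => exact absurd hd (Nat.succ_ne_zero a)

lemma snd_lt (d : Dart (out :: ins)) (hd : (d.1 : ℕ) = 0) : (d.2 : ℕ) < out.length :=
  d.2.2.trans_eq (congrArg List.length (get_eq d hd))

lemma length_out (hR : IsReducedDiag P v ws lab α out ins) :
    out.length = v.length + ws.flatten.length := by
  have := congrArg List.length hR.out_lab
  rwa [List.length_map, List.length_append] at this

lemma lab_val (hR : IsReducedDiag P v ws lab α out ins) (d : Dart (out :: ins))
    (hd : (d.1 : ℕ) = 0) : lab (Dart.val d) =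
      (v ++ ws.flatten)[(d.2 : ℕ)]'(by
        rw [List.length_append, ← hR.length_out]; exact snd_lt d hd) := by
  have h : ∀ (l : List ℕ) (hl : (d.2 : ℕ) < l.length), l = out → lab (l[(d.2 : ℕ)]) =
      (v ++ ws.flatten)[(d.2 : ℕ)]'(by
        rw [List.length_append, ← hR.length_out]; exact snd_lt d hd) := by
    rintro l hl rfl
    rw [← List.getElem_map lab (h := by rwa [List.length_map])]
    exact getElem_congr_coll hR.out_lab
  exact h _ d.2.2 (get_eq d hd)

lemma lab_val_of_lt (hR : IsReducedDiag P v ws lab α out ins) (d : Dart (out :: ins))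
    (hd : (d.1 : ℕ) = 0) (h : (d.2 : ℕ) < v.length) : lab (Dart.val d) = v[(d.2 : ℕ)] := by
  rw [hR.lab_val d hd, List.getElem_append_left h]

/-- The decomposition of the boundary word at a position beyond `v`. -/
lemma exists_part (hR : IsReducedDiag P v ws lab α out ins) (d : Dart (out :: ins))
    (hd : (d.1 : ℕ) = 0) (h : v.length ≤ (d.2 : ℕ)) :
    ∃ ws₁ p₁ p₂ ws₂, ws = ws₁ ++ (p₁ ++ lab (Dart.val d) :: p₂) :: ws₂ ∧
      (d.2 : ℕ) = v.length + ws₁.flatten.length + p₁.length := by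
  have h1 := snd_lt d hd
  have h2 := hR.length_out
  obtain ⟨ws₁, p₁, p₂, ws₂, h3, h4⟩ :=
    exists_flatten_getElem ws ((d.2 : ℕ) - v.length) (by omega)
  refine ⟨ws₁, p₁, p₂, ws₂, ?_, by omega⟩
  rw [hR.lab_val d hd, List.getElem_append_right h]
  exact h3

lemma lab_val_prev (hR : IsReducedDiag P v ws lab α out ins) (d e : Dart (out :: ins))
    (he : (e.1 : ℕ) = 0) {ws₁ ws₂ : List (Word S)} {p₁ p₂ : Word S}
    {y : S × Bool} (h3 : ws = ws₁ ++ (p₁ ++ y :: lab (Dart.val d) :: p₂) :: ws₂)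
    (h4 : (d.2 : ℕ) = v.length + ws₁.flatten.length + (p₁.length + 1))
    (h5 : (e.2 : ℕ) + 1 = d.2) : lab (Dart.val e) = y := by
  rw [hR.lab_val e he]
  have h6 : v ++ ws.flatten = (v ++ (ws₁.flatten ++ p₁)) ++
      y :: (lab (Dart.val d) :: (p₂ ++ ws₂.flatten)) := by
    conv_lhs => rw [h3]
    simp
  have h7 : (e.2 : ℕ) = (v ++ (ws₁.flatten ++ p₁)).length := by
    simp only [List.length_append]; omega
  rw [getElem_congr_coll h6, List.getElem_append_right (by omega)]
  simp [h7]

end IsReducedDiag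

end Conversion

end GSC

namespace GSC

section Conversion

variable {S : Type} {P : C6Presentation S} {v : Word S} {ws : List (Word S)}
  {lab : ℕ → S × Bool} {α : ℕ → ℕ} {out : List ℕ} {ins : List (List ℕ)}

namespace IsReducedDiag

open Dart

lemma orbitWord_mem (hR : IsReducedDiag P v ws lab α out ins) (d : Dart (out :: ins))
    (hd : (d.1 : ℕ) ≠ 0) :
    orbitWord (next (out :: ins)) (fun e => lab (val e))
      (Finset.univ.filter fun e : Dart (out :: ins) => (e.1 : ℕ) = (d.1 : ℕ)).card d ∈ P.rels := by
  rw [orbitWord_card, List.map_rotate]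
  exact P.rotate_mem _ (hR.rel _ (get_mem d hd)) _

lemma snd_next_out (d : Dart (out :: ins)) (hd : (d.1 : ℕ) = 0) :
    ((next (out :: ins) d).2 : ℕ) = ((d.2 : ℕ) + 1) % out.length :=
  (snd_next d).trans
    (congrArg (fun l : List ℕ => ((d.2 : ℕ) + 1) % l.length) (get_eq d hd))

lemma lab_next_ne (hR : IsReducedDiag P v ws lab α out ins) {γ : ℤ → P.Grp} {s : ℤ}
    (hγ : Function.Injective γ)
    (hv : ∀ (i : ℕ) (hi : i < v.length), P.eltL v[i] = (γ (s + i))⁻¹ * γ (s + i + 1))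
    (d : Dart (out :: ins))
    (hd : ((d.1 : ℕ) = 0 → ((next (out :: ins) d).2 : ℕ) ≠ 0 ∧ ∀ j < ws.length,
      ((next (out :: ins) d).2 : ℕ) ≠ v.length + (ws.take j).flatten.length)) :
    lab (val (next (out :: ins) d)) ≠ invL (lab (val d)) := by
  by_cases h0 : (d.1 : ℕ) = 0
  · obtain ⟨h1, h2⟩ := hd h0
    have h3 := snd_next_out d h0
    have h4 := snd_lt d h0
    have h5 : (d.2 : ℕ) + 1 < out.length := by
      by_contra hge
      have : (d.2 : ℕ) + 1 = out.length := by omega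
      rw [this, Nat.mod_self] at h3
      exact h1 h3
    rw [Nat.mod_eq_of_lt h5] at h3
    have hd' : ((next (out :: ins) d).1 : ℕ) = 0 := h0
    have hlen := hR.length_out
    rcases Nat.lt_or_ge ((d.2 : ℕ) + 1) v.length with h6 | h6
    · intro he
      rw [hR.lab_val_of_lt _ hd' (by omega), hR.lab_val_of_lt _ h0 (by omega)] at he
      have h7 := congrArg P.eltL he
      rw [P.eltL_invL, hv, hv, mul_inv_rev, inv_inv, h3] at h7
      have h8 : s + (((d.2 : ℕ) + 1 : ℕ) : ℤ) = s + (d.2 : ℕ) + 1 := by push_cast; ring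
      rw [h8, mul_right_inj] at h7
      have := hγ h7
      omega
    · obtain ⟨ws₁, p₁, p₂, ws₂, h7, h8⟩ := hR.exists_part _ hd' (by omega)
      rcases List.eq_nil_or_concat p₁ with rfl | ⟨p, y, rfl⟩
      · refine absurd ?_ (h2 ws₁.length (by rw [h7]; simp))
        rw [h8]
        conv_rhs => rw [h7]
        simp
      · rw [List.concat_eq_append] at h7 h8
        have h9 : ws = ws₁ ++ (p ++ y :: lab (val (next (out :: ins) d)) :: p₂) :: ws₂ := by
          rw [h7]; simp
        rw [hR.lab_val_prev (next (out :: ins) d) d h0 h9 (by simpa using h8) h3.symm]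
        rcases hR.isPart (p ++ y :: lab (val (next (out :: ins) d)) :: p₂)
          (h9 ▸ by simp) with ⟨r, hr, h10⟩ | ⟨x, h10, -⟩
        · refine Reduced.ne (Reduced.of_isPrefix ?_ h10)
          exact Reduced.of_isPrefix (P.cyclically_reduced r hr) (List.prefix_append r r)
        · have := congrArg List.length h10
          simp only [List.length_append, List.length_cons, List.length_nil] at this
          omega
  · have h1 := hR.orbitWord_mem d h0
    rw [orbitWord_card, rotate_eq] at h1
    have h2 := P.cyclically_reduced _ h1
    have h3 := rotate_eq (next (out :: ins) d)
    rw [rotate_next_eq] at h3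
    rcases hs : (((out :: ins).get d.1).drop (d.2 + 1) ++ ((out :: ins).get d.1).take d.2) with
      _ | ⟨x, s⟩
    · rw [hs] at h3 h2
      have h4 : val d = val (next (out :: ins) d) := by
        rw [List.nil_append] at h3
        exact (List.cons.inj h3).1
      rw [← h4]
      exact (invL_ne _).symm
    · rw [hs] at h3 h2
      have h4 : x = val (next (out :: ins) d) := by
        exact (List.cons.inj h3).1
      rw [← h4]
      exact Reduced.ne (u := []) h2

lemma orbitWord_ne (hR : IsReducedDiag P v ws lab α out ins) (d : Dart (out :: ins))
    (h1 : (d.1 : ℕ) ≠ 0) (h2 : ((hR.isDiag.opp d).1 : ℕ) ≠ 0)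
    (h3 : (d.1 : ℕ) ≠ (hR.isDiag.opp d).1) :
    orbitWord (next (out :: ins)) (fun e => lab (val e))
      (Finset.univ.filter fun e : Dart (out :: ins) => (e.1 : ℕ) = (d.1 : ℕ)).card d ≠
    wordInv (orbitWord (next (out :: ins)) (fun e => lab (val e))
      (Finset.univ.filter fun e : Dart (out :: ins) => (e.1 : ℕ) =
        ((hR.isDiag.opp d).1 : ℕ)).card (next (out :: ins) (hR.isDiag.opp d))) := by
  set e := hR.isDiag.opp d with he
  have h4 : orbitWord (next (out :: ins)) (fun e => lab (val e))
      (Finset.univ.filter fun f : Dart (out :: ins) => (f.1 : ℕ) = (e.1 : ℕ)).card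
      (next (out :: ins) e) = _ := orbitWord_card lab (next (out :: ins) e)
  intro h
  rw [h4, orbitWord_card, rotate_eq, rotate_next_eq, List.map_append, wordInv_append,
    List.map_cons] at h
  simp only [List.map_cons, List.map_nil, wordInv_cons, wordInv_nil, List.nil_append,
    List.cons_append, List.cons.injEq] at h
  have h5 : val e = α (val d) := hR.isDiag.val_opp d
  obtain ⟨⟨a, ha⟩, i⟩ := d
  obtain ⟨⟨b, hb⟩, j⟩ := e
  cases a with
  | zero => exact h1 rfl
  | succ a =>
  cases b with
  | zero => exact h2 rfl
  | succ b =>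
  obtain ⟨rest, hp⟩ := exists_perm_cons_cons ins a b (Nat.lt_of_succ_lt_succ ha)
    (Nat.lt_of_succ_lt_succ hb) (fun hab => h3 (congrArg Nat.succ hab))
  have h6 := get_eq_take_append (F := out :: ins) ⟨⟨a + 1, ha⟩, i⟩
  have h7 := get_eq_take_append (F := out :: ins) ⟨⟨b + 1, hb⟩, j⟩
  rw [h5] at h7
  change ins[a]'(Nat.lt_of_succ_lt_succ ha) = _ at h6
  change ins[b]'(Nat.lt_of_succ_lt_succ hb) = _ at h7
  rw [h6, h7] at hp
  exact hR.no_cancel hp h.2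

lemma part_ne (hR : IsReducedDiag P v ws lab α out ins) (e : Dart (out :: ins))
    (h0 : (e.1 : ℕ) = 0) (h1 : ((hR.isDiag.opp e).1 : ℕ) ≠ 0) {ws₁ ws₂ : List (Word S)}
    {p₁ p₂ q : Word S} (h3 : ws = ws₁ ++ (p₁ ++ lab (val e) :: p₂) :: ws₂)
    (h4 : (e.2 : ℕ) = v.length + ws₁.flatten.length + p₁.length)
    (hr : p₁ ++ lab (val e) :: (p₂ ++ q) ∈ P.rels) :
    orbitWord (next (out :: ins)) (fun e => lab (val e))
      (Finset.univ.filter fun d : Dart (out :: ins) => (d.1 : ℕ) =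
        ((hR.isDiag.opp e).1 : ℕ)).card (hR.isDiag.opp e) ≠
      invL (lab (val e)) :: (wordInv p₁ ++ (wordInv q ++ wordInv p₂)) := by
  set d := hR.isDiag.opp e with he
  rw [orbitWord_card, rotate_eq, List.map_cons]
  intro h
  have h5 : val e = α (val d) := by rw [← hR.isDiag.val_opp, he, hR.isDiag.opp_opp]
  have hp := List.perm_cons_erase (get_mem d h1)
  rw [get_eq_take_append] at hp
  have h6 := get_eq_take_append e
  have h7 : out = out.take e.2 ++ val e :: out.drop (e.2 + 1) := by
    have : ∀ l, l = out → l = l.take e.2 ++ val e :: l.drop (e.2 + 1) →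
      out = out.take e.2 ++ val e :: out.drop (e.2 + 1) := by rintro l rfl h; exact h
    exact this _ (get_eq e h0) h6
  rw [h5] at h7
  refine hR.no_absorb (ws₁ := ws₁) (ws₂ := ws₂) (p₁ := p₁) (p₂ := p₂) (q := q) hp h7 ?_ ?_ ?_
    (List.cons.inj h).2
  · rwa [← h5]
  · rw [List.map_take, hR.out_lab, h3]
    simp only [List.flatten_append, List.flatten_cons, List.append_assoc]
    rw [List.take_append, List.take_of_length_le (by omega), List.take_append,
      List.take_of_length_le (by omega), List.take_append, List.take_of_length_le (by omega)]
    have : (e.2 : ℕ) - v.length - ws₁.flatten.length - p₁.length = 0 := by omega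
    rw [this]; simp
  · rwa [← h5]

end IsReducedDiag

end Conversion

end GSC

namespace GSC

section Conversion

variable {S : Type} {P : C6Presentation S} {v : Word S} {ws : List (Word S)}
  {lab : ℕ → S × Bool} {α : ℕ → ℕ} {out : List ℕ} {ins : List (List ℕ)}

namespace IsReducedDiag

open Dart

lemma map_lab_prod (hR : IsReducedDiag P v ws lab α out ins) :
    ∀ f ∈ out :: ins, (f.map fun x => P.eltL (lab x)).prod = 1 := by
  intro f hf
  have h : (f.map fun x => P.eltL (lab x)).prod = P.elt (f.map lab) := by
    rw [P.elt_eq_prod, List.map_map]; rfl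
  rw [h]
  rcases List.mem_cons.1 hf with rfl | hf
  · rw [hR.out_lab, hR.elt_eq]
  · exact P.elt_rel (hR.rel f hf)

lemma exists_pos (hR : IsReducedDiag P v ws lab α out ins) (d₀ : Dart (out :: ins)) (b : P.Grp) :
    ∃ pos : Dart (out :: ins) → P.Grp, pos d₀ = b ∧
      (∀ d, pos (hR.isDiag.opp d) = pos d * P.eltL (lab (val d))) ∧
      ∀ d, pos (next (out :: ins) d) = pos d * P.eltL (lab (val d)) := by
  obtain ⟨σ, h1, h2⟩ := hR.isDiag.exists_potential (H := P.Grp)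
    (fun d => P.eltL (lab (val d))) (fun d => by
      rw [hR.isDiag.val_opp, hR.isDiag.lab_inv _ (val_mem_flatten d)]
      exact P.eltL_invL _) (fun a => by
      rw [← hR.map_lab_prod _ (List.get_mem _ a)]
      congr 1
      exact List.ext_getElem (by simp) fun i h1 h2 => by simp [val])
  exact ⟨fun d => b * (σ d₀)⁻¹ * σ d, by simp, fun d => by simp only [h1, mul_assoc],
    fun d => by simp only [h2, mul_assoc]⟩

lemma exists_potential_rat (hR : IsReducedDiag P v ws lab α out ins) (h : Dart (out :: ins) → ℚ)
    (h1 : ∀ d, h (hR.isDiag.opp d) = - h d)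
    (h2 : ∀ i, 1 ≤ i → i ≤ ins.length →
      ∑ e : Dart (out :: ins) with (e.1 : ℕ) = i, h e = 0) :
    ∃ σ : Dart (out :: ins) → ℚ, ∀ d, σ (hR.isDiag.opp d) = σ d + h d ∧
      σ (next (out :: ins) d) = σ d + h d := by
  have h3 : ∑ e, h e = 0 := by
    have : ∑ e, h (hR.isDiag.opp e) = ∑ e, h e := Equiv.sum_comp _ _
    simp only [h1, Finset.sum_neg_distrib] at this
    linarith
  have h4 : ∀ a : Fin (out :: ins).length,
      ∑ e : Dart (out :: ins) with (e.1 : ℕ) = a, h e = ∑ i, h ⟨a, i⟩ := by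
    intro a
    refine Eq.trans (Finset.sum_congr ?_ fun _ _ => rfl) (Finset.sum_map Finset.univ
      (Function.Embedding.sigmaMk (β := fun a => Fin ((out :: ins).get a).length) a) h)
    ext ⟨b, j⟩
    simp only [Finset.mem_filter, Finset.mem_univ, true_and, Finset.mem_map,
      Function.Embedding.sigmaMk_apply]
    constructor
    · intro h
      obtain rfl := Fin.ext h
      exact ⟨j, rfl⟩
    · rintro ⟨i, h⟩
      rw [(Sigma.mk.inj_iff.1 h).1]
  have h5 : ∀ a : Fin (out :: ins).length, ∑ i, h ⟨a, i⟩ = 0 := by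
    have hs : ∀ a : Fin ins.length, ∑ i, h ⟨a.succ, i⟩ = 0 := by
      intro a
      have := h2 (a.1 + 1) (by omega) (by omega)
      rw [← this]
      exact (h4 a.succ).symm
    intro a
    refine Fin.cases ?_ hs a
    rw [Fintype.sum_sigma] at h3
    have h6 : ∑ a : Fin (ins.length + 1), ∑ i : Fin ((out :: ins).get a).length,
      h ⟨a, i⟩ = 0 := h3
    rw [Fin.sum_univ_succ] at h6
    rw [Finset.sum_eq_zero (fun a _ => hs a), add_zero] at h6
    exact h6
  obtain ⟨σ, h6, h7⟩ := hR.isDiag.exists_potential (H := Multiplicative ℚ)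
    (fun d => Multiplicative.ofAdd (h d)) (fun d => by rw [h1]; rfl) (fun a => by
      rw [List.prod_ofFn, ← ofAdd_sum, h5, ofAdd_zero])
  exact ⟨fun d => (σ d).toAdd, fun d => ⟨congrArg Multiplicative.toAdd (h6 d),
    congrArg Multiplicative.toAdd (h7 d)⟩⟩

lemma pos_eq (hR : IsReducedDiag P v ws lab α out ins) {γ : ℤ → P.Grp} {s : ℤ}
    (hv : ∀ (i : ℕ) (hi : i < v.length), P.eltL v[i] = (γ (s + i))⁻¹ * γ (s + i + 1))
    (h0 : 0 < out.length) {pos : Dart (out :: ins) → P.Grp}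
    (h1 : pos ⟨⟨0, Nat.succ_pos _⟩, ⟨0, h0⟩⟩ = γ s)
    (h2 : ∀ d, pos (next (out :: ins) d) = pos d * P.eltL (lab (val d)))
    (i : ℕ) (d : Dart (out :: ins)) (hd : (d.1 : ℕ) = 0) (hi : (d.2 : ℕ) = i)
    (hiv : i < v.length) :
    pos d = γ (s + i) ∧ pos (next (out :: ins) d) = γ (s + i + 1) := by
  have hlen := hR.length_out
  have key : ∀ d : Dart (out :: ins), (d.1 : ℕ) = 0 → ∀ i, (d.2 : ℕ) = i → i < v.length →
      pos d = γ (s + i) → pos (next (out :: ins) d) = γ (s + i + 1) := by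
    rintro d hd _ rfl hi h
    rw [h2, h, hR.lab_val_of_lt d hd hi, hv]
    group
  induction i generalizing d with
  | zero =>
    have h3 : d = ⟨⟨0, Nat.succ_pos _⟩, ⟨0, h0⟩⟩ := ext_val hd hi
    have h4 : pos d = γ (s + (0 : ℕ)) := by rw [h3, h1]; simp
    exact ⟨h4, key d hd 0 hi hiv h4⟩
  | succ i ih =>
    let e : Dart (out :: ins) := ⟨⟨0, Nat.succ_pos _⟩, ⟨i, by simp; omega⟩⟩
    have h3 : next (out :: ins) e = d := by
      refine ext_val (by rw [fst_next]; exact hd.symm) ?_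
      rw [snd_next_out e rfl, hi]
      exact Nat.mod_eq_of_lt (show i + 1 < _ by omega)
    have h4 := (ih e rfl rfl (by omega)).2
    rw [h3] at h4
    have h5 : pos d = γ (s + (i + 1 : ℕ)) := by rw [h4]; congr 1; push_cast; ring
    exact ⟨h5, key d hd _ hi hiv h5⟩

open Classical in
lemma nonempty_rdiag (hR : IsReducedDiag P v ws lab α out ins) {γ : ℤ → P.Grp} {s : ℤ}
    (hγ : Function.Injective γ) (hv0 : 0 < v.length)
    (hv : ∀ (i : ℕ) (hi : i < v.length), P.eltL v[i] = (γ (s + i))⁻¹ * γ (s + i + 1)) :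
    Nonempty (RDiag P γ s v.length ws.length (Dart (out :: ins))) := by
  have hlen := hR.length_out
  have h0 : 0 < out.length := by omega
  obtain ⟨pos, hp0, hp1, hp2⟩ := hR.exists_pos ⟨⟨0, Nat.succ_pos _⟩, ⟨0, h0⟩⟩ (γ s)
  have hpos := hR.pos_eq hv h0 hp0 hp2
  have hwrap : ∀ d : Dart (out :: ins), (d.1 : ℕ) = 0 → ((next (out :: ins) d).2 : ℕ) ≠ 0 →
      ((next (out :: ins) d).2 : ℕ) = (d.2 : ℕ) + 1 := by
    intro d hd h
    have h1 := snd_next_out d hd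
    have h2 := snd_lt d hd
    rw [h1] at h ⊢
    refine Nat.mod_eq_of_lt (lt_of_le_of_ne h2 fun h3 => h ?_)
    rw [h3, Nat.mod_self]
  refine ⟨{
    φ := next (out :: ins)
    α := hR.isDiag.opp
    lab := fun d => lab (val d)
    pos := pos
    n := ins.length
    fc := fun d => d.1
    Brk := Finset.univ.filter fun d => (d.1 : ℕ) = 0 ∧ ((d.2 : ℕ) = 0 ∨
      ∃ j < ws.length, (d.2 : ℕ) = v.length + (ws.take j).flatten.length)
    V := Finset.univ.filter fun d => (d.1 : ℕ) = 0 ∧ (d.2 : ℕ) < v.length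
    idx := fun d => d.2
    α_α := hR.isDiag.opp_opp
    lab_α := fun d => by
      rw [hR.isDiag.val_opp, hR.isDiag.lab_inv _ (val_mem_flatten d)]
    pos_α := hp1
    pos_φ := hp2
    fc_le := fun d => Nat.le_of_lt_succ d.1.2
    fc_φ := fun d => rfl
    fc_surj := ?_
    pow_size := ?_
    exists_pow := ?_
    rel := fun d hd => hR.orbitWord_mem d hd
    red := ?_
    V_fc := fun d hd => (Finset.mem_filter.1 hd).2.1
    V_idx := fun d hd => (Finset.mem_filter.1 hd).2.2
    V_inj := fun d hd e he h => ext_val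
      ((Finset.mem_filter.1 hd).2.1.trans (Finset.mem_filter.1 he).2.1.symm) h
    V_pos := fun d hd => (hpos _ d (Finset.mem_filter.1 hd).2.1 rfl (Finset.mem_filter.1 hd).2.2).1
    V_pos' := fun d hd => (hpos _ d (Finset.mem_filter.1 hd).2.1 rfl (Finset.mem_filter.1 hd).2.2).2
    V_card := ?_
    V_exit := ?_
    V_brk := ?_
    brk_fc := fun d hd => (Finset.mem_filter.1 hd).2.1
    brk_card := ?_
    no_cancel := fun d h1 h2 h3 => hR.orbitWord_ne d h1 h2 h3
    part := ?_
    sc := hR.exists_potential_rat }⟩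
  · rintro (_ | i) h1 h2
    · omega
    · have h3 : 0 < (ins[i]'h2).length :=
        List.length_pos_iff.2 (hR.ne_nil _ (List.getElem_mem _))
      exact ⟨⟨⟨i + 1, Nat.succ_lt_succ h2⟩, ⟨0, h3⟩⟩, rfl⟩
  · intro d
    rw [card_fiber]
    refine ext_val (by rw [fst_next_pow]) ?_
    rw [snd_next_pow, Nat.add_mod_right, Nat.mod_eq_of_lt d.2.2]
  · rintro ⟨a, i⟩ ⟨b, j⟩ h
    obtain rfl : a = b := Fin.ext h
    rw [card_fiber]
    have hpos : 0 < ((out :: ins).get a).length := i.1.zero_le.trans_lt i.2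
    refine ⟨(j.1 + (((out :: ins).get a).length - i.1)) % ((out :: ins).get a).length,
      Nat.mod_lt _ hpos, ext_val (by rw [fst_next_pow]) ?_⟩
    rw [snd_next_pow]
    change (i.1 + (j.1 + (((out :: ins).get a).length - i.1)) % ((out :: ins).get a).length) %
      ((out :: ins).get a).length = j.1
    have h1 := i.2
    have h2 := j.2
    rw [Nat.add_mod_mod]
    have : i.1 + (j.1 + (((out :: ins).get a).length - i.1)) =
      j.1 + ((out :: ins).get a).length := by omega
    rw [this, Nat.add_mod_right, Nat.mod_eq_of_lt h2]
  · intro d hd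
    refine hR.lab_next_ne hγ hv d fun h1 => ?_
    rw [Finset.mem_filter] at hd
    constructor
    · exact fun h => hd ⟨Finset.mem_univ _, h1, Or.inl h⟩
    · exact fun j hj h => hd ⟨Finset.mem_univ _, h1, Or.inr ⟨j, hj, h⟩⟩
  · refine Eq.trans ?_ (Finset.card_range v.length)
    refine Finset.card_bij (fun d _ => (d.2 : ℕ)) ?_ ?_ ?_
    · intro d hd
      exact Finset.mem_range.2 (Finset.mem_filter.1 hd).2.2
    · intro d hd e he h
      exact ext_val ((Finset.mem_filter.1 hd).2.1.trans (Finset.mem_filter.1 he).2.1.symm) h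
    · intro i hi
      rw [Finset.mem_range] at hi
      exact ⟨⟨⟨0, Nat.succ_pos _⟩, ⟨i, by simp; omega⟩⟩, by simp [hi], rfl⟩
  · intro d hd hd'
    obtain ⟨-, h1, h2⟩ := Finset.mem_filter.1 hd
    by_contra hne
    refine hd' (Finset.mem_filter.2 ⟨Finset.mem_univ _, h1, ?_⟩)
    rw [snd_next_out d h1, Nat.mod_eq_of_lt (by omega)]
    omega
  · intro d hd
    simp only [Finset.mem_filter, Finset.mem_univ, true_and, not_and, not_or] at hd ⊢
    by_cases h1 : (d.1 : ℕ) = 0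
    · obtain ⟨h2, h3⟩ := hd h1
      have h4 := hwrap d h1 h2
      have h5 := snd_lt _ (show ((next (out :: ins) d).1 : ℕ) = 0 from h1)
      constructor
      · rintro ⟨-, h6⟩; exact ⟨h1, by omega⟩
      · rintro ⟨-, h6⟩
        refine ⟨h1, ?_⟩
        by_contra h7
        refine h3 ⟨0, ?_, by simp; omega⟩
        rcases ws with _ | ⟨w, ws⟩
        · simp at hlen; omega
        · simp
    · constructor
      · rintro ⟨h, -⟩; exact absurd h h1
      · rintro ⟨h, -⟩; exact absurd h h1
  · refine le_trans (Finset.card_le_card_of_injOn (t := insert 0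
      ((Finset.range ws.length).image fun j => v.length + (ws.take j).flatten.length))
      (fun d => (d.2 : ℕ)) ?_ ?_) ?_
    · intro d hd
      obtain ⟨-, -, h | ⟨j, hj, h⟩⟩ := Finset.mem_filter.1 hd
      · simp [h]
      · exact Finset.mem_insert_of_mem (Finset.mem_image.2 ⟨j, Finset.mem_range.2 hj, h.symm⟩)
    · intro d hd e he h
      exact ext_val ((Finset.mem_filter.1 hd).2.1.trans (Finset.mem_filter.1 he).2.1.symm) h
    · refine (Finset.card_insert_le _ _).trans (Nat.succ_le_succ ?_)
      exact Finset.card_image_le.trans (Finset.card_range _).le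
  · intro e he he'
    have h1 : v.length ≤ (e.2 : ℕ) := by
      by_contra h
      exact he' (Finset.mem_filter.2 ⟨Finset.mem_univ _, he, by omega⟩)
    obtain ⟨ws₁, p₁, p₂, ws₂, h2, h3⟩ := hR.exists_part e he h1
    have h4 := snd_lt e he
    let e₀ : Dart (out :: ins) :=
      ⟨⟨0, Nat.succ_pos _⟩, ⟨v.length + ws₁.flatten.length,
        show v.length + ws₁.flatten.length < out.length by omega⟩⟩
    have h5 : (next (out :: ins) ^ p₁.length) e₀ = e := by
      refine ext_val (by rw [fst_next_pow]; exact he.symm) ?_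
      rw [snd_next_pow]
      change (v.length + ws₁.flatten.length + p₁.length) % out.length = _
      rw [← h3, Nat.mod_eq_of_lt h4]
    refine ⟨e₀, Finset.mem_filter.2 ⟨Finset.mem_univ _, rfl, Or.inr ⟨ws₁.length, ?_, ?_⟩⟩,
      p₁, p₂, h5, ?_, hR.isPart _ (h2.symm ▸ by simp), ?_⟩
    · rw [h2]; simp
    · conv_rhs => rw [h2]
      simp [e₀]
    · rw [orbitWord_eq_take lab e₀ _ (show v.length + ws₁.flatten.length + (p₁.length + 1) ≤
        out.length by omega)]
      change ((out.map lab).drop (v.length + ws₁.flatten.length)).take (p₁.length + 1) = _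
      rw [hR.out_lab]
      have h6 : v ++ ws.flatten = (v ++ ws₁.flatten) ++ ((p₁ ++ [lab (val e)]) ++
          (p₂ ++ ws₂.flatten)) := by
        conv_lhs => rw [h2]
        simp
      rw [h6, ← List.length_append, List.drop_left]
      exact List.take_left' (by simp)
    · intro q hq hne
      exact hR.part_ne e he hne h2 h3 hq

end IsReducedDiag

end Conversion

end GSC

namespace GSC

section Faces

variable {S : Type} {P : C6Presentation S} {γ : ℤ → P.Grp} {s : ℤ} {m k : ℕ} {D : Type}
  [Fintype D] [DecidableEq D]

lemma length_orbitWord {D : Type} (φ : Equiv.Perm D) (lab : D → S × Bool) (N : ℕ) (d : D) :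
    (orbitWord φ lab N d).length = N := by simp [orbitWord]

lemma orbitWord_succ {D : Type} (φ : Equiv.Perm D) (lab : D → S × Bool) (N : ℕ) (d : D) :
    orbitWord φ lab (N + 1) d = orbitWord φ lab N d ++ [lab ((φ ^ N) d)] := by
  simp [orbitWord, List.range_succ]

lemma orbitWord_isPrefix {D : Type} (φ : Equiv.Perm D) (lab : D → S × Bool) {l N : ℕ} (h : l ≤ N)
    (d : D) : orbitWord φ lab l d <+: orbitWord φ lab N d := by
  obtain ⟨c, rfl⟩ := Nat.exists_eq_add_of_le h
  induction c with
  | zero => simp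
  | succ c ih =>
    rw [← add_assoc, orbitWord_succ]
    exact (ih (by omega)).trans (List.prefix_append _ _)

/-- The words read backwards along an orbit, in inverted letters. -/
def backWord {D : Type} (φ : Equiv.Perm D) (lab : D → S × Bool) (N : ℕ) (d : D) : Word S :=
  (List.range N).map fun j => invL (lab ((φ⁻¹ ^ j) d))

lemma inv_pow_apply_pow {D : Type} (φ : Equiv.Perm D) {i j : ℕ} (h : i ≤ j) (d : D) :
    (φ⁻¹ ^ i) ((φ ^ j) d) = (φ ^ (j - i)) d := by
  obtain ⟨c, rfl⟩ := Nat.exists_eq_add_of_le h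
  rw [pow_add, Equiv.Perm.mul_apply, ← Equiv.Perm.mul_apply, inv_pow, inv_mul_cancel]
  simp

lemma pow_apply_inv_pow {D : Type} (φ : Equiv.Perm D) {i j : ℕ} (h : i ≤ j) (d : D) :
    (φ ^ i) ((φ⁻¹ ^ j) d) = (φ⁻¹ ^ (j - i)) d := by
  have := inv_pow_apply_pow φ⁻¹ h d
  rwa [inv_inv] at this

lemma wordInv_orbitWord {D : Type} (φ : Equiv.Perm D) (lab : D → S × Bool) (N : ℕ) (d : D) :
    wordInv (orbitWord φ lab (N + 1) d) = backWord φ lab (N + 1) ((φ ^ N) d) := by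
  refine List.ext_getElem (by simp [length_wordInv, length_orbitWord, backWord]) ?_
  intro j h1 h2
  simp only [backWord, List.length_map, List.length_range] at h2
  simp only [wordInv_eq, List.getElem_reverse, List.getElem_map, backWord, List.getElem_range,
    orbitWord,
    List.length_map, List.length_range]
  rw [inv_pow_apply_pow _ (by omega)]
  congr 4

namespace RDiag

variable (Δ : RDiag P γ s m k D)

/-- The number of darts of the face of `d`. -/
def size (d : D) : ℕ := (Finset.univ.filter fun e => Δ.fc e = Δ.fc d).card

/-- The boundary word of the face of `d`, read from `d`. -/
def word (d : D) : Word S := orbitWord Δ.φ Δ.lab (Δ.size d) d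

lemma size_pos (d : D) : 0 < Δ.size d :=
  Finset.card_pos.2 ⟨d, by simp⟩

lemma fc_pow (j : ℕ) (d : D) : Δ.fc ((Δ.φ ^ j) d) = Δ.fc d := by
  induction j with
  | zero => rfl
  | succ j ih => rw [pow_succ', Equiv.Perm.mul_apply, Δ.fc_φ, ih]

lemma fc_inv_pow (j : ℕ) (d : D) : Δ.fc ((Δ.φ⁻¹ ^ j) d) = Δ.fc d := by
  rw [← Δ.fc_pow j, pow_apply_inv_pow _ le_rfl]
  simp

lemma size_congr {d e : D} (h : Δ.fc d = Δ.fc e) : Δ.size d = Δ.size e := by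
  rw [size, size, h]

lemma φ_pow_size (d : D) : (Δ.φ ^ Δ.size d) d = d := Δ.pow_size d

lemma length_word (d : D) : (Δ.word d).length = Δ.size d := length_orbitWord _ _ _ _

lemma word_mem {d : D} (hd : Δ.fc d ≠ 0) : Δ.word d ∈ P.rels := Δ.rel d hd

lemma lab_mem_word (d : D) : Δ.lab d ∈ Δ.word d := by
  rw [word, orbitWord, List.mem_map]
  exact ⟨0, List.mem_range.2 (Δ.size_pos d), rfl⟩

lemma wordInv_word (e : D) : wordInv (Δ.word (Δ.φ e)) = backWord Δ.φ Δ.lab (Δ.size e) e := by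
  obtain ⟨N, hN⟩ := Nat.exists_eq_succ_of_ne_zero (Δ.size_pos e).ne'
  have h2 := Δ.φ_pow_size e
  rw [word, Δ.size_congr (Δ.fc_φ e), hN, wordInv_orbitWord]
  rw [hN, Nat.succ_eq_add_one, pow_succ, Equiv.Perm.mul_apply] at h2
  rw [h2]

lemma lab_φ_ne_of_fc {d : D} (hd : Δ.fc d ≠ 0) : Δ.lab (Δ.φ d) ≠ invL (Δ.lab d) :=
  Δ.red d fun h => hd ((Δ.fc_φ d).symm.trans (Δ.brk_fc _ h))

lemma word_ne_self {d : D} (hd : Δ.fc d ≠ 0) (h : Δ.fc d = Δ.fc (Δ.α d)) :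
    Δ.word d ≠ backWord Δ.φ Δ.lab (Δ.size (Δ.α d)) (Δ.α d) := by
  intro heq
  obtain ⟨t, ht, h1⟩ := Δ.exists_pow d _ h
  have ht' : t < Δ.size d := ht
  have h2 : ∀ j ≤ t, Δ.lab ((Δ.φ ^ j) d) = invL (Δ.lab ((Δ.φ ^ (t - j)) d)) := by
    intro j hj
    have h3 : (Δ.word d)[j]'(by rw [Δ.length_word]; omega) =
        (backWord Δ.φ Δ.lab (Δ.size (Δ.α d)) (Δ.α d))[j]'(by
          rw [← heq, Δ.length_word]; omega) := getElem_congr_coll heq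
    simp only [word, orbitWord, backWord, List.getElem_map, List.getElem_range] at h3
    rw [h3, ← h1, inv_pow_apply_pow _ hj]
  rcases Nat.even_or_odd' t with ⟨c, rfl | rfl⟩
  · have := h2 c (by omega)
    rw [show 2 * c - c = c by omega] at this
    exact (invL_ne _) this.symm
  · have := h2 (c + 1) (by omega)
    rw [show 2 * c + 1 - (c + 1) = c by omega, pow_succ', Equiv.Perm.mul_apply] at this
    exact Δ.lab_φ_ne_of_fc (by rwa [Δ.fc_pow]) this

lemma exists_back {d : D} (hd : Δ.fc d ≠ 0) (hV : Δ.α d ∉ Δ.V) :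
    ∃ ρ ∈ P.rels, Δ.word d ≠ ρ ∧ ∀ l ≤ ρ.length,
      (∀ j, j + 1 < l → (Δ.φ⁻¹ ^ j) (Δ.α d) ∉ Δ.Brk) →
        backWord Δ.φ Δ.lab l (Δ.α d) <+: ρ := by
  by_cases he : Δ.fc (Δ.α d) = 0
  · obtain ⟨e₀, he₀, p₁, p₂, h1, h2, h3, h4⟩ := Δ.part _ he hV
    rcases h3 with ⟨r, hr, q, h3⟩ | ⟨x, h3, h5⟩
    · have h3' : p₁ ++ Δ.lab (Δ.α d) :: (p₂ ++ q) = r := by rw [← h3]; simp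
      have h6 := h4 q (h3' ▸ hr) (by rwa [Δ.α_α])
      rw [Δ.α_α] at h6
      have h7 : invL (Δ.lab (Δ.α d)) :: wordInv p₁ =
          backWord Δ.φ Δ.lab (p₁.length + 1) (Δ.α d) := by
        rw [← h1, ← wordInv_orbitWord, h2, wordInv_append]
        simp [wordInv_cons, h1]
      refine ⟨_, ?_, h6, fun l hl hbrk => ?_⟩
      · have h8 := P.rotate_mem _ (P.inv_mem _ hr) (wordInv (p₂ ++ q)).length
        have h9 : wordInv r = wordInv (p₂ ++ q) ++ (invL (Δ.lab (Δ.α d)) :: wordInv p₁) := by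
          rw [← h3', wordInv_append, wordInv_cons]; simp
        rw [h9, List.rotate_append_length_eq, wordInv_append] at h8
        simpa using h8
      · have h8 : l ≤ p₁.length + 1 := by
          by_contra hlt
          refine hbrk p₁.length (by omega) ?_
          rwa [← h1, inv_pow_apply_pow _ le_rfl, Nat.sub_self, pow_zero]
        have h9 : backWord Δ.φ Δ.lab l (Δ.α d) <+:
            backWord Δ.φ Δ.lab (p₁.length + 1) (Δ.α d) :=
          List.IsPrefix.map _ (by
            rw [List.prefix_iff_eq_take, List.length_range, List.take_range, min_eq_left h8])
        refine h9.trans ?_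
        rw [← h7, ← List.cons_append]
        exact List.prefix_append _ _
    · exfalso
      have h6 : Δ.lab (Δ.α d) = x := by
        have := congrArg List.length h3
        simp only [List.length_append, List.length_cons, List.length_nil] at this
        obtain rfl : p₁ = [] := List.eq_nil_of_length_eq_zero (by omega)
        exact (List.cons.inj h3).1
      refine h5 _ (P.inv_mem _ (Δ.word_mem hd)) ?_
      rw [← h6, Δ.lab_α, wordInv_eq, List.mem_reverse]
      exact List.mem_map_of_mem (Δ.lab_mem_word d)
  · refine ⟨wordInv (Δ.word (Δ.φ (Δ.α d))),
      P.inv_mem _ (Δ.word_mem (by rwa [Δ.fc_φ])), ?_, fun l hl _ => ?_⟩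
    · by_cases h : Δ.fc d = Δ.fc (Δ.α d)
      · rw [wordInv_word]
        exact Δ.word_ne_self hd h
      · have := Δ.no_cancel d hd he h
        rw [word, word, Δ.size_congr (Δ.fc_φ (Δ.α d))]
        exact this
    · rw [length_wordInv, length_word, Δ.size_congr (Δ.fc_φ (Δ.α d))] at hl
      rw [wordInv_word]
      exact List.IsPrefix.map _ (by
        rw [List.prefix_iff_eq_take, List.length_range, List.take_range, min_eq_left hl])

lemma six_mul_lt_size {d : D} (hd : Δ.fc d ≠ 0) (hV : Δ.α d ∉ Δ.V) {l : ℕ}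
    (h1 : ∀ j < l, Δ.α ((Δ.φ ^ j) d) = (Δ.φ⁻¹ ^ j) (Δ.α d))
    (h2 : ∀ j, j + 1 < l → (Δ.φ⁻¹ ^ j) (Δ.α d) ∉ Δ.Brk) : 6 * l < Δ.size d := by
  obtain ⟨ρ, hρ, hne, hpre⟩ := Δ.exists_back hd hV
  have h3 : ∀ l' ≤ l, backWord Δ.φ Δ.lab l' (Δ.α d) = orbitWord Δ.φ Δ.lab l' d := by
    intro l' hl'
    refine List.map_congr_left fun j hj => ?_
    rw [List.mem_range] at hj
    rw [← h1 j (by omega), Δ.lab_α, invL_invL]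
  have h4 : ∀ l' ≤ l, l' ≤ Δ.size d → l' ≤ ρ.length →
      6 * l' < Δ.size d ∧ 6 * l' < ρ.length := by
    intro l' hl hs hr
    have h5 := hpre l' hr fun j hj => h2 j (by omega)
    rw [h3 l' hl] at h5
    have h6 : orbitWord Δ.φ Δ.lab l' d <+: Δ.word d := orbitWord_isPrefix _ _ hs d
    have h7 : IsPiece P.rels (orbitWord Δ.φ Δ.lab l' d) :=
      ⟨_, Δ.word_mem hd, _, hρ, hne, h6, h5⟩
    have h8 := P.small_cancellation _ (Δ.word_mem hd) _ h6 h7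
    have h9 := P.small_cancellation _ hρ _ h5 h7
    rw [length_orbitWord] at h8 h9
    rw [length_word] at h8
    exact ⟨h8, h9⟩
  have h5 := h4 (min l (min (Δ.size d) ρ.length)) (by omega) (by omega) (by omega)
  omega

end RDiag

end Faces

end GSC

namespace GSC

section Runs

variable {S : Type} {P : C6Presentation S} {γ : ℤ → P.Grp} {s : ℤ} {m k : ℕ} {D : Type}
  [Fintype D] [DecidableEq D]

namespace RDiag

variable (Δ : RDiag P γ s m k D)

/-- The rotation about the initial vertex of a dart. -/
def rot (d : D) : D := Δ.φ (Δ.α d)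

/-- The darts whose initial vertex is not an interior vertex of a run. -/
def K : Finset D := Finset.univ.filter fun d =>
  ¬ (Δ.rot d ≠ d ∧ Δ.rot (Δ.rot d) = d ∧ d ∉ Δ.Brk ∧ Δ.rot d ∉ Δ.Brk)

lemma not_mem_K {d : D} : d ∉ Δ.K ↔
    (Δ.rot d ≠ d ∧ Δ.rot (Δ.rot d) = d ∧ d ∉ Δ.Brk ∧ Δ.rot d ∉ Δ.Brk) := by
  simp only [K, Finset.mem_filter, Finset.mem_univ, true_and, not_not]

lemma mem_K_of_mem_brk {d : D} (h : d ∈ Δ.Brk) : d ∈ Δ.K := by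
  by_contra h'
  exact (Δ.not_mem_K.1 h').2.2.1 h

lemma rot_injective : Function.Injective Δ.rot :=
  Δ.φ.injective.comp (Function.LeftInverse.injective Δ.α_α)

lemma rot_not_mem_K {d : D} (h : d ∉ Δ.K) : Δ.rot d ∉ Δ.K := by
  obtain ⟨h1, h2, h3, h4⟩ := Δ.not_mem_K.1 h
  exact Δ.not_mem_K.2 ⟨by rw [h2]; exact h1.symm, by rw [h2], h4, by rwa [h2]⟩

lemma rot_mem_K {d : D} : Δ.rot d ∈ Δ.K ↔ d ∈ Δ.K := by
  refine ⟨fun h => by_contra fun h' => Δ.rot_not_mem_K h' h, fun h => by_contra fun h' => ?_⟩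
  have h2 := (Δ.not_mem_K.1 h').2.1
  have h3 := Δ.rot_not_mem_K h'
  rw [Δ.rot_injective h2] at h3
  exact h3 h

lemma α_φ {d : D} (h : Δ.φ d ∉ Δ.K) : Δ.φ (Δ.α (Δ.φ d)) = Δ.α d := by
  have h2 := (Δ.not_mem_K.1 h).2.1
  have h3 : Δ.φ (Δ.α (Δ.φ (Δ.α (Δ.φ d)))) = Δ.φ d := h2
  have h4 := congrArg Δ.α (Δ.φ.injective h3)
  rwa [Δ.α_α] at h4

lemma α_φ_pow {d : D} {l : ℕ} (h : ∀ i, 1 ≤ i → i < l → (Δ.φ ^ i) d ∉ Δ.K) :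
    ∀ j < l, Δ.α ((Δ.φ ^ j) d) = (Δ.φ⁻¹ ^ j) (Δ.α d) := by
  intro j hj
  induction j with
  | zero => rfl
  | succ j ih =>
    have h1 := h (j + 1) (by omega) hj
    rw [pow_succ', Equiv.Perm.mul_apply] at h1 ⊢
    have h2 := Δ.α_φ h1
    rw [ih (by omega)] at h2
    rw [pow_succ', Equiv.Perm.mul_apply, Equiv.Perm.eq_inv_iff_eq]
    exact h2

lemma inv_pow_not_mem_K {d : D} {l : ℕ} (h : ∀ i, 1 ≤ i → i < l → (Δ.φ ^ i) d ∉ Δ.K) (j : ℕ)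
    (hj : j + 1 < l) : (Δ.φ⁻¹ ^ j) (Δ.α d) ∉ Δ.K := by
  have h1 := Δ.rot_not_mem_K (h (j + 1) (by omega) hj)
  rw [rot, Δ.α_φ_pow h (j + 1) hj, pow_succ', Equiv.Perm.mul_apply] at h1
  rwa [← Equiv.Perm.mul_apply, mul_inv_cancel, Equiv.Perm.one_apply] at h1

lemma V_inv_pow {d : D} {l : ℕ} (h : ∀ j, j + 1 < l → (Δ.φ⁻¹ ^ j) d ∉ Δ.K) :
    ∀ j < l, ((Δ.φ⁻¹ ^ j) d ∈ Δ.V ↔ d ∈ Δ.V) := by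
  intro j hj
  induction j with
  | zero => simp
  | succ j ih =>
    rw [← ih (by omega), pow_succ', Equiv.Perm.mul_apply]
    have h1 := fun hb => h j hj (Δ.mem_K_of_mem_brk hb)
    have h2 : Δ.φ (Δ.φ⁻¹ ((Δ.φ⁻¹ ^ j) d)) = (Δ.φ⁻¹ ^ j) d := by
      rw [← Equiv.Perm.mul_apply, mul_inv_cancel, Equiv.Perm.one_apply]
    have h3 := Δ.V_brk (Δ.φ⁻¹ ((Δ.φ⁻¹ ^ j) d)) (by rwa [h2])
    rw [h2] at h3
    exact h3.symm

lemma idx_φ (hγ : Function.Injective γ) {d : D} (h1 : d ∈ Δ.V) (h2 : Δ.φ d ∈ Δ.V) :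
    Δ.idx (Δ.φ d) = Δ.idx d + 1 := by
  have h3 := Δ.V_pos' d h1
  rw [Δ.V_pos _ h2] at h3
  have := hγ h3
  omega

lemma exists_pow_not_mem_V (hγ : Function.Injective γ) (d : D) : ∃ j, (Δ.φ ^ j) d ∉ Δ.V := by
  by_contra! h
  have h1 : ∀ j, Δ.idx ((Δ.φ ^ j) d) = Δ.idx d + j := by
    intro j
    induction j with
    | zero => rfl
    | succ j ih =>
      have h2 := h (j + 1)
      rw [pow_succ', Equiv.Perm.mul_apply] at h2 ⊢
      rw [Δ.idx_φ hγ (h j) h2, ih, add_assoc]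
  have := Δ.V_idx _ (h m)
  rw [h1] at this
  omega

lemma exists_inv_pow_not_mem_V (hγ : Function.Injective γ) (d : D) :
    ∃ j, (Δ.φ⁻¹ ^ j) d ∉ Δ.V := by
  by_contra! h
  obtain ⟨j, hj⟩ := Δ.exists_pow_not_mem_V hγ d
  have h1 : (Δ.φ ^ (j * Δ.size d)) d = d := by
    rw [mul_comm, pow_mul]
    exact Function.IsFixedPt.perm_pow (Δ.φ_pow_size d) j
  have h2 := h (j * Δ.size d - j)
  have h3 : (Δ.φ ^ j) d = (Δ.φ⁻¹ ^ (j * Δ.size d - j)) d := by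
    have h4 := Nat.le_mul_of_pos_right j (Δ.size_pos d)
    have h5 := inv_pow_apply_pow Δ.φ (Nat.sub_le (j * Δ.size d) j) d
    rw [h1, Nat.sub_sub_self h4] at h5
    exact h5.symm
  exact hj (h3 ▸ h2)

lemma exists_pow_mem_K (hγ : Function.Injective γ) (hm : 0 < m) (d : D) :
    ∃ l, 1 ≤ l ∧ (Δ.φ ^ l) d ∈ Δ.K := by
  by_contra! h
  by_cases hd : Δ.fc d = 0
  · obtain ⟨x, hx⟩ : Δ.V.Nonempty := Finset.card_pos.1 (by rw [Δ.V_card]; exact hm)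
    have h1 : ∀ e, Δ.fc e = 0 → e ∉ Δ.K := by
      intro e he
      obtain ⟨j, -, rfl⟩ := Δ.exists_pow (Δ.φ d) e (by rw [Δ.fc_φ, hd, he])
      have := h (j + 1) (by omega)
      rwa [pow_succ, Equiv.Perm.mul_apply] at this
    obtain ⟨j, hj⟩ := Δ.exists_pow_not_mem_V hγ x
    obtain ⟨e₀, he₀, -⟩ := Δ.part _ (by rw [Δ.fc_pow, Δ.V_fc x hx]) hj
    exact h1 e₀ (Δ.brk_fc _ he₀) (Δ.mem_K_of_mem_brk he₀)
  · have h1 : ∀ l i, 1 ≤ i → i < l → (Δ.φ ^ i) d ∉ Δ.K := fun l i hi _ => h i hi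
    have h2 : ∀ j, (Δ.φ⁻¹ ^ j) (Δ.α d) ∉ Δ.K := fun j =>
      Δ.inv_pow_not_mem_K (h1 (j + 2)) j (by omega)
    by_cases hV : Δ.α d ∈ Δ.V
    · obtain ⟨j, hj⟩ := Δ.exists_inv_pow_not_mem_V hγ (Δ.α d)
      exact hj ((Δ.V_inv_pow (l := j + 1) (fun i _ => h2 i) j (by omega)).2 hV)
    · have := Δ.six_mul_lt_size hd hV (Δ.α_φ_pow (h1 (Δ.size d)))
        fun j _ hb => h2 j (Δ.mem_K_of_mem_brk hb)
      omega

/-- Every dart is followed on its face by a dart of `K`. -/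
def Good (Δ : RDiag P γ s m k D) : Prop := ∀ d, ∃ l, 1 ≤ l ∧ (Δ.φ ^ l) d ∈ Δ.K

end RDiag

end Runs

end GSC

namespace GSC

section Runs

variable {S : Type} {P : C6Presentation S} {γ : ℤ → P.Grp} {s : ℤ} {m k : ℕ} {D : Type}
  [Fintype D] [DecidableEq D]

namespace RDiag

variable (Δ : RDiag P γ s m k D)

/-- The distance along the face of a dart to the next dart of `K`. -/
noncomputable def len (d : D) : ℕ := sInf {l | 1 ≤ l ∧ (Δ.φ ^ l) d ∈ Δ.K}

/-- The next dart of `K` along the face of a dart. -/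
noncomputable def nxt (d : D) : D := (Δ.φ ^ Δ.len d) d

/-- The initial dart of the reverse of the run starting with a dart. -/
noncomputable def opp (d : D) : D := Δ.α ((Δ.φ ^ (Δ.len d - 1)) d)

variable {Δ} (hG : Δ.Good)

include hG in
lemma len_pos (d : D) : 1 ≤ Δ.len d := (Nat.sInf_mem (hG d)).1

include hG in
lemma nxt_mem_K (d : D) : Δ.nxt d ∈ Δ.K := (Nat.sInf_mem (hG d)).2

variable (Δ) in
lemma pow_not_mem_K (d : D) : ∀ i, 1 ≤ i → i < Δ.len d → (Δ.φ ^ i) d ∉ Δ.K :=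
  fun _ h1 h2 h3 => Nat.notMem_of_lt_sInf h2 ⟨h1, h3⟩

lemma len_eq {d : D} {l : ℕ} (h1 : 1 ≤ l) (h2 : (Δ.φ ^ l) d ∈ Δ.K)
    (h3 : ∀ i, 1 ≤ i → i < l → (Δ.φ ^ i) d ∉ Δ.K) : Δ.len d = l := by
  have h4 := Nat.sInf_mem (s := {l | 1 ≤ l ∧ (Δ.φ ^ l) d ∈ Δ.K}) ⟨l, h1, h2⟩
  refine le_antisymm (Nat.sInf_le ⟨h1, h2⟩) ?_
  by_contra h
  exact h3 _ h4.1 (by rw [len] at h; omega) h4.2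

include hG

lemma opp_eq (d : D) : Δ.opp d = (Δ.φ⁻¹ ^ (Δ.len d - 1)) (Δ.α d) :=
  Δ.α_φ_pow (Δ.pow_not_mem_K d) _ (by have := len_pos hG d; omega)

lemma pow_opp (d : D) : (Δ.φ ^ (Δ.len d - 1)) (Δ.opp d) = Δ.α d := by
  rw [opp_eq hG, pow_apply_inv_pow _ le_rfl, Nat.sub_self]
  rfl

lemma rot_opp (d : D) : Δ.rot (Δ.opp d) = Δ.nxt d := by
  have h := len_pos hG d
  rw [rot, opp, Δ.α_α, nxt, ← Equiv.Perm.mul_apply, ← pow_succ', Nat.sub_add_cancel h]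

lemma opp_mem_K (d : D) : Δ.opp d ∈ Δ.K := by
  rw [← rot_mem_K, rot_opp hG]
  exact nxt_mem_K hG d

lemma pow_len_opp (d : D) : (Δ.φ ^ Δ.len d) (Δ.opp d) = Δ.rot d := by
  have h := len_pos hG d
  rw [← Nat.sub_add_cancel h, pow_succ', Equiv.Perm.mul_apply, pow_opp hG, rot]

lemma len_opp {d : D} (hd : d ∈ Δ.K) : Δ.len (Δ.opp d) = Δ.len d := by
  refine len_eq (len_pos hG d) ?_ ?_
  · rw [pow_len_opp hG]
    exact Δ.rot_mem_K.2 hd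
  · intro i h1 h2
    rw [opp_eq hG, pow_apply_inv_pow _ (by omega)]
    exact Δ.inv_pow_not_mem_K (Δ.pow_not_mem_K d) _ (by omega)

lemma nxt_opp {d : D} (hd : d ∈ Δ.K) : Δ.nxt (Δ.opp d) = Δ.rot d := by
  rw [nxt, len_opp hG hd, pow_len_opp hG]

lemma opp_opp {d : D} (hd : d ∈ Δ.K) : Δ.opp (Δ.opp d) = d := by
  rw [opp, len_opp hG hd, pow_opp hG, Δ.α_α]

lemma nxt_injOn {d e : D} (hd : d ∈ Δ.K) (he : e ∈ Δ.K) (h : Δ.nxt d = Δ.nxt e) : d = e := by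
  rw [← rot_opp hG, ← rot_opp hG] at h
  rw [← opp_opp hG hd, ← opp_opp hG he, Δ.rot_injective h]

omit hG in
lemma fc_nxt (d : D) : Δ.fc (Δ.nxt d) = Δ.fc d := Δ.fc_pow _ _

omit hG in
lemma fc_α_pow (d : D) {j : ℕ} (hj : j < Δ.len d) :
    Δ.fc (Δ.α ((Δ.φ ^ j) d)) = Δ.fc (Δ.α d) := by
  rw [Δ.α_φ_pow (Δ.pow_not_mem_K d) j hj, Δ.fc_inv_pow]

lemma fc_opp (d : D) : Δ.fc (Δ.opp d) = Δ.fc (Δ.α d) :=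
  fc_α_pow d (by have := len_pos hG d; omega)

omit hG in
lemma pow_mem_V (d : D) {j : ℕ} (hj : j < Δ.len d) : (Δ.φ ^ j) d ∈ Δ.V ↔ d ∈ Δ.V := by
  induction j with
  | zero => rfl
  | succ j ih =>
    rw [← ih (by omega), pow_succ', Equiv.Perm.mul_apply]
    refine Δ.V_brk _ fun h => Δ.pow_not_mem_K d (j + 1) (by omega) hj ?_
    rw [pow_succ', Equiv.Perm.mul_apply]
    exact Δ.mem_K_of_mem_brk h

omit hG in
lemma α_pow_mem_V (d : D) {j : ℕ} (hj : j < Δ.len d) :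
    Δ.α ((Δ.φ ^ j) d) ∈ Δ.V ↔ Δ.α d ∈ Δ.V := by
  rw [Δ.α_φ_pow (Δ.pow_not_mem_K d) j hj]
  exact Δ.V_inv_pow (Δ.inv_pow_not_mem_K (Δ.pow_not_mem_K d)) j hj

lemma opp_mem_V (d : D) : Δ.opp d ∈ Δ.V ↔ Δ.α d ∈ Δ.V :=
  α_pow_mem_V d (by have := len_pos hG d; omega)

lemma α_opp_mem_V (d : D) : Δ.α (Δ.opp d) ∈ Δ.V ↔ d ∈ Δ.V := by
  rw [opp, Δ.α_α]
  exact pow_mem_V d (by have := len_pos hG d; omega)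

omit hG in
variable (Δ) in
lemma pos_rot (d : D) : Δ.pos (Δ.rot d) = Δ.pos d := by
  rw [rot, Δ.pos_φ, ← Δ.pos_α, Δ.α_α]

lemma pos_opp (d : D) : Δ.pos (Δ.opp d) = Δ.pos (Δ.nxt d) := by
  rw [← rot_opp hG, pos_rot]

/-- Every dart lies on the run of a dart of `K`. -/
lemma exists_mem_K (d : D) : ∃ e ∈ Δ.K, ∃ j < Δ.len e, (Δ.φ ^ j) e = d := by
  obtain ⟨l, hl, hlK⟩ : ∃ l, (Δ.φ⁻¹ ^ l) d ∈ Δ.K ∧ ∀ i < l, (Δ.φ⁻¹ ^ i) d ∉ Δ.K := by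
    have h : ∃ l, (Δ.φ⁻¹ ^ l) d ∈ Δ.K := by
      obtain ⟨j, -, hj⟩ := hG d
      have h1 : (Δ.φ ^ (j * Δ.size d)) d = d := by
        rw [mul_comm, pow_mul]
        exact Function.IsFixedPt.perm_pow (Δ.φ_pow_size d) j
      have h4 := Nat.le_mul_of_pos_right j (Δ.size_pos d)
      have h5 := inv_pow_apply_pow Δ.φ (Nat.sub_le (j * Δ.size d) j) d
      rw [h1, Nat.sub_sub_self h4] at h5
      exact ⟨_, h5 ▸ hj⟩
    classical
    exact ⟨Nat.find h, Nat.find_spec h, fun i hi => Nat.find_min h hi⟩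
  have hpow : ∀ i, i ≤ l → (Δ.φ ^ i) ((Δ.φ⁻¹ ^ l) d) = (Δ.φ⁻¹ ^ (l - i)) d :=
    fun i hi => pow_apply_inv_pow _ hi d
  refine ⟨_, hl, l, ?_, by rw [hpow l le_rfl, Nat.sub_self]; rfl⟩
  by_contra h
  have h1 := nxt_mem_K hG ((Δ.φ⁻¹ ^ l) d)
  have h2 := len_pos hG ((Δ.φ⁻¹ ^ l) d)
  rw [nxt, hpow _ (by omega)] at h1
  exact hlK _ (by omega) h1

lemma sum_len_eq (A : Finset D) (hA : ∀ d, Δ.φ d ∉ Δ.K → (Δ.φ d ∈ A ↔ d ∈ A)) :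
    ∑ d ∈ Δ.K with d ∈ A, Δ.len d = A.card := by
  have hA' : ∀ d j, j < Δ.len d → ((Δ.φ ^ j) d ∈ A ↔ d ∈ A) := by
    intro d j hj
    induction j with
    | zero => rfl
    | succ j ih =>
      rw [← ih (by omega), pow_succ', Equiv.Perm.mul_apply]
      refine hA _ ?_
      have := Δ.pow_not_mem_K d (j + 1) (by omega) hj
      rwa [pow_succ', Equiv.Perm.mul_apply] at this
  have h1 : ∑ d ∈ Δ.K with d ∈ A, Δ.len d =
      ((Δ.K.filter (· ∈ A)).sigma fun d => Finset.range (Δ.len d)).card := by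
    simp [Finset.card_sigma]
  rw [h1]
  refine Finset.card_bij (fun x _ => (Δ.φ ^ x.2) x.1) ?_ ?_ ?_
  · rintro ⟨d, j⟩ h
    simp only [Finset.mem_sigma, Finset.mem_filter, Finset.mem_range] at h
    exact (hA' d j h.2).2 h.1.2
  · have key : ∀ d j e i, d ∈ Δ.K → j < Δ.len d → e ∈ Δ.K → i ≤ j →
        (Δ.φ ^ j) d = (Δ.φ ^ i) e → d = e ∧ j = i := by
      intro d j e i hd hj he hi h
      have h2 : e = (Δ.φ ^ (j - i)) d := by
        rw [← inv_pow_apply_pow _ hi, h, inv_pow_apply_pow _ le_rfl, Nat.sub_self]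
        rfl
      have h3 : j - i = 0 := by
        by_contra h3
        exact Δ.pow_not_mem_K d (j - i) (by omega) (by omega) (h2 ▸ he)
      rw [h3] at h2
      exact ⟨h2.symm, by omega⟩
    rintro ⟨d, j⟩ h ⟨e, i⟩ h' heq
    simp only [Finset.mem_sigma, Finset.mem_filter, Finset.mem_range] at h h' heq
    rcases le_total i j with hij | hij
    · obtain ⟨rfl, rfl⟩ := key d j e i h.1.1 h.2 h'.1.1 hij heq
      rfl
    · obtain ⟨rfl, rfl⟩ := key e i d j h'.1.1 h'.2 h.1.1 hij heq.symm
      rfl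
  · intro d hd
    obtain ⟨e, he, j, hj, rfl⟩ := exists_mem_K hG d
    exact ⟨⟨e, j⟩, by
      simp only [Finset.mem_sigma, Finset.mem_filter, Finset.mem_range]
      exact ⟨⟨he, (hA' e j hj).1 hd⟩, hj⟩, rfl⟩

omit hG in
variable (Δ) in
lemma pos_pow (d : D) (j : ℕ) :
    Δ.pos ((Δ.φ ^ j) d) = Δ.pos d * P.elt (orbitWord Δ.φ Δ.lab j d) := by
  induction j with
  | zero => simp [orbitWord, P.elt_nil]
  | succ j ih =>
    rw [orbitWord_succ, P.elt_append, P.elt_singleton, ← mul_assoc, ← ih, pow_succ',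
      Equiv.Perm.mul_apply, Δ.pos_φ]

omit hG in
variable (Δ) in
lemma wordLength_pos_pow_le (d : D) (j : ℕ) :
    wordLength P.gens ((Δ.pos d)⁻¹ * Δ.pos ((Δ.φ ^ j) d)) ≤ j := by
  rw [Δ.pos_pow, inv_mul_cancel_left]
  exact (P.wordLength_elt_le _).trans (by rw [length_orbitWord])

omit hG in
variable (Δ) in
lemma wordLength_pos_nxt_le (d : D) :
    wordLength P.gens ((Δ.pos d)⁻¹ * Δ.pos (Δ.nxt d)) ≤ Δ.len d :=
  Δ.wordLength_pos_pow_le d _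

omit hG in
lemma idx_pow (hγ : Function.Injective γ) {d : D} (hd : d ∈ Δ.V) {j : ℕ} (hj : j < Δ.len d) :
    Δ.idx ((Δ.φ ^ j) d) = Δ.idx d + j := by
  induction j with
  | zero => rfl
  | succ j ih =>
    have h := (pow_mem_V d hj).2 hd
    rw [pow_succ', Equiv.Perm.mul_apply] at h ⊢
    rw [Δ.idx_φ hγ ((pow_mem_V d (by omega)).2 hd) h, ih (by omega), add_assoc]

lemma pos_nxt_of_mem_V (hγ : Function.Injective γ) {d : D} (hd : d ∈ Δ.V) :
    Δ.pos (Δ.nxt d) = γ (s + Δ.idx d + Δ.len d) := by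
  have h := len_pos hG d
  have h1 : Δ.nxt d = Δ.φ ((Δ.φ ^ (Δ.len d - 1)) d) := by
    rw [nxt, ← Equiv.Perm.mul_apply, ← pow_succ', Nat.sub_add_cancel h]
  rw [h1, Δ.V_pos' _ ((pow_mem_V d (by omega)).2 hd), idx_pow hγ hd (by omega)]
  congr 1
  push_cast [h]
  ring

lemma idx_nxt (hγ : Function.Injective γ) {d : D} (hd : d ∈ Δ.V) (h : Δ.nxt d ∈ Δ.V) :
    Δ.idx (Δ.nxt d) = Δ.idx d + Δ.len d := by
  have h1 := pos_nxt_of_mem_V hG hγ hd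
  rw [Δ.V_pos _ h] at h1
  have := hγ h1
  omega

end RDiag

end Runs

end GSC

namespace GSC

section Euler

variable {D : Type} [Fintype D]

lemma card_le_two_mul_finrank_antisymm (α : D → D) (h1 : ∀ d, α (α d) = d) (h2 : ∀ d, α d ≠ d)
    (A : Submodule ℚ (D → ℚ)) (hA : ∀ h, (∀ d, h (α d) = - h d) → h ∈ A) :
    Fintype.card D ≤ 2 * Module.finrank ℚ A := by
  classical
  let f : (D → ℚ) →ₗ[ℚ] (D → ℚ) :=
    { toFun := fun h d => h d - h (α d)
      map_add' := fun x y => by ext d; simp only [Pi.add_apply]; ring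
      map_smul' := fun c x => by ext d; simp [mul_sub] }
  have hf := f.finrank_range_add_finrank_ker
  have hr : Module.finrank ℚ (LinearMap.range f) ≤ Module.finrank ℚ A := by
    refine Submodule.finrank_mono ?_
    rintro _ ⟨x, rfl⟩
    exact hA _ fun d => by simp [f, h1]
  have e := Fintype.equivFin D
  let ε : D → ℚ := fun d => if e d < e (α d) then 1 else -1
  have hε : ∀ d, ε (α d) = - ε d := by
    intro d
    have h3 : e d ≠ e (α d) := fun h => h2 d (e.injective h).symm
    simp only [ε, h1]
    rcases lt_or_gt_of_ne h3 with h | h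
    · simp [h, h.not_gt]
    · simp [h, h.not_gt]
  have hε0 : ∀ d, ε d ≠ 0 := by
    intro d
    simp only [ε]
    split_ifs <;> norm_num
  let g : LinearMap.ker f →ₗ[ℚ] A :=
    { toFun := fun h => ⟨fun d => ε d * h.1 d, hA _ fun d => by
        have := congrFun h.2 d
        simp only [f, LinearMap.coe_mk, AddHom.coe_mk, Pi.zero_apply] at this
        rw [hε, sub_eq_zero.1 this]
        ring⟩
      map_add' := fun x y => by ext d; simp [mul_add]
      map_smul' := fun c x => by ext d; simp [mul_left_comm] }
  have hg : Function.Injective g := by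
    intro x y hxy
    ext d
    have := congrFun (congrArg Subtype.val hxy) d
    exact mul_left_cancel₀ (hε0 d) this
  have hk := LinearMap.finrank_le_finrank_of_injective hg
  rw [Module.finrank_fintype_fun_eq_card] at hf
  omega

/-- The weight of an element under a permutation: at least the inverse of the size of its orbit. -/
noncomputable def orbitWeight [DecidableEq D] (ν : Equiv.Perm D) (d : D) : ℚ :=
  if ν d = d then 1 else if ν (ν d) = d then 1 / 2 else if ν (ν (ν d)) = d then 1 / 3 else 1 / 4

omit [Fintype D] in
lemma one_le_sum_orbitWeight [DecidableEq D] (ν : Equiv.Perm D) (A : Finset D) (d : D)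
    (hd : d ∈ A) (hA : ∀ e ∈ A, ν e ∈ A) : 1 ≤ ∑ e ∈ A, orbitWeight ν e := by
  have h0 : ∀ e, 0 ≤ orbitWeight ν e := by
    intro e
    unfold orbitWeight
    split_ifs <;> norm_num
  have hw : orbitWeight ν (ν d) = orbitWeight ν d := by
    simp [orbitWeight, ν.injective.eq_iff]
  have hw2 : orbitWeight ν (ν (ν d)) = orbitWeight ν d := by
    simp [orbitWeight, ν.injective.eq_iff]
  have hw3 : orbitWeight ν (ν (ν (ν d))) = orbitWeight ν d := by
    simp [orbitWeight, ν.injective.eq_iff]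
  have key : ∀ B : Finset D, (∀ e ∈ B, e = d ∨ e = ν d ∨ e = ν (ν d) ∨ e = ν (ν (ν d))) →
      B.card * orbitWeight ν d ≤ ∑ e ∈ A, orbitWeight ν e := by
    intro B hB
    calc (B.card : ℚ) * orbitWeight ν d = ∑ e ∈ B, orbitWeight ν e := by
          rw [← nsmul_eq_mul, ← Finset.sum_const]
          refine Finset.sum_congr rfl fun e he => ?_
          rcases hB e he with rfl | rfl | rfl | rfl <;> simp [hw, hw2, hw3]
      _ ≤ _ := by
          refine Finset.sum_le_sum_of_subset_of_nonneg ?_ fun _ _ _ => h0 _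
          intro e he
          rcases hB e he with rfl | rfl | rfl | rfl
          · exact hd
          · exact hA _ hd
          · exact hA _ (hA _ hd)
          · exact hA _ (hA _ (hA _ hd))
  by_cases h1 : ν d = d
  · have := key {d} (by simp)
    simpa [orbitWeight, h1] using this
  by_cases h2 : ν (ν d) = d
  · have := key {d, ν d} (by simp)
    rw [Finset.card_pair (Ne.symm h1)] at this
    simpa [orbitWeight, h1, h2] using this
  by_cases h3 : ν (ν (ν d)) = d
  · have := key {d, ν d, ν (ν d)} (by simp)
    rw [Finset.card_eq_three.2 ⟨_, _, _, Ne.symm h1, Ne.symm h2, ?_, rfl⟩] at this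
    · simpa [orbitWeight, h1, h2, h3] using this
    · exact fun h => h1 (ν.injective h.symm)
  · have := key {d, ν d, ν (ν d), ν (ν (ν d))} (by simp)
    rw [Finset.card_insert_of_notMem, Finset.card_eq_three.2 ⟨_, _, _, ?_, ?_, ?_, rfl⟩] at this
    · simpa [orbitWeight, h1, h2, h3] using this
    · exact fun h => h1 (ν.injective h.symm)
    · exact fun h => h2 (ν.injective h.symm)
    · exact fun h => h1 (ν.injective (ν.injective h.symm))
    · simp only [Finset.mem_insert, Finset.mem_singleton, not_or]
      exact ⟨Ne.symm h1, Ne.symm h2, Ne.symm h3⟩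

lemma finrank_le_sum_orbitWeight [DecidableEq D] (ν : Equiv.Perm D) (I : Submodule ℚ (D → ℚ))
    (hI : ∀ σ ∈ I, ∀ d, σ (ν d) = σ d) : (Module.finrank ℚ I : ℚ) ≤ ∑ d, orbitWeight ν d := by
  classical
  let Q := Quotient (Equiv.Perm.SameCycle.setoid ν)
  let p : D → Q := fun d => Quotient.mk (Equiv.Perm.SameCycle.setoid ν) d
  have hp : Function.Surjective p := Quotient.mk_surjective
  have hpν : ∀ d, p (ν d) = p d := fun d =>
    Quotient.sound (s := Equiv.Perm.SameCycle.setoid ν)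
      (Equiv.Perm.SameCycle.symm ⟨1, by simp⟩)
  have hpow : ∀ σ ∈ I, ∀ (i : ℕ) d, σ ((ν ^ i) d) = σ d := by
    intro σ hσ i d
    induction i with
    | zero => rfl
    | succ i ih => rw [pow_succ', Equiv.Perm.mul_apply, hI σ hσ, ih]
  let f : I →ₗ[ℚ] (Q → ℚ) :=
    { toFun := fun σ q => σ.1 (Function.surjInv hp q)
      map_add' := fun x y => rfl
      map_smul' := fun c x => rfl }
  have hf : Function.Injective f := by
    intro x y hxy
    ext d
    have h1 := congrFun hxy (p d)
    have h2 : ν.SameCycle (Function.surjInv hp (p d)) d :=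
      Quotient.exact (s := Equiv.Perm.SameCycle.setoid ν) (Function.surjInv_eq hp (p d))
    obtain ⟨i, -, hi⟩ := h2.exists_pow_eq'
    rw [← hi, hpow _ x.2, hpow _ y.2]
    exact h1
  have h1 := LinearMap.finrank_le_finrank_of_injective hf
  rw [Module.finrank_fintype_fun_eq_card] at h1
  calc (Module.finrank ℚ I : ℚ) ≤ (Fintype.card Q : ℚ) := by exact_mod_cast h1
    _ = ∑ q : Q, (1 : ℚ) := by simp
    _ ≤ ∑ q : Q, ∑ d with p d = q, orbitWeight ν d := by
        refine Finset.sum_le_sum fun q _ => ?_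
        refine one_le_sum_orbitWeight ν _ (Function.surjInv hp q) ?_ ?_
        · simp [Function.surjInv_eq hp q]
        · intro e he
          simpa [hpν] using he
    _ = ∑ d, orbitWeight ν d := Finset.sum_fiberwise _ _ _

end Euler

section Runs

variable {S : Type} {P : C6Presentation S} {γ : ℤ → P.Grp} {s : ℤ} {m k : ℕ} {D : Type}
  [Fintype D] [DecidableEq D]

namespace RDiag

variable (Δ : RDiag P γ s m k D)

lemma α_ne (d : D) : Δ.α d ≠ d := fun h => invL_ne (Δ.lab d) (by rw [← Δ.lab_α, h])

lemma rot_ne {d : D} (hd : d ∉ Δ.Brk) : Δ.rot d ≠ d := by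
  intro h
  have h1 := Δ.red (Δ.α d) (by rw [← rot, h]; exact hd)
  rw [← rot, h, Δ.lab_α, invL_invL] at h1
  exact h1 rfl

/-- The darts whose initial vertex has degree at least four. -/
def deg4 : Finset D := Finset.univ.filter fun d =>
  Δ.rot d ≠ d ∧ Δ.rot (Δ.rot d) ≠ d ∧ Δ.rot (Δ.rot (Δ.rot d)) ≠ d

lemma card_add_one_le_finrank [Nonempty D] :
    ∃ I : Submodule ℚ (D → ℚ), (∀ σ ∈ I, ∀ d, σ (Δ.rot d) = σ d) ∧
      Fintype.card D + 2 ≤ 2 * (Module.finrank ℚ I + Δ.n) := by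
  let A : Submodule ℚ (D → ℚ) :=
    { carrier := {h | ∀ d, h (Δ.α d) = - h d}
      add_mem' := fun {x y} hx hy d => by simp [hx d, hy d]; ring
      zero_mem' := fun d => by simp
      smul_mem' := fun c x hx d => by simp [hx d] }
  let I : Submodule ℚ (D → ℚ) :=
    { carrier := {σ | ∀ d, σ (Δ.rot d) = σ d}
      add_mem' := fun {x y} hx hy d => by simp [hx d, hy d]
      zero_mem' := fun d => by simp
      smul_mem' := fun c x hx d => by simp [hx d] }
  refine ⟨I, fun σ hσ => hσ, ?_⟩
  have h1 := card_le_two_mul_finrank_antisymm Δ.α Δ.α_α Δ.α_ne A fun h hh => hh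
  let f : A →ₗ[ℚ] (Fin Δ.n → ℚ) :=
    { toFun := fun h i => ∑ e with Δ.fc e = i + 1, h.1 e
      map_add' := fun x y => by ext i; simp [Finset.sum_add_distrib]
      map_smul' := fun c x => by ext i; simp [Finset.mul_sum] }
  have h2 := f.finrank_range_add_finrank_ker
  have h3 : Module.finrank ℚ (LinearMap.range f) ≤ Δ.n :=
    (Submodule.finrank_le _).trans (by simp)
  let δ : I →ₗ[ℚ] (D → ℚ) :=
    { toFun := fun σ d => σ.1 (Δ.α d) - σ.1 d
      map_add' := fun x y => by ext i; simp only [Submodule.coe_add, Pi.add_apply]; ring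
      map_smul' := fun c x => by ext i; simp [mul_sub] }
  have h4 := δ.finrank_range_add_finrank_ker
  have h5 : 1 ≤ Module.finrank ℚ (LinearMap.ker δ) := by
    rw [Nat.one_le_iff_ne_zero, Ne, Submodule.finrank_eq_zero]
    intro h
    have h6 : (⟨fun _ => 1, fun _ => rfl⟩ : I) ∈ LinearMap.ker δ := by
      ext d
      simp [δ]
    rw [h, Submodule.mem_bot] at h6
    have h7 := congrFun (congrArg Subtype.val h6) (Classical.arbitrary D)
    simp at h7
  have h6 : Module.finrank ℚ (LinearMap.ker f) ≤ Module.finrank ℚ (LinearMap.range δ) := by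
    rw [← Submodule.finrank_map_subtype_eq A (LinearMap.ker f)]
    refine Submodule.finrank_mono ?_
    rintro _ ⟨⟨h, hA⟩, hk, rfl⟩
    obtain ⟨σ, hσ⟩ := Δ.sc h hA fun i hi hin => by
      have := congrFun hk ⟨i - 1, by omega⟩
      simp only [f, LinearMap.coe_mk, AddHom.coe_mk, Pi.zero_apply] at this
      rwa [Nat.sub_add_cancel hi] at this
    refine ⟨⟨σ, fun d => ?_⟩, ?_⟩
    · rw [rot, (hσ _).2, (hσ d).1, hA d]
      ring
    · ext d
      simp [δ, (hσ d).1]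
  omega

lemma euler [Nonempty D] :
    2 * Δ.K.card + Δ.deg4.card + 12 ≤ 12 * Δ.n + 10 * Δ.Brk.card := by
  let ν : Equiv.Perm D := Δ.φ * Δ.α
  have hν : ∀ d, ν d = Δ.rot d := fun d => rfl
  obtain ⟨I, hI, h1⟩ := Δ.card_add_one_le_finrank
  have h2 := finrank_le_sum_orbitWeight ν I hI
  have hloc : ∀ d, (if d ∈ Δ.K then (1 / 6 : ℚ) else 0) + (if d ∈ Δ.deg4 then 1 / 12 else 0) -
      (if d ∈ Δ.Brk then 2 / 3 else 0) - (if ν d ∈ Δ.Brk then 1 / 6 else 0) ≤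
      1 / 2 - orbitWeight ν d := by
    intro d
    simp only [orbitWeight, hν]
    by_cases c1 : Δ.rot d = d
    · have hb : d ∈ Δ.Brk := by_contra fun h => Δ.rot_ne h c1
      have h4 : d ∉ Δ.deg4 := by simp [deg4, c1]
      simp only [c1, hb, h4, Δ.mem_K_of_mem_brk hb, if_true, if_false]
      norm_num
    have hK : d ∉ Δ.K ↔ _ := Δ.not_mem_K
    by_cases c2 : Δ.rot (Δ.rot d) = d
    · have h4 : d ∉ Δ.deg4 := by simp [deg4, c2]
      simp only [c1, c2, ne_eq, not_false_eq_true, true_and] at hK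
      simp only [c1, c2, h4, if_true, if_false]
      by_cases hb : d ∈ Δ.Brk <;> by_cases hb' : Δ.rot d ∈ Δ.Brk <;>
        by_cases hk : d ∈ Δ.K <;> simp [hb, hb', hk] at hK ⊢ <;> norm_num
    by_cases c3 : Δ.rot (Δ.rot (Δ.rot d)) = d
    · have h4 : d ∉ Δ.deg4 := by simp [deg4, c3]
      simp only [c1, c2, c3, h4, if_true, if_false]
      split_ifs <;> norm_num
    · simp only [c1, c2, c3, if_false]
      split_ifs <;> norm_num
  have h3 := Finset.sum_le_sum fun d (_ : d ∈ Finset.univ) => hloc d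
  have hb : (Finset.univ.filter fun d => ν d ∈ Δ.Brk).card = Δ.Brk.card := by
    rw [← Finset.card_map ν.toEmbedding]
    congr 1
    ext d
    simp only [Finset.mem_map, Finset.mem_filter, Finset.mem_univ, true_and, Equiv.coe_toEmbedding]
    exact ⟨fun ⟨e, he, h⟩ => h ▸ he, fun h => ⟨ν.symm d, by simpa using h, by simp⟩⟩
  simp only [Finset.sum_sub_distrib, Finset.sum_add_distrib, ← Finset.sum_filter,
    Finset.sum_const, Finset.filter_mem_eq_inter, Finset.univ_inter, nsmul_eq_mul,
    Finset.card_univ, hb] at h3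
  have h4 : (Fintype.card D : ℚ) + 2 ≤ 2 * (Module.finrank ℚ I + Δ.n) := by exact_mod_cast h1
  have h5 : 2 * (Δ.K.card : ℚ) + Δ.deg4.card + 12 ≤ 12 * Δ.n + 10 * Δ.Brk.card := by linarith
  exact_mod_cast h5

end RDiag

end Runs

end GSC

namespace GSC

/-- The word metric with respect to the generators, with values in `ℕ`. -/
noncomputable def C6Presentation.nd {S : Type} (P : C6Presentation S) (x y : P.Grp) : ℕ :=
  wordLength P.gens (x⁻¹ * y)

lemma C6Presentation.nd_comm {S : Type} (P : C6Presentation S) (x y : P.Grp) :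
    P.nd x y = P.nd y x := by
  rw [nd, nd, ← wordLength_inv P.closure_gens, mul_inv_rev, inv_inv]

lemma C6Presentation.nd_triangle {S : Type} (P : C6Presentation S) (x y z : P.Grp) :
    P.nd x z ≤ P.nd x y + P.nd y z := by
  have := wordLength_mul_le P.closure_gens (x⁻¹ * y) (y⁻¹ * z)
  rwa [mul_assoc, mul_inv_cancel_left] at this

section Runs

variable {S : Type} {P : C6Presentation S} {γ : ℤ → P.Grp} {s : ℤ} {m k : ℕ} {D : Type}
  [Fintype D] [DecidableEq D]

lemma injective_of_nd (hγ : ∀ a b : ℤ, P.nd (γ a) (γ b) = (b - a).natAbs) :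
    Function.Injective γ := by
  intro a b h
  have h1 := hγ a a
  have h2 := hγ a b
  rw [← h, h1] at h2
  simp only [sub_self, Int.natAbs_zero] at h2
  omega

namespace RDiag

variable (Δ : RDiag P γ s m k D)

lemma nd_pos_pow_le (d : D) (j : ℕ) : P.nd (Δ.pos d) (Δ.pos ((Δ.φ ^ j) d)) ≤ j :=
  Δ.wordLength_pos_pow_le d j

/-- Two darts of a face are at distance at most half the size of the face. -/
lemma two_mul_nd_pos_le {d e : D} (h : Δ.fc d = Δ.fc e) :
    2 * P.nd (Δ.pos d) (Δ.pos e) ≤ Δ.size d := by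
  obtain ⟨j, hj, rfl⟩ := Δ.exists_pow d e h
  change j < Δ.size d at hj
  have h1 := Δ.nd_pos_pow_le d j
  have h2 := Δ.nd_pos_pow_le ((Δ.φ ^ j) d) (Δ.size d - j)
  rw [← Equiv.Perm.mul_apply, ← pow_add, Nat.sub_add_cancel hj.le, Δ.φ_pow_size, P.nd_comm] at h2
  omega

lemma pos_mem_relatorCycle {d e : D} (h : Δ.fc d = Δ.fc e) :
    Δ.pos e ∈ relatorCycle P (Δ.pos d) (Δ.word d) := by
  obtain ⟨j, hj, rfl⟩ := Δ.exists_pow d e h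
  exact ⟨_, orbitWord_isPrefix Δ.φ Δ.lab hj.le d, Δ.pos_pow d j⟩

variable {Δ}

/-- The part of the boundary of an inner face on the geodesic is short. -/
lemma card_α_mem_V_le (hγ : ∀ a b : ℤ, P.nd (γ a) (γ b) = (b - a).natAbs) {C : ℕ}
    (hC : ∀ h, ∀ r ∈ P.rels, ∀ a b : ℤ, γ a ∈ relatorCycle P h r → γ b ∈ relatorCycle P h r →
      b - a ≤ C) {y : D} (hy : Δ.fc y ≠ 0) :
    2 * (Finset.univ.filter fun d => Δ.fc d = Δ.fc y ∧ Δ.α d ∈ Δ.V).card ≤ Δ.size y ∧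
      (Finset.univ.filter fun d => Δ.fc d = Δ.fc y ∧ Δ.α d ∈ Δ.V).card ≤ C := by
  set A := Finset.univ.filter fun d => Δ.fc d = Δ.fc y ∧ Δ.α d ∈ Δ.V with hA
  have hmem : ∀ d ∈ A, Δ.fc d = Δ.fc y ∧ Δ.α d ∈ Δ.V := fun d hd => by simpa [hA] using hd
  rcases A.eq_empty_or_nonempty with h | h
  · simp [h]
  obtain ⟨a, ha, hmin⟩ := A.exists_min_image (fun d => Δ.idx (Δ.α d)) h
  obtain ⟨b, hb, hmax⟩ := A.exists_max_image (fun d => Δ.idx (Δ.α d)) h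
  have hcard : A.card ≤ Δ.idx (Δ.α b) + 1 - Δ.idx (Δ.α a) := by
    rw [← Nat.card_Icc]
    refine Finset.card_le_card_of_injOn (fun d => Δ.idx (Δ.α d)) ?_ ?_
    · intro d hd
      simpa using ⟨hmin d hd, hmax d hd⟩
    · intro d hd e he hde
      exact Δ.α.injective (Δ.V_inj _ (hmem d hd).2 _ (hmem e he).2 hde)
  have h1 : Δ.pos (Δ.φ a) = γ (s + Δ.idx (Δ.α a)) := by
    rw [Δ.pos_φ, ← Δ.pos_α, Δ.V_pos _ (hmem a ha).2]
  have h2 : Δ.pos b = γ (s + Δ.idx (Δ.α b) + 1) := by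
    rw [← Δ.V_pos' _ (hmem b hb).2, Δ.pos_φ, ← Δ.pos_α, Δ.α_α]
  have h3 : Δ.fc (Δ.φ a) = Δ.fc b := by rw [Δ.fc_φ, (hmem a ha).1, (hmem b hb).1]
  have h4 := Δ.two_mul_nd_pos_le h3
  rw [h1, h2, hγ, Δ.size_congr (d := Δ.φ a) (e := y) (by rw [Δ.fc_φ, (hmem a ha).1])] at h4
  have h5 := hmin b hb
  have h6 : Δ.pos (Δ.φ a) ∈ relatorCycle P (Δ.pos y) (Δ.word y) :=
    Δ.pos_mem_relatorCycle (by rw [Δ.fc_φ, (hmem a ha).1])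
  have h7 : Δ.pos b ∈ relatorCycle P (Δ.pos y) (Δ.word y) :=
    Δ.pos_mem_relatorCycle (hmem b hb).1.symm
  rw [h1] at h6
  rw [h2] at h7
  have h8 := hC _ _ (Δ.word_mem hy) _ _ h6 h7
  constructor <;> omega

variable (hG : Δ.Good)

include hG

lemma sum_len_α_mem_V (i : ℕ) :
    ∑ d ∈ Δ.K with Δ.fc d = i ∧ Δ.α d ∈ Δ.V, Δ.len d =
      (Finset.univ.filter fun d => Δ.fc d = i ∧ Δ.α d ∈ Δ.V).card := by
  rw [← sum_len_eq hG]
  · simp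
  · intro d hd
    have h1 := Δ.α_φ hd
    have h2 := Δ.V_brk (Δ.α (Δ.φ d))
    rw [← rot] at h2
    have h3 := h2 fun h => Δ.rot_not_mem_K hd (Δ.mem_K_of_mem_brk h)
    rw [rot, h1] at h3
    simp [Δ.fc_φ, h3]

lemma sum_len_face (y : D) : ∑ d ∈ Δ.K with Δ.fc d = Δ.fc y, Δ.len d = Δ.size y := by
  rw [size, ← sum_len_eq hG]
  · simp
  · simp [Δ.fc_φ]

omit hG in
lemma six_mul_len_lt {d : D} (hd : Δ.fc d ≠ 0) (hV : Δ.α d ∉ Δ.V) :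
    6 * Δ.len d < Δ.size d :=
  Δ.six_mul_lt_size hd hV (Δ.α_φ_pow (Δ.pow_not_mem_K d))
    fun j hj hb => Δ.inv_pow_not_mem_K (Δ.pow_not_mem_K d) j hj (Δ.mem_K_of_mem_brk hb)

lemma len_le_card_α_mem_V {d : D} (hd : d ∈ Δ.K) (hV : Δ.α d ∈ Δ.V) :
    Δ.len d ≤ (Finset.univ.filter fun e => Δ.fc e = Δ.fc d ∧ Δ.α e ∈ Δ.V).card := by
  rw [← sum_len_α_mem_V hG]
  exact Finset.single_le_sum (f := Δ.len) (fun _ _ => Nat.zero_le _) (by simp [hd, hV])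

end RDiag

end Runs

end GSC

namespace GSC

section Runs

variable {S : Type} {P : C6Presentation S} {γ : ℤ → P.Grp} {s : ℤ} {m k : ℕ} {D : Type}
  [Fintype D] [DecidableEq D]

namespace RDiag

variable (Δ : RDiag P γ s m k D)

/-- The number of runs of a face on the geodesic. -/
def eRuns (i : ℕ) : ℕ := (Δ.K.filter fun d => Δ.fc d = i ∧ Δ.α d ∈ Δ.V).card

/-- The number of runs of a face which are not on the geodesic. -/
def oRuns (i : ℕ) : ℕ := (Δ.K.filter fun d => Δ.fc d = i ∧ Δ.α d ∉ Δ.V).card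

/-- The darts of `K` on the geodesic which are adjacent to an irregular configuration. -/
noncomputable def bad : Finset D := (Δ.K.filter (· ∈ Δ.V)).filter fun x =>
  Δ.fc (Δ.opp x) = 0 ∨ 7 ≤ Δ.oRuns (Δ.fc (Δ.opp x)) + 2 * Δ.eRuns (Δ.fc (Δ.opp x)) ∨
    x ∈ Δ.deg4 ∨ x ∈ Δ.Brk ∨ Δ.rot x ∈ Δ.Brk

variable {Δ} (hG : Δ.Good) (hγ : ∀ a b : ℤ, P.nd (γ a) (γ b) = (b - a).natAbs) {C : ℕ}
    (hC : ∀ h, ∀ r ∈ P.rels, ∀ a b : ℤ, γ a ∈ relatorCycle P h r → γ b ∈ relatorCycle P h r →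
      b - a ≤ C)

include hG hγ hC

lemma runs_face {i : ℕ} (hi : 1 ≤ i) (hn : i ≤ Δ.n) :
    6 ≤ Δ.oRuns i + 2 * Δ.eRuns i ∧
      (Δ.oRuns i + 2 * Δ.eRuns i = 6 → Δ.oRuns i = 4 ∧ Δ.eRuns i = 1) ∧
      (7 ≤ Δ.oRuns i + 2 * Δ.eRuns i →
        2 * Δ.eRuns i ≤ 3 * (Δ.oRuns i + 2 * Δ.eRuns i - 6)) := by
  obtain ⟨y, rfl⟩ := Δ.fc_surj i hi hn
  have hy : Δ.fc y ≠ 0 := by omega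
  have h1 := (card_α_mem_V_le hγ hC hy).1
  have h2 := sum_len_α_mem_V hG (Δ.fc y)
  have h3 := sum_len_face hG y
  have h4 := Finset.sum_filter_add_sum_filter_not (Δ.K.filter fun d => Δ.fc d = Δ.fc y)
    (fun d => Δ.α d ∈ Δ.V) Δ.len
  rw [Finset.filter_filter, Finset.filter_filter, h2, h3] at h4
  have h5 : ∑ d ∈ Δ.K with Δ.fc d = Δ.fc y ∧ Δ.α d ∉ Δ.V, (6 * Δ.len d + 1) ≤
      ∑ d ∈ Δ.K with Δ.fc d = Δ.fc y ∧ Δ.α d ∉ Δ.V, Δ.size y := by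
    refine Finset.sum_le_sum fun d hd => ?_
    simp only [Finset.mem_filter] at hd
    have := six_mul_len_lt (Δ := Δ) (d := d) (by omega) hd.2.2
    rw [Δ.size_congr hd.2.1] at this
    omega
  rw [Finset.sum_add_distrib, ← Finset.mul_sum, Finset.sum_const, Finset.sum_const, smul_eq_mul,
    smul_eq_mul, mul_one] at h5
  change _ + Δ.oRuns (Δ.fc y) ≤ Δ.oRuns (Δ.fc y) * _ at h5
  have hN := Δ.size_pos y
  set a := (Finset.univ.filter fun d => Δ.fc d = Δ.fc y ∧ Δ.α d ∈ Δ.V).card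
  set N := Δ.size y
  have h6 : Δ.eRuns (Δ.fc y) = 0 → a = 0 := by
    intro h
    rw [eRuns, Finset.card_eq_zero] at h
    rw [← h2, h, Finset.sum_empty]
  set o := Δ.oRuns (Δ.fc y)
  set e := Δ.eRuns (Δ.fc y)
  have h7 : 6 * N ≤ o * N - o + 6 * a := by omega
  have h8 : o ≤ 3 → False := by
    intro h
    interval_cases o <;> omega
  have h9 : e = 0 → o ≤ 6 → False := by
    intro he h
    have := h6 he
    interval_cases o <;> omega
  refine ⟨?_, ?_, ?_⟩
  · by_contra h
    by_cases he : e = 0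
    · exact h9 he (by omega)
    · exact h8 (by omega)
  · intro h
    by_cases he : e = 0
    · exact (h9 he (by omega)).elim
    · have : ¬ o ≤ 3 := h8
      omega
  · intro h
    by_cases he : e = 0
    · omega
    · have : ¬ o ≤ 3 := h8
      omega

lemma card_bad_le [Nonempty D] : Δ.bad.card ≤ 12 * (k + 1) := by
  have heuler := Δ.euler
  set I := Finset.Icc 1 Δ.n with hI
  have hfib : ∀ (p : D → Prop) [DecidablePred p],
      ∑ i ∈ I, (Δ.K.filter fun d => Δ.fc d = i ∧ p d).card =
      (Δ.K.filter fun d => Δ.fc d ≠ 0 ∧ p d).card := by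
    intro p _
    have := Finset.card_eq_sum_card_fiberwise (s := Δ.K.filter fun d => Δ.fc d ≠ 0 ∧ p d) (t := I)
      (f := Δ.fc) fun d hd => by
        simp only [Finset.coe_filter, Set.mem_ofPred_eq] at hd
        have := Δ.fc_le d
        simp only [hI, Finset.coe_Icc, Set.mem_Icc]
        omega
    rw [this]
    refine Finset.sum_congr rfl fun i hi => ?_
    congr 1
    ext d
    simp only [hI, Finset.mem_Icc] at hi
    simp only [Finset.mem_filter]
    constructor
    · rintro ⟨h1, h2, h3⟩
      exact ⟨⟨h1, by omega, h3⟩, h2⟩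
    · rintro ⟨⟨h1, h2, h3⟩, h4⟩
      exact ⟨h1, h4, h3⟩
  have hE : ∑ i ∈ I, Δ.eRuns i = _ := hfib fun d => Δ.α d ∈ Δ.V
  have hO : ∑ i ∈ I, Δ.oRuns i = _ := hfib fun d => Δ.α d ∉ Δ.V
  have hopp : ∀ (p : D → Prop) [DecidablePred p],
      ((Δ.K.filter (· ∈ Δ.V)).filter fun x => p (Δ.opp x)).card =
        (Δ.K.filter fun d => p d ∧ Δ.α d ∈ Δ.V).card := by
    intro p _
    refine Finset.card_bij (fun x _ => Δ.opp x) ?_ ?_ ?_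
    · intro x hx
      simp only [Finset.mem_filter] at hx ⊢
      exact ⟨opp_mem_K hG x, hx.2, (α_opp_mem_V hG x).2 hx.1.2⟩
    · intro x hx y hy h
      simp only [Finset.mem_filter] at hx hy
      rw [← opp_opp hG hx.1.1, h, opp_opp hG hy.1.1]
    · intro y hy
      simp only [Finset.mem_filter] at hy
      refine ⟨Δ.opp y, ?_, opp_opp hG hy.1⟩
      simp only [Finset.mem_filter, opp_opp hG hy.1]
      exact ⟨⟨opp_mem_K hG y, (opp_mem_V hG y).2 hy.2.2⟩, hy.2.1⟩
  have h1 := hopp fun d => Δ.fc d = 0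
  have h2 := hopp fun d => Δ.fc d ≠ 0
  have h3 := Finset.card_filter_add_card_filter_not (s := Δ.K.filter (· ∈ Δ.V))
    (fun x => Δ.fc (Δ.opp x) = 0)
  have h4 := Finset.card_filter_add_card_filter_not (s := Δ.K.filter fun d => Δ.fc d ≠ 0)
    (fun d => Δ.α d ∈ Δ.V)
  rw [Finset.filter_filter, Finset.filter_filter] at h4
  have h5 : (Δ.K.filter fun d => Δ.fc d ≠ 0).card + (Δ.K.filter (· ∈ Δ.V)).card ≤ Δ.K.card := by
    rw [← Finset.card_union_of_disjoint]
    · exact Finset.card_le_card (Finset.union_subset (Finset.filter_subset _ _)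
        (Finset.filter_subset _ _))
    · rw [Finset.disjoint_filter]
      exact fun d _ h h' => h (Δ.V_fc d h')
  have hκ : ∀ i ∈ I, 6 ≤ Δ.oRuns i + 2 * Δ.eRuns i := fun i hi =>
    (runs_face hG hγ hC (Finset.mem_Icc.1 hi).1 (Finset.mem_Icc.1 hi).2).1
  have h6 : ∑ i ∈ I, (Δ.oRuns i + 2 * Δ.eRuns i - 6) + 6 * Δ.n =
      ∑ i ∈ I, Δ.oRuns i + 2 * ∑ i ∈ I, Δ.eRuns i := by
    have h7 : 6 * Δ.n = ∑ i ∈ I, 6 := by simp [hI, mul_comm]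
    rw [h7, ← Finset.sum_add_distrib, Finset.mul_sum, ← Finset.sum_add_distrib]
    exact Finset.sum_congr rfl fun i hi => Nat.sub_add_cancel (hκ i hi)
  have h7 : 2 * ∑ i ∈ I with 7 ≤ Δ.oRuns i + 2 * Δ.eRuns i, Δ.eRuns i ≤
      3 * ∑ i ∈ I, (Δ.oRuns i + 2 * Δ.eRuns i - 6) := by
    rw [Finset.mul_sum, Finset.mul_sum]
    refine (Finset.sum_le_sum fun i hi => ?_).trans
      (Finset.sum_le_sum_of_subset (Finset.filter_subset _ _))
    simp only [Finset.mem_filter, hI, Finset.mem_Icc] at hi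
    exact (runs_face hG hγ hC hi.1.1 hi.1.2).2.2 hi.2
  have h8 := hopp fun d => Δ.fc d ≠ 0 ∧ 7 ≤ Δ.oRuns (Δ.fc d) + 2 * Δ.eRuns (Δ.fc d)
  have h9 : (Δ.K.filter fun d => (Δ.fc d ≠ 0 ∧ 7 ≤ Δ.oRuns (Δ.fc d) + 2 * Δ.eRuns (Δ.fc d)) ∧
      Δ.α d ∈ Δ.V).card = ∑ i ∈ I with 7 ≤ Δ.oRuns i + 2 * Δ.eRuns i, Δ.eRuns i := by
    rw [Finset.card_eq_sum_card_fiberwise (f := Δ.fc)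
      (t := I.filter fun i => 7 ≤ Δ.oRuns i + 2 * Δ.eRuns i)]
    · refine Finset.sum_congr rfl fun i hi => ?_
      rw [eRuns]
      congr 1
      ext d
      simp only [Finset.mem_filter, hI, Finset.mem_Icc] at hi ⊢
      constructor
      · rintro ⟨⟨a, b, c⟩, d⟩
        exact ⟨a, d, c⟩
      · rintro ⟨a, rfl, c⟩
        exact ⟨⟨a, ⟨by omega, hi.2⟩, c⟩, rfl⟩
    · intro d hd
      simp only [Finset.coe_filter, Set.mem_ofPred_eq, hI, Finset.mem_Icc] at hd ⊢
      have := Δ.fc_le d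
      omega
  have hrotB : (Finset.univ.filter fun d => Δ.rot d ∈ Δ.Brk).card ≤ Δ.Brk.card :=
    Finset.card_le_card_of_injOn Δ.rot (fun d hd => by simpa using hd) Δ.rot_injective.injOn
  have hbad : Δ.bad ⊆ ((Δ.K.filter (· ∈ Δ.V)).filter fun x => Δ.fc (Δ.opp x) = 0) ∪
      (((Δ.K.filter (· ∈ Δ.V)).filter fun x => Δ.fc (Δ.opp x) ≠ 0 ∧
        7 ≤ Δ.oRuns (Δ.fc (Δ.opp x)) + 2 * Δ.eRuns (Δ.fc (Δ.opp x))) ∪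
      (Δ.deg4 ∪ (Δ.Brk ∪ Finset.univ.filter fun d => Δ.rot d ∈ Δ.Brk))) := by
    intro x hx
    simp only [bad, Finset.mem_filter, Finset.mem_union, Finset.mem_univ, true_and] at hx ⊢
    tauto
  have h10 := Finset.card_le_card hbad
  have h11 := (h10.trans (Finset.card_union_le _ _)).trans (Nat.add_le_add_left
    ((Finset.card_union_le _ _).trans (Nat.add_le_add_left ((Finset.card_union_le _ _).trans
      (Nat.add_le_add_left (Finset.card_union_le _ _) _)) _)) _)
  have hB := Δ.brk_card
  simp only [ne_eq] at *
  omega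

end RDiag

end Runs

end GSC

namespace GSC

section Runs

variable {S : Type} {P : C6Presentation S} {γ : ℤ → P.Grp} {s : ℤ} {m k : ℕ} {D : Type}
  [Fintype D] [DecidableEq D]

namespace RDiag

variable {Δ : RDiag P γ s m k D} (hG : Δ.Good)

include hG

lemma iterate_nxt_mem_K {d : D} (hd : d ∈ Δ.K) (t : ℕ) : Δ.nxt^[t] d ∈ Δ.K := by
  cases t with
  | zero => exact hd
  | succ t =>
    rw [Function.iterate_succ_apply']
    exact nxt_mem_K hG _

omit hG in
lemma fc_iterate_nxt (d : D) (t : ℕ) : Δ.fc (Δ.nxt^[t] d) = Δ.fc d := by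
  induction t with
  | zero => rfl
  | succ t ih => rw [Function.iterate_succ_apply', fc_nxt, ih]

lemma exists_iterate_nxt_eq (j : ℕ) : ∀ d : D, (Δ.φ ^ j) d ∈ Δ.K →
    d ∈ Δ.K → ∃ t, Δ.nxt^[t] d = (Δ.φ ^ j) d := by
  induction j using Nat.strong_induction_on with
  | _ j ih =>
    intro d h hd
    rcases Nat.eq_zero_or_pos j with rfl | hj
    · exact ⟨0, rfl⟩
    have h1 : Δ.len d ≤ j := by
      by_contra h1
      exact Δ.pow_not_mem_K d j hj (by omega) h
    have h2 : (Δ.φ ^ (j - Δ.len d)) (Δ.nxt d) = (Δ.φ ^ j) d := by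
      rw [nxt, ← Equiv.Perm.mul_apply, ← pow_add, Nat.sub_add_cancel h1]
    have h3 := len_pos hG d
    obtain ⟨t, ht⟩ := ih (j - Δ.len d) (by omega) (Δ.nxt d) (h2 ▸ h) (nxt_mem_K hG d)
    exact ⟨t + 1, by rw [Function.iterate_succ_apply, ht, h2]⟩

lemma iterate_nxt_injOn (t : ℕ) : Set.InjOn (Δ.nxt^[t]) (Δ.K : Set D) := by
  induction t with
  | zero => exact Function.injective_id.injOn
  | succ t ih =>
    intro d hd e he h
    rw [Function.iterate_succ_apply', Function.iterate_succ_apply'] at h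
    exact ih hd he (nxt_injOn hG (iterate_nxt_mem_K hG hd t) (iterate_nxt_mem_K hG he t) h)

/-- The darts of `K` on a face form one cycle of `nxt`. -/
lemma face_eq_image {d : D} (hd : d ∈ Δ.K) :
    (Δ.K.filter fun e => Δ.fc e = Δ.fc d) =
        (Finset.range (Δ.K.filter fun e => Δ.fc e = Δ.fc d).card).image (fun t => Δ.nxt^[t] d) ∧
      Δ.nxt^[(Δ.K.filter fun e => Δ.fc e = Δ.fc d).card] d = d ∧
      Set.InjOn (fun t => Δ.nxt^[t] d) (Set.Iio (Δ.K.filter fun e => Δ.fc e = Δ.fc d).card) := by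
  have hper : d ∈ Function.periodicPts Δ.nxt := by
    obtain ⟨j, -, hj⟩ := Δ.exists_pow (Δ.nxt d) d (fc_nxt d)
    obtain ⟨t, ht⟩ := exists_iterate_nxt_eq hG j (Δ.nxt d) (by rwa [hj]) (nxt_mem_K hG d)
    rw [hj] at ht
    exact ⟨t + 1, by omega, ht⟩
  have hp := Function.minimalPeriod_pos_of_mem_periodicPts hper
  have hinj := Function.iterate_injOn_Iio_minimalPeriod (f := Δ.nxt) (x := d)
  have h1 : (Δ.K.filter fun e => Δ.fc e = Δ.fc d) =
      (Finset.range (Function.minimalPeriod Δ.nxt d)).image (fun t => Δ.nxt^[t] d) := by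
    ext e
    simp only [Finset.mem_filter, Finset.mem_image, Finset.mem_range]
    constructor
    · rintro ⟨he, hf⟩
      obtain ⟨j, -, hj⟩ := Δ.exists_pow d e hf.symm
      obtain ⟨t, ht⟩ := exists_iterate_nxt_eq hG j d (hj ▸ he) hd
      exact ⟨t % Function.minimalPeriod Δ.nxt d, Nat.mod_lt _ hp, by
        rw [Function.iterate_mod_minimalPeriod_eq, ht, hj]⟩
    · rintro ⟨t, -, rfl⟩
      exact ⟨iterate_nxt_mem_K hG hd t, fc_iterate_nxt d t⟩
  have h2 : (Δ.K.filter fun e => Δ.fc e = Δ.fc d).card = Function.minimalPeriod Δ.nxt d := by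
    rw [h1, Finset.card_image_of_injOn, Finset.card_range]
    rwa [Finset.coe_range]
  rw [h2]
  exact ⟨h1, Function.iterate_minimalPeriod, hinj⟩

variable (hγ : ∀ a b : ℤ, P.nd (γ a) (γ b) = (b - a).natAbs) {C : ℕ}
    (hC : ∀ h, ∀ r ∈ P.rels, ∀ a b : ℤ, γ a ∈ relatorCycle P h r → γ b ∈ relatorCycle P h r →
      b - a ≤ C)

include hγ hC

/-- A good dart of the geodesic lies on a face with five runs, four of which are interior. -/
lemma five_runs {x : D} (hx : x ∈ Δ.K) (hV : x ∈ Δ.V) (hb : x ∉ Δ.bad) :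
    Δ.nxt^[5] (Δ.opp x) = Δ.opp x ∧
      Δ.len (Δ.nxt^[2] (Δ.opp x)) + Δ.len (Δ.nxt^[3] (Δ.opp x)) + 1 ≤ Δ.len x ∧
      2 * Δ.len (Δ.nxt^[1] (Δ.opp x)) ≤ C ∧ 2 * Δ.len (Δ.nxt^[4] (Δ.opp x)) ≤ C := by
  have hb' : ¬ (_ ∨ _) := fun h => hb (Finset.mem_filter.2 ⟨Finset.mem_filter.2 ⟨hx, hV⟩, h⟩)
  push Not at hb'
  obtain ⟨h1, h2, -⟩ := hb'
  set d := Δ.opp x with hd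
  have hdK : d ∈ Δ.K := opp_mem_K hG x
  have hdV : Δ.α d ∈ Δ.V := (α_opp_mem_V hG x).2 hV
  have h3 := runs_face hG hγ hC (i := Δ.fc d) (by omega) (Δ.fc_le d)
  obtain ⟨ho, he⟩ := h3.2.1 (by omega)
  have h4 := Finset.card_filter_add_card_filter_not (s := Δ.K.filter fun e => Δ.fc e = Δ.fc d)
    (fun d => Δ.α d ∈ Δ.V)
  rw [Finset.filter_filter, Finset.filter_filter] at h4
  change Δ.eRuns _ + Δ.oRuns _ = _ at h4
  rw [ho, he] at h4
  obtain ⟨h5, h6, h7⟩ := face_eq_image hG hdK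
  rw [← h4] at h5 h6 h7
  have hmem : ∀ t, 1 ≤ t → t < 5 → Δ.α (Δ.nxt^[t] d) ∉ Δ.V := by
    intro t ht1 ht5 h
    obtain ⟨y, hy⟩ := Finset.card_eq_one.1 he
    have h8 : d ∈ ({y} : Finset D) := by rw [← hy]; simp [hdK, hdV]
    have h9 : Δ.nxt^[t] d ∈ ({y} : Finset D) := by
      rw [← hy]
      simp [iterate_nxt_mem_K hG hdK, fc_iterate_nxt, h]
    rw [Finset.mem_singleton] at h8 h9
    have := @h7 t (by simp only [Set.mem_Iio]; omega) 0 (by simp) (h9.trans h8.symm)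
    omega
  have hlen : ∀ t, 1 ≤ t → t < 5 → 6 * Δ.len (Δ.nxt^[t] d) < Δ.size d := by
    intro t ht1 ht5
    rw [← Δ.size_congr (fc_iterate_nxt d t)]
    exact six_mul_len_lt (by rwa [fc_iterate_nxt]) (hmem t ht1 ht5)
  have hsum := sum_len_face hG d
  rw [h5, Finset.sum_image (by simpa using h7)] at hsum
  simp only [Nat.reduceAdd, Finset.sum_range_succ, Finset.sum_range_zero] at hsum
  have hlx : Δ.len (Δ.nxt^[0] d) = Δ.len x := len_opp hG hx
  have hlC := (len_le_card_α_mem_V hG hdK hdV).trans (card_α_mem_V_le hγ hC h1).2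
  change Δ.len (Δ.nxt^[0] d) ≤ C at hlC
  have a1 := hlen 1 (by omega) (by omega)
  have a2 := hlen 2 (by omega) (by omega)
  have a3 := hlen 3 (by omega) (by omega)
  have a4 := hlen 4 (by omega) (by omega)
  refine ⟨h6, ?_, ?_, ?_⟩ <;> omega

omit hγ hC in
lemma pos_iterate_two_eq {x : D} (hx' : Δ.nxt x ∈ Δ.V) (hb : Δ.nxt x ∉ Δ.bad)
    (h5 : Δ.nxt^[5] (Δ.opp x) = Δ.opp x) :
    Δ.pos (Δ.nxt^[2] (Δ.opp (Δ.nxt x))) = Δ.pos (Δ.nxt^[4] (Δ.opp x)) := by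
  have hK := nxt_mem_K hG x
  have hb' : ¬ (_ ∨ _) := fun h => hb (Finset.mem_filter.2 ⟨Finset.mem_filter.2 ⟨hK, hx'⟩, h⟩)
  simp only [not_or, deg4, Finset.mem_filter, Finset.mem_univ, true_and] at hb'
  obtain ⟨-, -, h1, h2, h3⟩ := hb'
  have h4 := Δ.rot_ne h2
  have h6 : Δ.rot (Δ.rot (Δ.nxt x)) ≠ Δ.nxt x := fun h => Δ.not_mem_K.2 ⟨h4, h, h2, h3⟩ hK
  have h7 : Δ.rot (Δ.rot (Δ.rot (Δ.nxt x))) = Δ.nxt x := by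
    by_contra h
    exact h1 ⟨h4, h6, h⟩
  have h8 : Δ.rot (Δ.rot (Δ.nxt x)) = Δ.opp x := Δ.rot_injective (by rw [h7, rot_opp hG])
  have h9 : Δ.rot (Δ.opp (Δ.nxt^[4] (Δ.opp x))) = Δ.opp x := by
    rw [rot_opp hG]
    exact h5
  have h10 : Δ.nxt (Δ.opp (Δ.nxt x)) = Δ.opp (Δ.nxt^[4] (Δ.opp x)) := by
    rw [nxt_opp hG hK]
    exact Δ.rot_injective (h8.trans h9.symm)
  change Δ.pos (Δ.nxt (Δ.nxt (Δ.opp (Δ.nxt x)))) = _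
  rw [← pos_opp hG, h10, opp_opp hG (iterate_nxt_mem_K hG (opp_mem_K hG x) 4)]

/-- A chain of consecutive good darts of the geodesic has bounded length. -/
lemma chain_le {x : D} (hx : x ∈ Δ.K) {M : ℕ}
    (h : ∀ j < M, Δ.nxt^[j] x ∈ Δ.V ∧ Δ.nxt^[j] x ∉ Δ.bad) : M ≤ C := by
  rcases M with _ | M
  · omega
  have hinj := injective_of_nd hγ
  have hxK := iterate_nxt_mem_K hG hx
  have h5 : ∀ j ≤ M, _ := fun j hj =>
    five_runs hG hγ hC (hxK j) (h j (by omega)).1 (h j (by omega)).2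
  have hnxt : ∀ d, P.nd (Δ.pos d) (Δ.pos (Δ.nxt d)) ≤ Δ.len d := fun d => Δ.wordLength_pos_nxt_le d
  have hstep : ∀ j ≤ M, P.nd (Δ.pos x) (Δ.pos (Δ.nxt^[4] (Δ.opp (Δ.nxt^[j] x)))) + 1 ≤
      P.nd (Δ.pos x) (Δ.pos (Δ.nxt^[2] (Δ.opp (Δ.nxt^[j] x)))) + Δ.len (Δ.nxt^[j] x) := by
    intro j hj
    have h1 := hnxt (Δ.nxt^[2] (Δ.opp (Δ.nxt^[j] x)))
    have h2 := hnxt (Δ.nxt^[3] (Δ.opp (Δ.nxt^[j] x)))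
    have h3 := P.nd_triangle (Δ.pos x) (Δ.pos (Δ.nxt^[2] (Δ.opp (Δ.nxt^[j] x))))
      (Δ.pos (Δ.nxt^[3] (Δ.opp (Δ.nxt^[j] x))))
    have h4 := P.nd_triangle (Δ.pos x) (Δ.pos (Δ.nxt^[3] (Δ.opp (Δ.nxt^[j] x))))
      (Δ.pos (Δ.nxt^[4] (Δ.opp (Δ.nxt^[j] x))))
    have h5 := (h5 j hj).2.1
    change P.nd _ (Δ.pos (Δ.nxt^[3] (Δ.opp (Δ.nxt^[j] x)))) ≤ _ at h1
    change P.nd _ (Δ.pos (Δ.nxt^[4] (Δ.opp (Δ.nxt^[j] x)))) ≤ _ at h2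
    omega
  have hpath : ∀ j ≤ M, P.nd (Δ.pos x) (Δ.pos (Δ.nxt^[4] (Δ.opp (Δ.nxt^[j] x)))) + (j + 1) ≤
      Δ.len (Δ.nxt^[1] (Δ.opp x)) + ∑ i ∈ Finset.range (j + 1), Δ.len (Δ.nxt^[i] x) := by
    intro j hj
    have h6 := hstep j hj
    induction j with
    | zero =>
      have h1 := hnxt (Δ.nxt^[1] (Δ.opp x))
      have h2 : Δ.pos (Δ.nxt^[1] (Δ.opp x)) = Δ.pos x := by
        rw [Function.iterate_one, nxt_opp hG hx, pos_rot]
      rw [h2] at h1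
      change P.nd _ (Δ.pos (Δ.nxt^[2] (Δ.opp (Δ.nxt^[0] x)))) ≤ _ at h1
      simp only [zero_add, Finset.sum_range_one]
      omega
    | succ j ih =>
      have h1 := ih (by omega) (hstep j (by omega))
      have h7 := h (j + 1) (by omega)
      have h2 := pos_iterate_two_eq hG
        (by rw [← Function.iterate_succ_apply' Δ.nxt]; exact h7.1)
        (by rw [← Function.iterate_succ_apply' Δ.nxt]; exact h7.2) (h5 j (by omega)).1
      rw [← Function.iterate_succ_apply' Δ.nxt] at h2
      rw [h2] at h6
      rw [Finset.sum_range_succ]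
      omega
  have hidx : ∀ j ≤ M, Δ.idx (Δ.nxt^[j] x) =
      Δ.idx x + ∑ i ∈ Finset.range j, Δ.len (Δ.nxt^[i] x) := by
    intro j hj
    induction j with
    | zero => simp
    | succ j ih =>
      have h1 := (h (j + 1) (by omega)).1
      rw [Function.iterate_succ_apply'] at h1 ⊢
      rw [idx_nxt hG hinj (h j (by omega)).1 h1, ih (by omega), Finset.sum_range_succ, add_assoc]
  have h1 := hpath M le_rfl
  have h2 := hnxt (Δ.nxt^[4] (Δ.opp (Δ.nxt^[M] x)))
  have h3 : Δ.pos (Δ.nxt (Δ.nxt^[4] (Δ.opp (Δ.nxt^[M] x)))) = Δ.pos (Δ.nxt (Δ.nxt^[M] x)) := by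
    rw [← Function.iterate_succ_apply' Δ.nxt, (h5 M le_rfl).1, pos_opp hG]
  have h4 := P.nd_triangle (Δ.pos x) (Δ.pos (Δ.nxt^[4] (Δ.opp (Δ.nxt^[M] x))))
    (Δ.pos (Δ.nxt (Δ.nxt^[M] x)))
  have h6 : P.nd (Δ.pos x) (Δ.pos (Δ.nxt (Δ.nxt^[M] x))) =
      ∑ i ∈ Finset.range (M + 1), Δ.len (Δ.nxt^[i] x) := by
    rw [pos_nxt_of_mem_V hG hinj (h M (by omega)).1, Δ.V_pos x (h 0 (by omega)).1, hγ,
      hidx M le_rfl, Finset.sum_range_succ]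
    omega
  have h7 := (h5 0 (by omega)).2.2.1
  have h8 := (h5 M le_rfl).2.2.2
  rw [h3] at h2
  simp only [Function.iterate_zero, id_eq] at h7
  omega

end RDiag

end Runs

end GSC

namespace GSC

section Runs

variable {S : Type} {P : C6Presentation S} {γ : ℤ → P.Grp} {s : ℤ} {m k : ℕ} {D : Type}
  [Fintype D] [DecidableEq D]

namespace RDiag

variable {Δ : RDiag P γ s m k D} (hG : Δ.Good)
  (hγ : ∀ a b : ℤ, P.nd (γ a) (γ b) = (b - a).natAbs) {C : ℕ}
  (hC : ∀ h, ∀ r ∈ P.rels, ∀ a b : ℤ, γ a ∈ relatorCycle P h r → γ b ∈ relatorCycle P h r →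
    b - a ≤ C)

include hG hγ

lemma card_exit_le :
    ((Δ.K.filter (· ∈ Δ.V)).filter fun y => Δ.nxt y ∉ Δ.V).card ≤ 1 := by
  have hinj := injective_of_nd hγ
  rw [Finset.card_le_one]
  have key : ∀ y, y ∈ Δ.K → y ∈ Δ.V → Δ.nxt y ∉ Δ.V →
      (Δ.φ ^ (Δ.len y - 1)) y ∈ Δ.V ∧ Δ.idx ((Δ.φ ^ (Δ.len y - 1)) y) + 1 = m ∧
        Δ.φ ((Δ.φ ^ (Δ.len y - 1)) y) = Δ.nxt y := by
    intro y _ hV hn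
    have hl := len_pos hG y
    have h1 := (pow_mem_V y (j := Δ.len y - 1) (by omega)).2 hV
    have h2 : Δ.φ ((Δ.φ ^ (Δ.len y - 1)) y) = Δ.nxt y := by
      rw [nxt, ← Equiv.Perm.mul_apply, ← pow_succ', Nat.sub_add_cancel hl]
    exact ⟨h1, Δ.V_exit _ h1 (by rwa [h2]), h2⟩
  intro y hy z hz
  simp only [Finset.mem_filter] at hy hz
  obtain ⟨a1, a2, a3⟩ := key y hy.1.1 hy.1.2 hy.2
  obtain ⟨b1, b2, b3⟩ := key z hz.1.1 hz.1.2 hz.2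
  have h := Δ.V_inj _ a1 _ b1 (by omega)
  exact nxt_injOn hG hy.1.1 hz.1.1 (by rw [← a3, ← b3, h])

include hC

lemma card_K_inter_V_le [Nonempty D] :
    (Δ.K.filter (· ∈ Δ.V)).card ≤ (C + 1) * (12 * (k + 1) + 1) := by
  set X := (Δ.K.filter (· ∈ Δ.V)).filter fun y => Δ.nxt y ∉ Δ.V with hX
  have h1 : Δ.K.filter (· ∈ Δ.V) ⊆ (Finset.range (C + 1)).biUnion fun j =>
      Δ.K.filter fun x => Δ.nxt^[j] x ∈ Δ.bad ∪ X := by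
    intro x hx
    obtain ⟨hxK, hxV⟩ := Finset.mem_filter.1 hx
    have h2 : ∃ j, j < C + 1 ∧ ¬ (Δ.nxt^[j] x ∈ Δ.V ∧ Δ.nxt^[j] x ∉ Δ.bad) := by
      by_contra! h
      have := chain_le hG hγ hC hxK (M := C + 1) h
      omega
    classical
    obtain ⟨hj, hj'⟩ := Nat.find_spec h2
    have hmin := fun i (hi : i < Nat.find h2) => Nat.find_min h2 hi
    generalize Nat.find h2 = j at *
    simp only [Finset.mem_biUnion, Finset.mem_range, Finset.mem_filter, Finset.mem_union]
    by_cases hb : Δ.nxt^[j] x ∈ Δ.bad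
    · exact ⟨j, hj, hxK, Or.inl hb⟩
    have hV : Δ.nxt^[j] x ∉ Δ.V := fun h => hj' ⟨h, hb⟩
    rcases j with _ | j
    · exact (hV hxV).elim
    have h3 : Δ.nxt^[j] x ∈ Δ.V ∧ Δ.nxt^[j] x ∉ Δ.bad := by
      by_contra h
      exact hmin j (by omega) ⟨by omega, h⟩
    refine ⟨j, by omega, hxK, Or.inr ?_⟩
    rw [hX, Finset.mem_filter, Finset.mem_filter, ← Function.iterate_succ_apply' Δ.nxt]
    exact ⟨⟨iterate_nxt_mem_K hG hxK j, h3.1⟩, hV⟩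
  have h2 : ∀ j ∈ Finset.range (C + 1),
      (Δ.K.filter fun x => Δ.nxt^[j] x ∈ Δ.bad ∪ X).card ≤ 12 * (k + 1) + 1 := by
    intro j _
    have h3 := (Finset.card_le_card_of_injOn (s := Δ.K.filter fun x => Δ.nxt^[j] x ∈ Δ.bad ∪ X)
      (t := Δ.bad ∪ X) Δ.nxt^[j] (fun x hx => (Finset.mem_filter.1 hx).2)
      ((iterate_nxt_injOn hG j).mono fun x hx => (Finset.mem_filter.1 hx).1)).trans
      (Finset.card_union_le _ _)
    have h4 := card_bad_le hG hγ hC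
    have h5 := card_exit_le hG hγ
    rw [← hX] at h5
    omega
  refine (Finset.card_le_card h1).trans (Finset.card_biUnion_le.trans ?_)
  refine (Finset.sum_le_sum h2).trans ?_
  simp

lemma len_le_of_mem_V {x : D} (hx : x ∈ Δ.K) (hV : x ∈ Δ.V) : Δ.len x ≤ C + 1 := by
  have hinj := injective_of_nd hγ
  by_cases hf : Δ.fc (Δ.opp x) = 0
  swap
  · have h1 := (len_le_card_α_mem_V hG (opp_mem_K hG x) ((α_opp_mem_V hG x).2 hV)).trans
      (card_α_mem_V_le hγ hC hf).2
    rw [len_opp hG hx] at h1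
    omega
  rw [fc_opp hG] at hf
  have hα : Δ.α x ∉ Δ.V := by
    intro h
    have h1 : Δ.pos (Δ.α x) = Δ.pos (Δ.φ x) := by rw [Δ.pos_α, Δ.pos_φ]
    have h2 : Δ.pos (Δ.φ (Δ.α x)) = Δ.pos x := Δ.pos_rot x
    rw [Δ.V_pos _ h, Δ.V_pos' _ hV] at h1
    rw [Δ.V_pos' _ h, Δ.V_pos _ hV] at h2
    have h3 := hinj h1
    have h4 := hinj h2
    omega
  obtain ⟨e₀, he₀, p₁, p₂, h1, h2, h3, -⟩ := Δ.part _ hf hα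
  have hl := len_pos hG x
  have h4 : Δ.len x ≤ p₁.length + 1 := by
    by_contra h
    have h5 := Δ.inv_pow_not_mem_K (Δ.pow_not_mem_K x) p₁.length (by omega)
    rw [← h1, inv_pow_apply_pow _ le_rfl, Nat.sub_self] at h5
    exact h5 (Δ.mem_K_of_mem_brk he₀)
  rcases h3 with ⟨r, hr, h3⟩ | ⟨l, h3, -⟩
  · have h5 : Δ.opp x = (Δ.φ ^ (p₁.length - (Δ.len x - 1))) e₀ := by
      rw [opp_eq hG, ← h1, inv_pow_apply_pow _ (by omega)]
    have h6 : orbitWord Δ.φ Δ.lab (p₁.length + 1) e₀ <+: r := by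
      rw [h2]
      refine List.IsPrefix.trans ⟨p₂, ?_⟩ h3
      simp
    have h7 : Δ.pos x ∈ relatorCycle P (Δ.pos e₀) r := by
      refine ⟨_, h6, ?_⟩
      rw [← Δ.pos_pow, pow_succ', Equiv.Perm.mul_apply, h1]
      exact (Δ.pos_rot x).symm
    have h8 : Δ.pos (Δ.nxt x) ∈ relatorCycle P (Δ.pos e₀) r := by
      refine ⟨_, (orbitWord_isPrefix Δ.φ Δ.lab
        (Nat.le_succ_of_le (Nat.sub_le _ (Δ.len x - 1))) _).trans
        h6, ?_⟩
      rw [← Δ.pos_pow, ← h5, pos_opp hG]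
    rw [Δ.V_pos x hV] at h7
    rw [pos_nxt_of_mem_V hG hinj hV] at h8
    have := hC _ _ hr _ _ h7 h8
    omega
  · have h5 := congrArg List.length h3
    simp at h5
    omega

lemma le_of_good [Nonempty D] : m ≤ (C + 1) * (C + 1) * (12 * (k + 1) + 1) := by
  have h1 := sum_len_eq hG Δ.V fun d hd => Δ.V_brk d fun h => hd (Δ.mem_K_of_mem_brk h)
  rw [Δ.V_card] at h1
  rw [← h1]
  calc ∑ d ∈ Δ.K with d ∈ Δ.V, Δ.len d ≤ ∑ d ∈ Δ.K with d ∈ Δ.V, (C + 1) :=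
        Finset.sum_le_sum fun d hd => len_le_of_mem_V hG hγ hC (Finset.mem_filter.1 hd).1
          (Finset.mem_filter.1 hd).2
    _ = (Δ.K.filter (· ∈ Δ.V)).card * (C + 1) := by simp
    _ ≤ (C + 1) * (12 * (k + 1) + 1) * (C + 1) :=
        Nat.mul_le_mul_right _ (card_K_inter_V_le hG hγ hC)
    _ = _ := by ring

end RDiag

end Runs

/-- A segment of a geodesic with bounded intersections with relator cycles cannot be replaced by
few parts of relators. -/
theorem geodesic_le_of_parts {S : Type} [Nonempty S] {P : C6Presentation S} {γ : ℤ → P.Grp}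
    (hγ : ∀ a b : ℤ, P.nd (γ a) (γ b) = (b - a).natAbs) {C : ℕ}
    (hC : ∀ h, ∀ r ∈ P.rels, ∀ a b : ℤ, γ a ∈ relatorCycle P h r → γ b ∈ relatorCycle P h r →
      b - a ≤ C) (s : ℤ) (m : ℕ) (ws : List (Word S)) (hws : ∀ w ∈ ws, IsPart P w)
    (h : (γ s)⁻¹ * γ (s + m) * P.elt ws.flatten = 1) :
    m ≤ (C + 1) * (C + 1) * (12 * (ws.length + 1) + 1) := by
  classical
  rcases Nat.eq_zero_or_pos m with rfl | hm
  · exact Nat.zero_le _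
  have hinj := injective_of_nd hγ
  choose a ha using fun i : ℕ => P.exists_letter_of_wordLength_eq_one
    (g := (γ (s + i))⁻¹ * γ (s + i + 1)) (by
      have := hγ (s + i) (s + i + 1)
      rw [add_sub_cancel_left] at this
      exact this)
  have hv : ∀ n : ℕ, P.elt ((List.range n).map a) = (γ s)⁻¹ * γ (s + n) := by
    intro n
    induction n with
    | zero => simp [P.elt_nil]
    | succ n ih =>
      rw [List.range_succ, List.map_append, P.elt_append, ih, List.map_singleton,
        P.elt_singleton, ha, mul_assoc, mul_inv_cancel_left]
      push_cast
      rw [add_assoc]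
  obtain ⟨ws', hws', lab, α, out, ins, hR⟩ := exists_isReducedDiag P ((List.range m).map a) ws hws
    (by rw [P.elt_append, hv, h])
  have hlen : ((List.range m).map a).length = m := by simp
  obtain ⟨Δ⟩ := hR.nonempty_rdiag (γ := γ) (s := s) hinj (by omega) (by
    intro i hi
    simp [ha])
  rw [hlen, hws'] at Δ
  have : Nonempty (Dart (out :: ins)) :=
    (Finset.card_pos.1 (by rw [Δ.V_card]; exact hm) : Δ.V.Nonempty).to_subtype.map Subtype.val
  exact RDiag.le_of_good (Δ.exists_pow_mem_K hinj hm) hγ hC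

end GSC

namespace GSC

/-- A sequence of integers that is equivariant up to a bounded error and coarsely onto is
bi-Lipschitz up to an additive error. -/
lemma exists_sub_le_of_coarse (τ a : ℤ → ℤ) (E : ℤ)
    (h₁ : ∀ i m, |τ (i + m) - τ i| ≤ a m + E) (h₂ : ∀ i m, a m - E ≤ |τ (i + m) - τ i|)
    (hd : ∀ t, ∃ n, |τ n - t| ≤ E) :
    ∃ K : ℕ, ∀ i j : ℤ, i ≤ j → j - i ≤ K * |τ j - τ i| + K := by
  set J := a 1 + E with hJ
  have hJ0 : 0 ≤ J := (abs_nonneg _).trans (h₁ 0 1)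
  obtain ⟨m, hm0, hm⟩ : ∃ m : ℕ, 0 < m ∧ J + 1 ≤ a m - E := by
    obtain ⟨n, hn⟩ := hd (τ 0 + (J + 3 * E + 1))
    have hb : J + 2 * E + 1 ≤ |τ n - τ 0| := by
      refine le_trans ?_ (le_abs_self _)
      have := (abs_le.1 hn).1
      linarith
    have ha : |τ n - τ 0| ≤ a n.natAbs + E := by
      rcases Int.natAbs_eq n with h | h
      · have := h₁ 0 n.natAbs
        rw [← h] at this ⊢
        rwa [zero_add] at this
      · have := h₁ n n.natAbs
        rwa [show n + (n.natAbs : ℤ) = 0 by omega, abs_sub_comm] at this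
    refine ⟨n.natAbs, Nat.pos_of_ne_zero fun h0 => ?_, by linarith⟩
    rw [Int.natAbs_eq_zero] at h0
    subst h0
    rw [sub_self, abs_zero] at hb
    have := (abs_nonneg _).trans hn
    linarith
  have hlarge (i : ℤ) : J + 1 ≤ |τ (i + m) - τ i| := hm.trans (h₂ i m)
  have hstep (i : ℤ) : |τ (i + 1) - τ i| ≤ J := h₁ i 1
  have hsign (i : ℤ) : (0 < τ (i + m) - τ i ↔ 0 < τ (i + 1 + m) - τ (i + 1)) := by
    have e1 := hlarge i
    have e2 := hlarge (i + 1)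
    have e3 := abs_le.1 (hstep i)
    have e4 := abs_le.1 (hstep (i + m))
    rw [show i + m + 1 = i + 1 + m by ring] at e4
    rw [le_abs] at e1 e2
    constructor <;> intro h <;> omega
  have hsign' (i : ℤ) (n : ℕ) :
      (0 < τ (i + m) - τ i ↔ 0 < τ (i + n + m) - τ (i + n)) := by
    induction n with
    | zero => simp
    | succ n ih =>
      rw [ih, hsign]
      push_cast
      rw [add_assoc i]
  have hlin (i : ℤ) (q : ℕ) : (q : ℤ) ≤ |τ (i + q * m) - τ i| := by
    by_cases hp : 0 < τ (i + m) - τ i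
    · refine le_trans ?_ (le_abs_self _)
      induction q with
      | zero => simp
      | succ q ih =>
        have h3 := (hsign' i (q * m)).1 hp
        have h4 := hlarge (i + (q * m : ℕ))
        rw [abs_of_pos h3] at h4
        push_cast at h4 ⊢
        rw [show i + (q + 1) * (m : ℤ) = i + q * m + m by ring]
        linarith
    · refine le_trans ?_ (neg_le_abs _)
      induction q with
      | zero => simp
      | succ q ih =>
        have h3 := (not_congr (hsign' i (q * m))).1 hp
        have h4 := hlarge (i + (q * m : ℕ))
        rw [abs_of_nonpos (not_lt.1 h3)] at h4
        push_cast at h4 ⊢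
        rw [show i + (q + 1) * (m : ℤ) = i + q * m + m by ring]
        linarith
  have hlip (i : ℤ) (r : ℕ) : |τ (i + r) - τ i| ≤ r * J := by
    induction r with
    | zero => simp
    | succ r ih =>
      have h3 := hstep (i + r)
      have h4 := abs_sub_le (τ (i + r + 1)) (τ (i + r)) (τ i)
      push_cast
      rw [← add_assoc]
      linarith
  refine ⟨m * (m * J.toNat) + m, fun i j hij => ?_⟩
  obtain ⟨d, hd'⟩ := Int.le.dest hij
  have hdm : m * (d / m) + d % m = d := Nat.div_add_mod d m
  have hr : d % m < m := Nat.mod_lt _ hm0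
  set q := d / m
  set r := d % m
  have hj : j = i + q * m + r := by
    rw [← hd', ← hdm]
    push_cast
    ring
  have e1 := hlin i q
  have e2 := hlip (i + q * m) r
  rw [← hj] at e2
  have e3 := abs_sub_le (τ (i + q * m)) (τ j) (τ i)
  rw [abs_sub_comm (τ (i + q * m)) (τ j)] at e3
  have e4 : (r : ℤ) * J ≤ m * J := mul_le_mul_of_nonneg_right (by exact_mod_cast hr.le) hJ0
  have e5 : j - i ≤ m * (|τ j - τ i| + m * J) + m := by
    have : (m : ℤ) * q ≤ m * (|τ j - τ i| + m * J) :=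
      mul_le_mul_of_nonneg_left (by linarith) (by positivity)
    have hr' : (r : ℤ) < m := by exact_mod_cast hr
    rw [hj] at this ⊢
    linarith
  refine e5.trans ?_
  push_cast
  rw [Int.toNat_of_nonneg hJ0]
  have := mul_nonneg (mul_nonneg (Int.natCast_nonneg m) (mul_nonneg (Int.natCast_nonneg m) hJ0))
    (abs_nonneg (τ j - τ i))
  linarith

section Coned

variable {S : Type} (P : C6Presentation S)

lemma isPart_of_isInfix {w r : Word S} (hr : r ∈ P.rels) (hw : w <:+: r) :
    IsPart P w := by
  obtain ⟨u, v, rfl⟩ := hw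
  refine Or.inl ⟨_, P.rotate_mem _ hr u.length, ?_⟩
  rw [List.append_assoc, List.rotate_append_length_eq, List.append_assoc]
  exact List.prefix_append _ _

lemma exists_isPart {x : P.Grp} (hx : x ∈ conedGens P ∨ x⁻¹ ∈ conedGens P) :
    ∃ w, IsPart P w ∧ P.elt w = x := by
  have hletter (hx : x ∈ P.gens ∨ x⁻¹ ∈ P.gens) : ∃ w, IsPart P w ∧ P.elt w = x := by
    obtain ⟨a, rfl⟩ := P.exists_eltL hx
    refine ⟨[a], ?_, P.elt_singleton a⟩
    by_cases h : ∃ r ∈ P.rels, a ∈ r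
    · obtain ⟨r, hr, ha⟩ := h
      exact isPart_of_isInfix P hr ((List.singleton_infix_iff _ _).2 ha)
    · push Not at h
      exact Or.inr ⟨a, rfl, h⟩
  rcases hx with (hx | ⟨r, hr, p, hp, rfl⟩) | (hx | ⟨r, hr, p, hp, hx⟩)
  · exact hletter (Or.inl hx)
  · exact ⟨p, Or.inl ⟨r, hr, hp⟩, rfl⟩
  · exact hletter (Or.inr hx)
  · refine ⟨wordInv p, isPart_of_isInfix P (P.inv_mem r hr) ?_, ?_⟩
    · obtain ⟨v, rfl⟩ := hp
      rw [wordInv_append]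
      exact (List.suffix_append _ _).isInfix
    · rw [P.elt_wordInv, ← hx, inv_inv]

/-- A shortest expression in the coned-off generators, written as a product of parts. -/
lemma exists_parts (z : P.Grp) : ∃ ws : List (Word S), (∀ w ∈ ws, IsPart P w) ∧
    P.elt ws.flatten = z ∧ ws.length = wordLength (conedGens P) z := by
  obtain ⟨l, hl, hmem, rfl⟩ := exists_list_length_eq_wordLength P.closure_conedGens z
  rw [← hl]
  clear hl
  induction l with
  | nil => exact ⟨[], by simp, by simp, rfl⟩
  | cons x l ih =>
    obtain ⟨ws, h1, h2, h3⟩ := ih fun y hy => hmem y (List.mem_cons_of_mem _ hy)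
    obtain ⟨w, hw, rfl⟩ := exists_isPart P (hmem _ List.mem_cons_self)
    refine ⟨w :: ws, ?_, ?_, by simp [h3]⟩
    · simpa [hw] using h1
    · rw [List.flatten_cons, P.elt_append, h2, List.prod_cons]

lemma wordLength_conedGens_le (z : P.Grp) :
    wordLength (conedGens P) z ≤ wordLength P.gens z := by
  obtain ⟨l, hl, hmem, rfl⟩ := exists_list_length_eq_wordLength P.closure_gens z
  rw [← hl]
  exact wordLength_le_of_list _ fun x hx => (hmem x hx).imp Or.inl Or.inl

lemma wdist_conedGens_le (x y : P.Grp) : wdist (conedGens P) x y ≤ wdist P.gens x y :=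
  Nat.cast_le.2 (wordLength_conedGens_le P _)

variable {P}

/-- Relator cycles have diameter at most one in the coned-off space. -/
lemma wdist_conedGens_le_one {h x y : P.Grp} {r : Word S} (hr : r ∈ P.rels)
    (hx : x ∈ relatorCycle P h r) (hy : y ∈ relatorCycle P h r) :
    wdist (conedGens P) x y ≤ 1 := by
  have key : ∀ p q : Word S, p <+: q → q <+: r →
      wdist (conedGens P) (h * P.elt p) (h * P.elt q) ≤ 1 := by
    rintro p _ ⟨u, rfl⟩ ⟨v, rfl⟩
    have hmem : P.elt u ∈ conedGens P := by
      refine Or.inr ⟨_, P.rotate_mem _ hr p.length, u, ?_, rfl⟩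
      rw [List.append_assoc, List.rotate_append_length_eq, List.append_assoc]
      exact List.prefix_append _ _
    have := wordLength_le_of_list (T := conedGens P) [P.elt u] (by simp [hmem])
    rw [List.prod_singleton] at this
    rw [wdist, P.elt_append, ← mul_assoc h, inv_mul_cancel_left]
    exact_mod_cast this
  obtain ⟨p, hp, rfl⟩ := hx
  obtain ⟨q, hq, rfl⟩ := hy
  rcases le_total p.length q.length with h | h
  · exact key p q (List.prefix_of_prefix_length_le hp hq h) hq
  · rw [wdist_comm P.closure_conedGens]
    exact key q p (List.prefix_of_prefix_length_le hq hp h) hp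

/-- A geodesic having bounded intersection with all relator cycles makes linear progress in the
coned-off space. -/
lemma abs_sub_le_of_geodesic [Nonempty S] {γ : ℤ → P.Grp}
    (hγ : ∀ a b : ℤ, P.nd (γ a) (γ b) = (b - a).natAbs) {C : ℕ}
    (hC : ∀ h, ∀ r ∈ P.rels, ∀ a b : ℤ, γ a ∈ relatorCycle P h r → γ b ∈ relatorCycle P h r →
      b - a ≤ C) (s t : ℤ) :
    |t - s| ≤ (C + 1) * (C + 1) * (12 * (wordLength (conedGens P) ((γ s)⁻¹ * γ t) + 1) + 1) := by
  wlog hst : s ≤ t generalizing s t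
  · have := this t s (le_of_not_ge hst)
    rwa [abs_sub_comm, ← wordLength_inv P.closure_conedGens, mul_inv_rev, inv_inv] at this
  obtain ⟨m, rfl⟩ := Int.le.dest hst
  obtain ⟨ws, hws, he, hl⟩ := exists_parts P ((γ (s + m))⁻¹ * γ s)
  have := geodesic_le_of_parts hγ hC s m ws hws (by rw [he]; group)
  rw [hl, ← wordLength_inv P.closure_conedGens, mul_inv_rev, inv_inv] at this
  rw [add_sub_cancel_left, Nat.abs_cast]
  exact_mod_cast this

end Coned

/-- Let `g` be an infinite-order element of a classical C'(1/6) group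
and `γ` a bi-infinite geodesic at finite Hausdorff distance from `⟨g⟩`. Then `g` is
hyperbolic for the action on the coned-off space (i.e. `n ↦ gⁿ` is a quasi-isometric
embedding of `ℤ` into `(G, d_{S∪W})`) iff there is `C > 0` bounding the diameter of
`γ ∩ Γ₀` over all embedded relator cycles `Γ₀`. -/
theorem statement9 {S : Type} (P : C6Presentation S) (g : P.Grp)
    (hg : ¬ IsOfFinOrder g) (γ : Set P.Grp) (hγ : IsBiInfGeodesic P.gens γ)
    (hHd : FinHausdorffDist P.gens γ
      ((Subgroup.zpowers g : Subgroup P.Grp) : Set P.Grp)) :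
    (∃ L A : ℝ, 1 ≤ L ∧ 0 ≤ A ∧ ∀ m n : ℤ,
        L⁻¹ * |(m : ℝ) - (n : ℝ)| - A ≤ wdist (conedGens P) (g ^ m) (g ^ n) ∧
        wdist (conedGens P) (g ^ m) (g ^ n) ≤ L * |(m : ℝ) - (n : ℝ)| + A) ↔
    (∃ C : ℝ, 0 < C ∧ ∀ (h : P.Grp) (r : Word S), r ∈ P.rels →
        ∀ x ∈ γ ∩ relatorCycle P h r, ∀ y ∈ γ ∩ relatorCycle P h r,
          wdist P.gens x y < C) := by
  obtain ⟨γ, hγ, rfl⟩ := hγ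
  obtain ⟨ε, hε₁, hε₂⟩ := hHd
  have hcl := P.closure_gens
  have hcl' := P.closure_conedGens
  constructor
  · rintro ⟨L, A, hL, hA, hLA⟩
    have hε : 0 ≤ ε := by
      obtain ⟨b, -, hb⟩ := hε₁ _ ⟨0, rfl⟩
      exact (wdist_nonneg _ _).trans hb
    refine ⟨2 * ε + L * (1 + 2 * ε + A) * wordLength P.gens g + 1, by positivity, ?_⟩
    rintro h r hr x ⟨hxγ, hx⟩ y ⟨hyγ, hy⟩
    obtain ⟨_, ⟨m, rfl⟩, hm⟩ := hε₁ x hxγ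
    obtain ⟨_, ⟨n, rfl⟩, hn⟩ := hε₁ y hyγ
    simp only at hm hn
    have h1 := wdist_conedGens_le_one hr hx hy
    have h2 : wdist (conedGens P) (g ^ m) (g ^ n) ≤ 1 + 2 * ε := by
      have e1 := wdist_triangle hcl' (g ^ m) x (g ^ n)
      have e2 := wdist_triangle hcl' x y (g ^ n)
      have e3 := wdist_conedGens_le P x (g ^ m)
      have e4 := wdist_conedGens_le P y (g ^ n)
      rw [wdist_comm hcl' (g ^ m) x] at e1
      linarith
    have h3 : |(m : ℝ) - n| ≤ L * (1 + 2 * ε + A) := by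
      have := (hLA m n).1
      rw [← inv_mul_le_iff₀ (by linarith)]
      linarith
    have h4 : wdist P.gens (g ^ m) (g ^ n) ≤ |(m : ℝ) - n| * wordLength P.gens g := by
      rw [wdist_comm hcl, wdist, ← zpow_neg, ← zpow_add, neg_add_eq_sub]
      have := wordLength_zpow_le hcl g (m - n)
      rw [← Int.cast_sub, ← Int.cast_abs, Int.abs_eq_natAbs]
      exact_mod_cast this
    have h5 := mul_le_mul_of_nonneg_right h3 (Nat.cast_nonneg (α := ℝ) (wordLength P.gens g))
    have e1 := wdist_triangle hcl x (g ^ m) y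
    have e2 := wdist_triangle hcl (g ^ m) (g ^ n) y
    rw [wdist_comm hcl (g ^ n) y] at e2
    linarith
  · rintro ⟨C, -, hC⟩
    have hnd : ∀ a b : ℤ, P.nd (γ a) (γ b) = (b - a).natAbs := by
      intro a b
      have := hγ a b
      change (P.nd (γ a) (γ b) : ℝ) = _ at this
      rw [abs_sub_comm, ← Int.cast_sub, ← Int.cast_abs, Int.abs_eq_natAbs] at this
      exact_mod_cast this
    have hne : Nonempty S := by
      have h1 : P.nd (γ 0) (γ 1) = 1 := by simp [hnd]
      obtain ⟨a, -⟩ := P.exists_letter_of_wordLength_eq_one h1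
      exact ⟨a.1⟩
    have hC' : ∀ h, ∀ r ∈ P.rels, ∀ a b : ℤ, γ a ∈ relatorCycle P h r →
        γ b ∈ relatorCycle P h r → b - a ≤ ⌈C⌉₊ := by
      intro h r hr a b ha hb
      have h1 := (hC h r hr _ ⟨⟨a, rfl⟩, ha⟩ _ ⟨⟨b, rfl⟩, hb⟩).le
      rw [hγ] at h1
      have h2 : (b : ℝ) - a ≤ ⌈C⌉₊ := by
        have := neg_le_abs ((a : ℝ) - b)
        linarith [Nat.le_ceil C]
      exact_mod_cast h2
    set N := ⌈ε⌉₊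
    have hN {x y : P.Grp} (h : wdist P.gens x y ≤ ε) : P.nd x y ≤ N := by
      have : (P.nd x y : ℝ) ≤ N := h.trans (Nat.le_ceil ε)
      exact_mod_cast this
    have hproj (n : ℤ) : ∃ t, P.nd (γ t) (g ^ n) ≤ N := by
      obtain ⟨_, ⟨t, rfl⟩, ht⟩ := hε₂ (g ^ n) ⟨n, rfl⟩
      exact ⟨t, hN ht⟩
    choose τ hτ using hproj
    have habs (s t : ℤ) : |t - s| = P.nd (γ s) (γ t) := by rw [hnd, Int.abs_eq_natAbs]
    have hpow (i m : ℤ) : P.nd (g ^ i) (g ^ (i + m)) = wordLength P.gens (g ^ m) := by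
      rw [C6Presentation.nd, zpow_add, inv_mul_cancel_left]
    obtain ⟨K, hK⟩ := exists_sub_le_of_coarse τ (fun m => wordLength P.gens (g ^ m)) (2 * N)
      (fun i m => by
        have h1 := P.nd_triangle (γ (τ i)) (g ^ i) (γ (τ (i + m)))
        have h2 := P.nd_triangle (g ^ i) (g ^ (i + m)) (γ (τ (i + m)))
        rw [P.nd_comm (g ^ (i + m)) (γ _)] at h2
        have h3 := hτ i
        have h4 := hτ (i + m)
        rw [hpow] at h2
        rw [habs]
        omega)
      (fun i m => by
        have h1 := P.nd_triangle (g ^ i) (γ (τ i)) (g ^ (i + m))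
        have h2 := P.nd_triangle (γ (τ i)) (γ (τ (i + m))) (g ^ (i + m))
        rw [P.nd_comm (g ^ i) (γ _), hpow] at h1
        have h3 := hτ i
        have h4 := hτ (i + m)
        rw [habs]
        omega)
      (fun t => by
        obtain ⟨_, ⟨n, rfl⟩, hn⟩ := hε₁ (γ t) ⟨t, rfl⟩
        simp only at hn
        refine ⟨n, ?_⟩
        have h1 := hN hn
        have h2 := hτ n
        have h3 := P.nd_triangle (γ t) (g ^ n) (γ (τ n))
        rw [P.nd_comm (g ^ n) (γ _)] at h3
        rw [habs]
        omega)
    set M := (⌈C⌉₊ + 1) * (⌈C⌉₊ + 1) with hM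
    set ℓ := wordLength P.gens g
    have hmain (i j : ℤ) : |j - i| ≤
        (K * M * 12) * wordLength (conedGens P) ((g ^ i)⁻¹ * g ^ j) +
          (K * M * (24 * N + 13) + K) := by
      wlog hij : i ≤ j generalizing i j
      · have := this j i (le_of_not_ge hij)
        rwa [abs_sub_comm, ← wordLength_inv hcl', mul_inv_rev, inv_inv] at this
      rw [abs_of_nonneg (sub_nonneg.2 hij)]
      have h1 := abs_sub_le_of_geodesic hnd hC' (τ i) (τ j)
      have h2 : wordLength (conedGens P) ((γ (τ i))⁻¹ * γ (τ j)) ≤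
          2 * N + wordLength (conedGens P) ((g ^ i)⁻¹ * g ^ j) := by
        have e1 := wordLength_mul_le hcl' ((γ (τ i))⁻¹ * g ^ i) ((g ^ i)⁻¹ * γ (τ j))
        have e2 := wordLength_mul_le hcl' ((g ^ i)⁻¹ * g ^ j) ((g ^ j)⁻¹ * γ (τ j))
        rw [mul_assoc, mul_inv_cancel_left] at e1 e2
        have e3 := (wordLength_conedGens_le P _).trans (hτ i)
        have e4 := (wordLength_conedGens_le P _).trans ((P.nd_comm _ _).trans_le (hτ j))
        omega
      have h3 := hK i j hij
      have h4 : (K : ℤ) * |τ j - τ i| ≤ K * (M * (12 * (2 * N +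
          wordLength (conedGens P) ((g ^ i)⁻¹ * g ^ j) + 1) + 1)) := by
        refine mul_le_mul_of_nonneg_left (h1.trans ?_) (by positivity)
        rw [hM]
        push_cast
        gcongr
        exact_mod_cast h2
      linarith
    refine ⟨K * M * 12 + ℓ + 1, K * M * (24 * N + 13) + K, ?_, by positivity, fun m n => ⟨?_, ?_⟩⟩
    · have : (0 : ℝ) ≤ K * M * 12 + ℓ := by positivity
      linarith
    · have h1 : |(m : ℝ) - n| ≤ (K * M * 12) * wdist (conedGens P) (g ^ m) (g ^ n) +
          (K * M * (24 * N + 13) + K) := by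
        rw [abs_sub_comm, wdist]
        exact_mod_cast hmain m n
      have hA : (0 : ℝ) ≤ K * M * (24 * N + 13) + K := by positivity
      set A : ℝ := K * M * (24 * N + 13) + K
      have hd : 0 ≤ wdist (conedGens P) (g ^ m) (g ^ n) := wdist_nonneg _ _
      rw [sub_le_iff_le_add, inv_mul_le_iff₀ (by positivity)]
      have h2 : (0 : ℝ) ≤ ℓ + 1 := by positivity
      have h3 : (0 : ℝ) ≤ K * M * 12 + ℓ := by positivity
      have h4 := mul_nonneg h2 hd
      have h5 := mul_nonneg h3 hA
      linarith
    · have h1 : wdist (conedGens P) (g ^ m) (g ^ n) ≤ |(m : ℝ) - n| * ℓ := by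
        rw [wdist_comm hcl']
        refine (wdist_conedGens_le P _ _).trans ?_
        rw [wdist, ← zpow_neg, ← zpow_add, neg_add_eq_sub]
        have := wordLength_zpow_le hcl g (m - n)
        rw [← Int.cast_sub, ← Int.cast_abs, Int.abs_eq_natAbs]
        exact_mod_cast this
      have h2 : (0 : ℝ) ≤ K * M * 12 + 1 := by positivity
      have h3 := mul_nonneg h2 (abs_nonneg ((m : ℝ) - n))
      have h4 : (0 : ℝ) ≤ K * M * (24 * N + 13) + K := by positivity
      linarith

end GSC
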